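/- arXiv:2003.03661 — 3 statements merged into one kernel-verified Lean document; each statement's English description precedes it below -/
import Mathlib

section
/- For every positive integer n, there are infinitely many positive integers x such that ω(x) = ω(x + n), where ω(x) denotes the number of distinct prime factors of x. -/
theorem card_dvd_linear_bounds (N q α β : ℕ) (hq : 0 < q) (hα : α.Coprime q) :
    (N : ℝ) / q - 1 ≤ (((Finset.Ioc 0 N).filter (fun m => q ∣ α * m + β)).card : ℝ) ∧
    (((Finset.Ioc 0 N).filter (fun m => q ∣ α * m + β)).card : ℝ) ≤ (N : ℝ) / q + 1 := by
  have : NeZero q := ⟨hq.ne'⟩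
  set v : ℕ := (-(β : ZMod q) * (α : ZMod q)⁻¹).val with hv
  have hvz : ((v : ℕ) : ZMod q) = -(β : ZMod q) * (α : ZMod q)⁻¹ := by
    rw [hv, ZMod.natCast_zmod_val]
  have hu : (α : ZMod q) * (α : ZMod q)⁻¹ = 1 := ZMod.coe_mul_inv_eq_one α hα
  have hiff : ∀ m : ℕ, q ∣ α * m + β ↔ m ≡ v [MOD q] := by
    intro m
    rw [← ZMod.natCast_eq_zero_iff, ← ZMod.natCast_eq_natCast_iff, hvz]
    push_cast
    constructor
    · intro h
      linear_combination (α : ZMod q)⁻¹ * h - (m : ZMod q) * hu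
    · intro h
      linear_combination (α : ZMod q) * h - (β : ZMod q) * hu
  simp only [hiff]
  have h := Nat.Ioc_filter_modEq_card 0 N hq v
  set c := ((Finset.Ioc 0 N).filter (fun m => m ≡ v [MOD q])).card
  have hqQ : (0 : ℚ) < q := by exact_mod_cast hq
  have e : ((N : ℚ) - v) / q - ((0 : ℕ) - (v : ℚ)) / q = N / q := by
    push_cast; field_simp; ring
  have f1 := Int.floor_le (((N : ℚ) - v) / q)
  have f2 := Int.lt_floor_add_one (((N : ℚ) - v) / q)
  have f3 := Int.floor_le ((((0 : ℕ) : ℚ) - v) / q)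
  have f4 := Int.lt_floor_add_one ((((0 : ℕ) : ℚ) - v) / q)
  have hN : (0 : ℚ) ≤ N / q := by positivity
  have hc : (c : ℚ) = max ((⌊((N : ℚ) - v) / q⌋ : ℚ) - ⌊(((0 : ℕ) : ℚ) - v) / q⌋) 0 := by
    exact_mod_cast h
  have r1 : (N : ℚ) / q - 1 ≤ c := by
    rw [hc]; refine le_trans ?_ (le_max_left _ _); linarith
  have r2 : (c : ℚ) ≤ N / q + 1 := by
    rw [hc]; refine max_le ?_ ?_ <;> linarith
  constructor
  · have := (Rat.cast_le (K := ℝ)).mpr r1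
    push_cast at this
    exact this
  · have := (Rat.cast_le (K := ℝ)).mpr r2
    push_cast at this
    exact this

theorem sum_inv_primes_le (J : ℕ) :
    ∑ p ∈ (Finset.Icc 1 (2 ^ (J + 1))).filter Nat.Prime, (1 : ℝ) / p ≤
      1 + 4 * (harmonic J : ℝ) := by
  induction J with
  | zero =>
    have : (Finset.Icc 1 (2 ^ (0 + 1))).filter Nat.Prime = {2} := by decide
    rw [this]; norm_num [harmonic]
  | succ I ih =>
    set J := I + 1 with hJ
    have hsplit : (Finset.Icc 1 (2 ^ (J + 1))).filter Nat.Prime =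
        (Finset.Icc 1 (2 ^ J)).filter Nat.Prime ∪
          (Finset.Ioc (2 ^ J) (2 ^ (J + 1))).filter Nat.Prime := by
      have h2 : 2 ^ J ≤ 2 ^ (J + 1) := Nat.pow_le_pow_right (by norm_num) (by omega)
      have h1 : 1 ≤ 2 ^ J := Nat.one_le_two_pow
      ext p
      simp only [Finset.mem_filter, Finset.mem_union, Finset.mem_Icc, Finset.mem_Ioc]
      constructor
      · rintro ⟨⟨a, b⟩, c⟩
        by_cases h : p ≤ 2 ^ J
        · exact Or.inl ⟨⟨a, h⟩, c⟩
        · exact Or.inr ⟨⟨by omega, b⟩, c⟩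
      · rintro (⟨⟨a, b⟩, c⟩ | ⟨⟨a, b⟩, c⟩)
        · exact ⟨⟨a, by omega⟩, c⟩
        · exact ⟨⟨by omega, b⟩, c⟩
    have hdisj : Disjoint ((Finset.Icc 1 (2 ^ J)).filter Nat.Prime)
        ((Finset.Ioc (2 ^ J) (2 ^ (J + 1))).filter Nat.Prime) := by
      rw [Finset.disjoint_left]
      simp only [Finset.mem_filter, Finset.mem_Icc, Finset.mem_Ioc]
      rintro p ⟨⟨_, a⟩, _⟩ ⟨⟨b, _⟩, _⟩
      omega
    rw [hsplit, Finset.sum_union hdisj]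
    set S := (Finset.Ioc (2 ^ J) (2 ^ (J + 1))).filter Nat.Prime with hS
    have hcard : J * S.card ≤ 2 ^ (J + 2) := by
      have h1 : (2 ^ J) ^ S.card ≤ ∏ p ∈ S, p := by
        apply Finset.pow_card_le_prod
        intro p hp
        simp only [hS, Finset.mem_filter, Finset.mem_Ioc] at hp
        omega
      have h2 : ∏ p ∈ S, p ≤ primorial (2 ^ (J + 1)) := by
        unfold primorial
        apply Finset.prod_le_prod_of_subset_of_one_le'
        · intro p hp
          simp only [hS, Finset.mem_filter, Finset.mem_Ioc, Finset.mem_range] at hp ⊢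
          exact ⟨by omega, hp.2⟩
        · intro p hp _
          simp only [Finset.mem_filter] at hp
          exact hp.2.one_lt.le
      have h3 := (h1.trans h2).trans (primorial_le_four_pow _)
      rw [show (4 : ℕ) = 2 ^ 2 by norm_num, ← pow_mul, ← pow_mul] at h3
      have h4 := (Nat.pow_le_pow_iff_right (by norm_num : 1 < 2)).mp h3
      calc _ ≤ _ := h4
        _ = _ := by ring
    have hsum : ∑ p ∈ S, (1 : ℝ) / p ≤ S.card * (1 / 2 ^ J : ℝ) := by
      rw [← nsmul_eq_mul]
      apply Finset.sum_le_card_nsmul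
      intro p hp
      simp only [hS, Finset.mem_filter, Finset.mem_Ioc] at hp
      apply one_div_le_one_div_of_le (by positivity)
      exact_mod_cast hp.1.1.le
    have hJr : (0 : ℝ) < J := by rw [hJ]; positivity
    have hcardr : (J : ℝ) * S.card ≤ 2 ^ (J + 2) := by exact_mod_cast hcard
    have hle : (S.card : ℝ) * (1 / 2 ^ J : ℝ) ≤ 4 * (J : ℝ)⁻¹ := by
      rw [mul_one_div, div_le_iff₀ (by positivity), mul_right_comm, ← div_eq_mul_inv,
        le_div_iff₀ hJr]
      calc (S.card : ℝ) * J = J * S.card := by ring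
        _ ≤ _ := hcardr
        _ = _ := by ring
    have hh : (harmonic J : ℝ) = harmonic I + (J : ℝ)⁻¹ := by
      rw [hJ, harmonic_succ]; push_cast; ring
    rw [hh]
    linarith

theorem sum_inv_primes_le_of_double_exp (F : ℕ) :
    ∑ p ∈ (Finset.Icc 1 (2 ^ 2 ^ F)).filter Nat.Prime, (1 : ℝ) / p ≤ 4 * F + 5 := by
  have hsub : ∑ p ∈ (Finset.Icc 1 (2 ^ 2 ^ F)).filter Nat.Prime, (1 : ℝ) / p ≤
      ∑ p ∈ (Finset.Icc 1 (2 ^ (2 ^ F + 1))).filter Nat.Prime, (1 : ℝ) / p := by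
    apply Finset.sum_le_sum_of_subset_of_nonneg
    · apply Finset.filter_subset_filter
      apply Finset.Icc_subset_Icc le_rfl
      exact Nat.pow_le_pow_right (by norm_num) (by omega)
    · intros; positivity
  have h1 := sum_inv_primes_le (2 ^ F)
  have h2 := harmonic_le_one_add_log (2 ^ F)
  have h3 : Real.log ((2 ^ F : ℕ) : ℝ) ≤ F := by
    push_cast
    rw [Real.log_pow]
    have : Real.log 2 ≤ 1 := by
      have := Real.log_two_lt_d9; linarith
    nlinarith [(Nat.cast_nonneg F : (0 : ℝ) ≤ F)]
  linarith

theorem sum_sq_card_dvd_sub_le (y α β : ℕ) (hy : 0 < y) (P : Finset ℕ)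
    (hP : ∀ p ∈ P, p.Prime) (hPy : ∀ p ∈ P, p ≤ y) (hα : ∀ p ∈ P, ¬ p ∣ α) :
    ∑ m ∈ Finset.Ioc 0 (y ^ 2),
      (((P.filter (· ∣ α * m + β)).card : ℝ) - ∑ p ∈ P, (1 : ℝ) / p) ^ 2 ≤
      (y : ℝ) ^ 2 * (3 * (∑ p ∈ P, (1 : ℝ) / p) + 1) := by
  classical
  set μ : ℝ := ∑ p ∈ P, (1 : ℝ) / p with hμ
  set I := Finset.Ioc 0 (y ^ 2) with hI
  set f : ℕ → ℕ → ℝ := fun p m => if p ∣ α * m + β then 1 else 0 with hf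
  have hμ0 : 0 ≤ μ := Finset.sum_nonneg (fun p _ => by positivity)
  have hcop : ∀ p ∈ P, α.Coprime p := fun p hp =>
    ((Nat.Prime.coprime_iff_not_dvd (hP p hp)).mpr (hα p hp)).symm
  have hS : ∀ m, ((P.filter (· ∣ α * m + β)).card : ℝ) = ∑ p ∈ P, f p m := by
    intro m
    simp [hf]
  have hPc : (P.card : ℝ) ≤ y := by
    have : P ⊆ Finset.Icc 1 y := by
      intro p hp
      exact Finset.mem_Icc.mpr ⟨(hP p hp).one_lt.le, hPy p hp⟩
    have := Finset.card_le_card this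
    simp at this
    exact_mod_cast this
  have hcnt : ∀ q, ∑ m ∈ I, (if q ∣ α * m + β then (1 : ℝ) else 0) =
      ((I.filter (fun m => q ∣ α * m + β)).card : ℝ) := by
    intro q; simp
  have h1 : (y : ℝ) ^ 2 * μ - y ≤ ∑ m ∈ I, ∑ p ∈ P, f p m := by
    rw [Finset.sum_comm]
    have : ∑ p ∈ P, ((y : ℝ) ^ 2 * (1 / p) - 1) ≤ ∑ p ∈ P, ∑ m ∈ I, f p m := by
      apply Finset.sum_le_sum
      intro p hp
      rw [hcnt p]
      have := (card_dvd_linear_bounds (y ^ 2) p α β (hP p hp).pos (hcop p hp)).1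
      push_cast at this
      rw [mul_one_div]
      exact this
    rw [Finset.sum_sub_distrib, ← Finset.mul_sum, ← hμ] at this
    simp at this
    linarith
  have hpair : ∀ p ∈ P, ∀ q ∈ P, ∑ m ∈ I, f p m * f q m ≤
      (y : ℝ) ^ 2 * (1 / p * (1 / q)) + (if p = q then (y : ℝ) ^ 2 * (1 / p) else 0) + 1 := by
    intro p hp q hq
    by_cases hpq : p = q
    · subst hpq
      have e : ∀ m, f p m * f p m = f p m := by
        intro m; simp only [hf]; split_ifs <;> simp
      simp only [e, if_true]
      rw [hcnt p]
      have := (card_dvd_linear_bounds (y ^ 2) p α β (hP p hp).pos (hcop p hp)).2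
      push_cast at this
      have h0 : 0 ≤ (y : ℝ) ^ 2 * (1 / p * (1 / p)) := by positivity
      have h1' : (y : ℝ) ^ 2 * (1 / p) = (y : ℝ) ^ 2 / p := mul_one_div _ _
      linarith
    · have hc : p.Coprime q := (Nat.coprime_primes (hP p hp) (hP q hq)).mpr hpq
      have e : ∀ m, f p m * f q m = if p * q ∣ α * m + β then 1 else 0 := by
        intro m
        have : p * q ∣ α * m + β ↔ p ∣ α * m + β ∧ q ∣ α * m + β :=
          ⟨fun h => ⟨(dvd_mul_right _ _).trans h, (dvd_mul_left _ _).trans h⟩,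
            fun h => hc.mul_dvd_of_dvd_of_dvd h.1 h.2⟩
        simp only [hf, this]
        by_cases a : p ∣ α * m + β <;> by_cases b : q ∣ α * m + β <;> simp [a, b]
      simp only [e, if_neg hpq]
      rw [hcnt (p * q)]
      have := (card_dvd_linear_bounds (y ^ 2) (p * q) α β
        (Nat.mul_pos (hP p hp).pos (hP q hq).pos)
        (Nat.Coprime.mul_right (hcop p hp) (hcop q hq))).2
      push_cast at this
      rw [one_div_mul_one_div, mul_one_div]
      linarith
  have h2 : ∑ m ∈ I, (∑ p ∈ P, f p m) ^ 2 ≤ (y : ℝ) ^ 2 * μ ^ 2 + (y : ℝ) ^ 2 * μ + y ^ 2 := by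
    have e1 : ∑ m ∈ I, (∑ p ∈ P, f p m) ^ 2 = ∑ p ∈ P, ∑ q ∈ P, ∑ m ∈ I, f p m * f q m := by
      simp_rw [sq, Finset.sum_mul_sum]
      rw [Finset.sum_comm]
      refine Finset.sum_congr rfl fun p _ => ?_
      rw [Finset.sum_comm]
    have e2 : ∑ p ∈ P, ∑ q ∈ P, ((y : ℝ) ^ 2 * (1 / p * (1 / q)) +
        (if p = q then (y : ℝ) ^ 2 * (1 / p) else 0) + 1) =
        (y : ℝ) ^ 2 * μ ^ 2 + (y : ℝ) ^ 2 * μ + (P.card : ℝ) ^ 2 := by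
      simp_rw [Finset.sum_add_distrib, ← Finset.mul_sum]
      rw [sq μ, hμ, Finset.sum_mul_sum, Finset.mul_sum (s := P)
        (f := fun p : ℕ => (1 : ℝ) / p) (a := (y : ℝ) ^ 2)]
      congr 1
      · congr 1
        · simp_rw [Finset.mul_sum]
        · refine Finset.sum_congr rfl fun p hp => ?_
          rw [Finset.sum_ite_eq]; simp [hp]
      · simp [sq]
    rw [e1]
    refine (Finset.sum_le_sum fun p hp => Finset.sum_le_sum fun q hq => hpair p hp q hq).trans ?_
    rw [e2]
    have : (P.card : ℝ) ^ 2 ≤ (y : ℝ) ^ 2 := by gcongr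
    linarith
  have e3 : ∑ m ∈ I, (∑ p ∈ P, f p m - μ) ^ 2 =
      ∑ m ∈ I, (∑ p ∈ P, f p m) ^ 2 - 2 * μ * ∑ m ∈ I, ∑ p ∈ P, f p m + (y : ℝ) ^ 2 * μ ^ 2 := by
    have : ∀ m, (∑ p ∈ P, f p m - μ) ^ 2 =
        (∑ p ∈ P, f p m) ^ 2 - 2 * μ * (∑ p ∈ P, f p m) + μ ^ 2 := by intro m; ring
    simp_rw [this]
    rw [Finset.sum_add_distrib, Finset.sum_sub_distrib, ← Finset.mul_sum]
    simp [hI]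
  simp_rw [hS]
  rw [e3]
  have hy1 : (1 : ℝ) ≤ y := by exact_mod_cast hy
  have hyy : (y : ℝ) ≤ (y : ℝ) ^ 2 := by nlinarith
  nlinarith [mul_le_mul_of_nonneg_left h1 hμ0, mul_le_mul_of_nonneg_left hyy hμ0]

theorem exists_ne_of_sum_sq_sub_lt (t : ℕ) (v : ℕ → ℕ) (μ : ℝ) (hμ : 0 ≤ μ)
    (h : ∑ i ∈ Finset.range (4 * t), ((v i : ℝ) - μ) ^ 2 < 2 * (t : ℝ) ^ 3) :
    ∃ i < 4 * t, ∃ j < 4 * t, i ≠ j ∧ v i = v j := by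
  classical
  by_contra! hcon
  have hinj : Set.InjOn v (Finset.range (4 * t)) := by
    intro i hi j hj hij
    by_contra hne
    exact hcon i (by simpa using hi) j (by simpa using hj) hne hij
  set A := (Finset.range (4 * t)).filter (fun i => |(v i : ℝ) - μ| < t) with hA
  set B := (Finset.range (4 * t)).filter (fun i => ¬ |(v i : ℝ) - μ| < t) with hB
  have hAB : A.card + B.card = 4 * t := by
    rw [hA, hB, Finset.card_filter_add_card_filter_not, Finset.card_range]
  have hAc : A.card ≤ 2 * t := by
    have hmap : A.card ≤ (Finset.Icc (⌊μ⌋₊ + 1 - t) (⌊μ⌋₊ + t)).card := by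
      apply Finset.card_le_card_of_injOn v
      · intro i hi
        simp only [hA, Finset.coe_filter, Set.mem_ofPred_eq, abs_lt] at hi
        obtain ⟨-, h1, h2⟩ := hi
        have f1 := Nat.floor_le hμ
        have f2 := Nat.lt_floor_add_one μ
        simp only [Finset.coe_Icc, Set.mem_Icc]
        constructor
        · have : (⌊μ⌋₊ : ℝ) < v i + t := by linarith
          have : ⌊μ⌋₊ < v i + t := by exact_mod_cast this
          omega
        · have : (v i : ℝ) < ⌊μ⌋₊ + t + 1 := by linarith
          have : v i < ⌊μ⌋₊ + t + 1 := by exact_mod_cast this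
          omega
      · exact hinj.mono (by intro i hi; exact Finset.mem_coe.mpr (Finset.mem_filter.mp hi).1)
    rw [Nat.card_Icc] at hmap
    omega
  have hBc : (2 * t : ℝ) ≤ B.card := by
    have : 2 * t ≤ B.card := by omega
    exact_mod_cast this
  have hsum : (B.card : ℝ) * (t : ℝ) ^ 2 ≤ ∑ i ∈ B, ((v i : ℝ) - μ) ^ 2 := by
    rw [← nsmul_eq_mul]
    apply Finset.card_nsmul_le_sum
    intro i hi
    simp only [hB, Finset.mem_filter, not_lt] at hi
    rw [← sq_abs ((v i : ℝ) - μ)]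
    gcongr
    exact hi.2
  have hsub : ∑ i ∈ B, ((v i : ℝ) - μ) ^ 2 ≤
      ∑ i ∈ Finset.range (4 * t), ((v i : ℝ) - μ) ^ 2 :=
    Finset.sum_le_sum_of_subset_of_nonneg (Finset.filter_subset _ _)
      (fun i _ _ => sq_nonneg _)
  nlinarith [sq_nonneg (t : ℝ)]

theorem card_large_primeFactors_le_three (y L : ℕ) (hy : 2 ≤ y) (hL0 : L ≠ 0) (hL : L < y ^ 4) :
    (L.primeFactors.filter (fun p => ¬ p ≤ y)).card ≤ 3 := by
  set R := L.primeFactors.filter (fun p => ¬ p ≤ y) with hR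
  have h1 : y ^ R.card ≤ ∏ p ∈ R, p := by
    apply Finset.pow_card_le_prod
    intro p hp
    simp only [hR, Finset.mem_filter, not_le] at hp
    exact hp.2.le
  have h2 : ∏ p ∈ R, p ≤ ∏ p ∈ L.primeFactors, p := by
    apply Finset.prod_le_prod_of_subset_of_one_le' (Finset.filter_subset _ _)
    intro p hp _
    exact (Nat.prime_of_mem_primeFactors hp).one_lt.le
  have h3 := Nat.le_of_dvd (Nat.pos_of_ne_zero hL0) (Nat.prod_primeFactors_dvd L)
  have h4 : y ^ R.card < y ^ 4 := by omega
  have := (Nat.pow_lt_pow_iff_right (by omega : 1 < y)).mp h4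
  omega

theorem exists_linear_forms_collision (F t D : ℕ) (α β : ℕ → ℕ)
    (ht : 48 * F + 100 < t ^ 2)
    (hα : ∀ i < 4 * t, α i ≤ 2 ^ 2 ^ F) (hβ : ∀ i < 4 * t, β i ≤ 2 ^ 2 ^ F)
    (hβ0 : ∀ i < 4 * t, 0 < β i)
    (hD : ∀ i < 4 * t, ∀ p, p.Prime → ¬ p ∣ D → ¬ p ∣ α i) :
    ∃ m, 0 < m ∧ ∃ i < 4 * t, ∃ j < 4 * t, i ≠ j ∧
      ((α i * m + β i).primeFactors.filter (fun p => ¬ p ∣ D)).card =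
      ((α j * m + β j).primeFactors.filter (fun p => ¬ p ∣ D)).card := by
  classical
  set y := 2 ^ 2 ^ F with hy
  have hy2 : 2 ≤ y := by
    calc 2 = 2 ^ 1 := rfl
      _ ≤ _ := Nat.pow_le_pow_right (by norm_num) Nat.one_le_two_pow
  set P := ((Finset.Icc 1 y).filter Nat.Prime).filter (fun p => ¬ p ∣ D) with hP
  have hPmem : ∀ p, p ∈ P ↔ p.Prime ∧ p ≤ y ∧ ¬ p ∣ D := by
    intro p
    simp only [hP, Finset.mem_filter, Finset.mem_Icc]
    exact ⟨fun h => ⟨h.1.2, h.1.1.2, h.2⟩, fun h => ⟨⟨⟨h.1.one_lt.le, h.2.1⟩, h.1⟩, h.2.2⟩⟩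
  set μ : ℝ := ∑ p ∈ P, (1 : ℝ) / p with hμ
  have hμ0 : 0 ≤ μ := Finset.sum_nonneg (fun p _ => by positivity)
  have hμle : μ ≤ 4 * F + 5 := by
    refine le_trans ?_ (sum_inv_primes_le_of_double_exp F)
    exact Finset.sum_le_sum_of_subset_of_nonneg (Finset.filter_subset _ _)
      (fun _ _ _ => by positivity)
  set S : ℕ → ℕ → ℝ := fun i m => ((P.filter (· ∣ α i * m + β i)).card : ℝ) with hS
  set I := Finset.Ioc 0 (y ^ 2) with hI
  have hvar : ∑ m ∈ I, ∑ i ∈ Finset.range (4 * t), (S i m - μ) ^ 2 ≤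
      ∑ m ∈ I, (4 * t : ℝ) * (3 * μ + 1) := by
    rw [Finset.sum_comm]
    have : ∀ i ∈ Finset.range (4 * t), ∑ m ∈ I, (S i m - μ) ^ 2 ≤
        (y : ℝ) ^ 2 * (3 * μ + 1) := by
      intro i hi
      exact sum_sq_card_dvd_sub_le y (α i) (β i) (by omega) P (fun p hp => ((hPmem p).mp hp).1)
        (fun p hp => ((hPmem p).mp hp).2.1)
        (fun p hp => hD i (by simpa using hi) p ((hPmem p).mp hp).1 ((hPmem p).mp hp).2.2)
    refine (Finset.sum_le_sum this).trans (le_of_eq ?_)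
    simp [hI]
    ring
  obtain ⟨m, hm, hle⟩ := Finset.exists_le_of_sum_le
    (⟨1, Finset.mem_Ioc.mpr ⟨by norm_num, Nat.one_le_pow _ _ (by omega)⟩⟩ : I.Nonempty) hvar
  have hmI := Finset.mem_Ioc.mp hm
  set v : ℕ → ℕ := fun i => ((α i * m + β i).primeFactors.filter (fun p => ¬ p ∣ D)).card with hv
  have hvS : ∀ i < 4 * t, ∃ r : ℕ, r ≤ 3 ∧ (v i : ℝ) = S i m + r := by
    intro i hi
    set L := α i * m + β i with hL
    have hL0 : L ≠ 0 := by have := hβ0 i hi; omega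
    have hLy : L < y ^ 4 := by
      have : L ≤ y * y ^ 2 + y := by
        have := Nat.mul_le_mul (hα i hi) hmI.2
        have := hβ i hi
        omega
      nlinarith [pow_pos (by omega : 0 < y) 3, pow_le_pow_left₀ (by omega) hy2 2]
    refine ⟨((L.primeFactors.filter (fun p => ¬ p ∣ D)).filter (fun p => ¬ p ≤ y)).card, ?_, ?_⟩
    · refine le_trans (Finset.card_le_card ?_) (card_large_primeFactors_le_three y L hy2 hL0 hLy)
      exact Finset.filter_subset_filter _ (Finset.filter_subset _ _)
    · have e : P.filter (· ∣ L) =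
          (L.primeFactors.filter (fun p => ¬ p ∣ D)).filter (fun p => p ≤ y) := by
        ext p
        simp only [Finset.mem_filter, hPmem, Nat.mem_primeFactors]
        tauto
      simp only [hS, hv, ← hL, e]
      rw [← Finset.card_filter_add_card_filter_not (s := L.primeFactors.filter (fun p => ¬ p ∣ D))
        (fun p => p ≤ y)]
      push_cast
      ring
  have ht0 : 0 < (t : ℝ) := by
    have : 0 < t := by
      rcases Nat.eq_zero_or_pos t with h | h
      · subst h; simp at ht
      · exact h
    exact_mod_cast this
  have htr : 48 * (F : ℝ) + 100 < (t : ℝ) ^ 2 := by exact_mod_cast ht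
  have hsum : ∑ i ∈ Finset.range (4 * t), ((v i : ℝ) - μ) ^ 2 < 2 * (t : ℝ) ^ 3 := by
    have h1 : ∀ i ∈ Finset.range (4 * t), ((v i : ℝ) - μ) ^ 2 ≤ 2 * (S i m - μ) ^ 2 + 18 := by
      intro i hi
      obtain ⟨r, hr, e⟩ := hvS i (by simpa using hi)
      have hr' : (r : ℝ) ≤ 3 := by exact_mod_cast hr
      have hr0 : (0 : ℝ) ≤ r := by positivity
      rw [e]
      nlinarith [sq_nonneg (S i m - μ - r)]
    have h2 := Finset.sum_le_sum h1
    rw [Finset.sum_add_distrib, ← Finset.mul_sum] at h2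
    simp only [Finset.sum_const, Finset.card_range, nsmul_eq_mul] at h2
    push_cast at h2
    have h3 : ∑ i ∈ Finset.range (4 * t), ((v i : ℝ) - μ) ^ 2 ≤ 4 * t * (6 * μ + 20) := by
      linarith
    have h4 : 4 * (t : ℝ) * (6 * μ + 20) < 2 * (t : ℝ) ^ 3 := by
      have : 12 * μ + 40 < (t : ℝ) ^ 2 := by linarith
      nlinarith
    linarith
  obtain ⟨i, hi, j, hj, hne, he⟩ := exists_ne_of_sum_sq_sub_lt t v μ hμ0 hsum
  exact ⟨m, hmI.1, i, hi, j, hj, hne, he⟩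

theorem factorization_pow_mul_of_not_dvd {p e c : ℕ} (hp : p.Prime) (hc : ¬ p ∣ c) :
    (p ^ e * c).factorization p = e := by
  have hc0 : c ≠ 0 := by rintro rfl; exact hc (dvd_zero p)
  rw [Nat.factorization_mul (pow_ne_zero _ hp.ne_zero) hc0, Nat.factorization_pow]
  simp [hp.factorization_self, Nat.factorization_eq_zero_of_not_dvd hc]

theorem factorization_add_of_pow_dvd {p L s : ℕ} (hp : p.Prime) (hs : 0 < s)
    (hL : p ^ (s.factorization p + 1) ∣ L) : (L + s).factorization p = s.factorization p := by
  obtain ⟨w, rfl⟩ := hL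
  have h1 : p ^ s.factorization p * (s / p ^ s.factorization p) = s := Nat.ordProj_mul_ordCompl_eq_self s p
  have h2 : ¬ p ∣ s / p ^ s.factorization p := Nat.not_dvd_ordCompl hp hs.ne'
  set e := s.factorization p
  set c := s / p ^ e
  have : p ^ (e + 1) * w + s = p ^ e * (p * w + c) := by
    rw [mul_add, h1]; ring
  rw [this]
  apply factorization_pow_mul_of_not_dvd hp
  intro h
  exact h2 ((Nat.dvd_add_right (dvd_mul_right p w)).mp h)

theorem exists_modEq_primeFactors (W : ℕ) (hW : 0 < W) (ρ : ℕ → ℕ) :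
    ∃ L, 0 < L ∧ L ≤ 2 * W ^ 2 ∧
      ∀ p, p.Prime → p ∣ W → L ≡ ρ p [MOD p ^ (W.factorization p + 1)] := by
  have hpp : Set.Pairwise (W.primeFactors : Set ℕ)
      (Function.onFun Nat.Coprime (fun p => p ^ (W.factorization p + 1))) := by
    intro p hp q hq hpq
    exact Nat.Coprime.pow _ _ ((Nat.coprime_primes (Nat.prime_of_mem_primeFactors hp)
      (Nat.prime_of_mem_primeFactors hq)).mpr hpq)
  have hs : ∀ p ∈ W.primeFactors, p ^ (W.factorization p + 1) ≠ 0 := fun p hp =>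
    pow_ne_zero _ (Nat.prime_of_mem_primeFactors hp).ne_zero
  set x := Nat.chineseRemainderOfFinset ρ (fun p => p ^ (W.factorization p + 1))
    W.primeFactors hs hpp with hx
  set M := ∏ p ∈ W.primeFactors, p ^ (W.factorization p + 1) with hM
  have hlt : (x : ℕ) < M := Nat.chineseRemainderOfFinset_lt_prod _ _ hs hpp
  have hMW : M ≤ W ^ 2 := by
    have h1 : M = W * ∏ p ∈ W.primeFactors, p := by
      rw [hM]
      simp_rw [pow_succ]
      rw [Finset.prod_mul_distrib]
      congr 1
      exact Nat.prod_factorization_pow_eq_self hW.ne'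
    rw [h1, sq]
    exact Nat.mul_le_mul_left _ (Nat.le_of_dvd hW (Nat.prod_primeFactors_dvd W))
  refine ⟨x + M, by omega, by omega, ?_⟩
  intro p hp hpW
  have hmem : p ∈ W.primeFactors := Nat.mem_primeFactors.mpr ⟨hp, hpW, hW.ne'⟩
  have h2 : p ^ (W.factorization p + 1) ∣ M :=
    Finset.dvd_prod_of_mem (fun p => p ^ (W.factorization p + 1)) hmem
  have h3 := (Nat.modEq_zero_iff_dvd.mpr h2)
  simpa using (x.2 p hmem).add h3

theorem exists_residue_preserving_valuations (r p e : ℕ) (hp : p.Prime) (hr : r + 1 < p)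
    (s : ℕ → ℕ) (hs : ∀ i < r, 0 < s i)
    (he : ∀ i < r, (s i).factorization p = 0 ∨ (s i).factorization p = e) :
    ∃ ρ, ∀ L, L ≡ ρ [MOD p ^ (e + 1)] → L.factorization p = e ∧
      ∀ i < r, (L + s i).factorization p = (s i).factorization p := by
  classical
  have : Fact p.Prime := ⟨hp⟩
  set bad : Finset (ZMod p) := insert 0
    ((Finset.range r).image (fun i => -((s i / p ^ e : ℕ) : ZMod p))) with hbad
  have hcard : bad.card < (Finset.univ : Finset (ZMod p)).card := by
    rw [Finset.card_univ, ZMod.card]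
    refine lt_of_le_of_lt (Finset.card_insert_le _ _) ?_
    have := Finset.card_image_le (s := Finset.range r)
      (f := fun i => -((s i / p ^ e : ℕ) : ZMod p))
    rw [Finset.card_range] at this
    omega
  obtain ⟨u, -, hu⟩ := Finset.exists_mem_notMem_of_card_lt_card hcard
  refine ⟨p ^ e * u.val, ?_⟩
  intro L hL
  have hpL : p ^ e ∣ L :=
    ((hL.of_dvd (pow_dvd_pow p (Nat.le_succ e))).dvd_iff dvd_rfl).mpr (dvd_mul_right _ _)
  obtain ⟨w, rfl⟩ := hpL
  have hw : (w : ZMod p) = u := by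
    rw [pow_succ] at hL
    have h := Nat.ModEq.mul_left_cancel' (pow_ne_zero e hp.ne_zero) hL
    have h' := (ZMod.natCast_eq_natCast_iff _ _ _).mpr h
    rw [h', ZMod.natCast_zmod_val]
  have hw0 : ¬ p ∣ w := by
    intro h
    rw [← ZMod.natCast_eq_zero_iff, hw] at h
    exact hu (by rw [h, hbad]; exact Finset.mem_insert_self _ _)
  refine ⟨factorization_pow_mul_of_not_dvd hp hw0, ?_⟩
  intro i hi
  have case_e : (s i).factorization p = e →
      (p ^ e * w + s i).factorization p = (s i).factorization p := by
    intro h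
    have h1 : p ^ e * (s i / p ^ e) = s i := by
      rw [← h]; exact Nat.ordProj_mul_ordCompl_eq_self _ p
    have h2 : p ^ e * w + s i = p ^ e * (w + s i / p ^ e) := by rw [mul_add, h1]
    rw [h, h2]
    apply factorization_pow_mul_of_not_dvd hp
    intro hd
    rw [← ZMod.natCast_eq_zero_iff] at hd
    push_cast at hd
    rw [hw] at hd
    apply hu
    rw [hbad]
    apply Finset.mem_insert_of_mem
    exact Finset.mem_image.mpr ⟨i, Finset.mem_range.mpr hi, (eq_neg_of_add_eq_zero_left hd).symm⟩
  by_cases h : (s i).factorization p = e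
  · exact case_e h
  · have h0 := (he i hi).resolve_right h
    apply factorization_add_of_pow_dvd hp (hs i hi)
    rw [h0] at h ⊢
    exact (pow_dvd_pow p (by omega)).mul_right w

/-- A tuple, decreasing and with differences dividing its members, whose valuations increase along
the tuple at primes up to `k`, take at most one nonzero value at larger primes, and at `p ∈ E`
jump from `0` to `1` at the index `τ p`. -/
structure StagedTuple (k : ℕ) (E : Finset ℕ) (τ : ℕ → ℕ) (r T : ℕ) (s : ℕ → ℕ) : Prop where
  pos : ∀ i < r, 0 < s i
  le : ∀ i < r, s i ≤ T
  lt : ∀ j < r, ∀ i < j, s j < s i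
  dvd : ∀ j < r, ∀ i < j, s i - s j ∣ s j
  chain : ∀ j < r, ∀ i < j, ∀ p, p.Prime → p ≤ k → (s i).factorization p < (s j).factorization p
  level : ∀ i < r, ∀ j < r, ∀ p, p.Prime → k < p → (s i).factorization p ≠ 0 →
    (s j).factorization p ≠ 0 → (s i).factorization p = (s j).factorization p
  ctrl : ∀ i < r, ∀ p ∈ E, (s i).factorization p = if τ p ≤ i then 1 else 0

theorem le_two_mul_sq_bound {k r X T L : ℕ} {s : ℕ → ℕ} (hk : 0 < k) (hr : r ≤ k) (hT : 2 ≤ T)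
    (hX : X ≤ T) (hs : ∀ i < r, s i ≤ T) (hL : L ≤ 2 * (X * ∏ i ∈ Finset.range r, s i) ^ 2) :
    L + T ≤ T ^ (2 * k + 4) := by
  have h1 : ∏ i ∈ Finset.range r, s i ≤ T ^ r := by
    have := Finset.prod_le_pow_card (Finset.range r) s T (fun i hi => hs i (by simpa using hi))
    simpa using this
  have h2 : X * ∏ i ∈ Finset.range r, s i ≤ T ^ (k + 1) := by
    calc _ ≤ T * T ^ r := Nat.mul_le_mul hX h1
      _ = T ^ (r + 1) := by ring
      _ ≤ _ := Nat.pow_le_pow_right (by omega) (by omega)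
  have h3 : (X * ∏ i ∈ Finset.range r, s i) ^ 2 ≤ T ^ (2 * k + 2) := by
    calc _ ≤ (T ^ (k + 1)) ^ 2 := Nat.pow_le_pow_left h2 2
      _ = _ := by rw [← pow_mul]; ring_nf
  have h4 : T ≤ T ^ (2 * k + 2) := Nat.le_self_pow (by omega) T
  have h5 : T ^ (2 * k + 4) = T ^ 2 * T ^ (2 * k + 2) := by rw [← pow_add]; ring_nf
  have h6 : 4 ≤ T ^ 2 := by nlinarith
  rw [h5]
  nlinarith

theorem StagedTuple.exists_succ {k : ℕ} {E : Finset ℕ} {τ : ℕ → ℕ} {r T X : ℕ} {s : ℕ → ℕ}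
    (hs : StagedTuple k E τ r T s) (hr : r < k) (hE : ∀ p ∈ E, p.Prime ∧ k < p)
    (hX0 : 0 < X) (hXk : ∀ p, p.Prime → p ≤ k → p ∣ X) (hXE : ∀ p ∈ E, p ∣ X) (hXT : X ≤ T)
    (hT : 2 ≤ T) : ∃ s', StagedTuple k E τ (r + 1) (T ^ (2 * k + 4)) s' := by
  classical
  set W := X * ∏ i ∈ Finset.range r, s i with hWdef
  have hW : 0 < W := Nat.mul_pos hX0
    (Finset.prod_pos fun i hi => hs.pos i (by simpa using hi))
  have hXW : X ∣ W := dvd_mul_right _ _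
  have hsW : ∀ i < r, s i ∣ W := fun i hi =>
    (Finset.dvd_prod_of_mem s (Finset.mem_range.mpr hi)).trans (dvd_mul_left _ _)
  have hvW : ∀ i < r, ∀ p, (s i).factorization p ≤ W.factorization p := fun i hi p =>
    (Nat.factorization_le_iff_dvd (hs.pos i hi).ne' hW.ne').mpr (hsW i hi) p
  have hex : ∀ p, ∃ ρ, p.Prime → p ∣ W →
      (p ≤ k → ρ = 0) ∧ (k < p → ∃ e,
        (∀ i < r, (s i).factorization p = 0 ∨ (s i).factorization p = e) ∧
        (p ∈ E → e = if τ p ≤ r then 1 else 0) ∧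
        ∀ L, L ≡ ρ [MOD p ^ (W.factorization p + 1)] → L.factorization p = e ∧
          ∀ i < r, (L + s i).factorization p = (s i).factorization p) := by
    intro p
    by_cases hp : p.Prime ∧ p ∣ W ∧ k < p
    swap
    · exact ⟨0, fun h1 h2 => ⟨fun _ => rfl, fun h3 => absurd ⟨h1, h2, h3⟩ hp⟩⟩
    obtain ⟨hp, hpW, hkp⟩ := hp
    have hpe : ∃ e, e ≤ W.factorization p ∧
        (∀ i < r, (s i).factorization p = 0 ∨ (s i).factorization p = e) ∧
        (p ∈ E → e = if τ p ≤ r then 1 else 0) := by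
      by_cases hpE : p ∈ E
      · refine ⟨if τ p ≤ r then 1 else 0, ?_, ?_, fun _ => rfl⟩
        · have : 0 < W.factorization p := hp.factorization_pos_of_dvd hW.ne' hpW
          split_ifs <;> omega
        · intro i hi
          rw [hs.ctrl i hi p hpE]
          split_ifs <;> omega
      · by_cases hall : ∃ i < r, (s i).factorization p ≠ 0
        · obtain ⟨i, hi, hne⟩ := hall
          refine ⟨(s i).factorization p, hvW i hi p, ?_, fun h => absurd h hpE⟩
          intro j hj
          by_cases h0 : (s j).factorization p = 0
          · exact Or.inl h0
          · exact Or.inr (hs.level j hj i hi p hp hkp h0 hne)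
        · push Not at hall
          exact ⟨0, Nat.zero_le _, fun i hi => Or.inl (hall i hi), fun h => absurd h hpE⟩
    obtain ⟨e, heW, he, heE⟩ := hpe
    obtain ⟨ρ, hρ⟩ := exists_residue_preserving_valuations r p e hp (by omega) s hs.pos he
    refine ⟨ρ, fun _ _ => ⟨fun h => by omega, fun _ => ⟨e, he, heE, fun L hL => ?_⟩⟩⟩
    exact hρ L (hL.of_dvd (pow_dvd_pow p (by omega)))
  choose ρ hρ using hex
  obtain ⟨L, hL0, hLle, hL⟩ := exists_modEq_primeFactors W hW ρ
  have hsmall : ∀ p, p.Prime → p ≤ k → p ^ (W.factorization p + 1) ∣ L := by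
    intro p hp hpk
    have hpW := (hXk p hp hpk).trans hXW
    have := hL p hp hpW
    rw [(hρ p hp hpW).1 hpk] at this
    exact Nat.modEq_zero_iff_dvd.mp this
  have hbig : ∀ p, p.Prime → p ∣ W → k < p → ∃ e, L.factorization p = e ∧
      (∀ i < r, (s i).factorization p = 0 ∨ (s i).factorization p = e) ∧
      (p ∈ E → e = if τ p ≤ r then 1 else 0) := by
    intro p hp hpW hkp
    obtain ⟨e, h1, h2, h3⟩ := (hρ p hp hpW).2 hkp
    exact ⟨e, (h3 L (hL p hp hpW)).1, h1, h2⟩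
  have hpres : ∀ p, p.Prime → p ∣ W → ∀ i < r,
      (L + s i).factorization p = (s i).factorization p := by
    intro p hp hpW i hi
    by_cases hpk : p ≤ k
    · apply factorization_add_of_pow_dvd hp (hs.pos i hi)
      exact (pow_dvd_pow p (by have := hvW i hi p; omega)).trans (hsmall p hp hpk)
    · obtain ⟨e, h1, h2, h3⟩ := (hρ p hp hpW).2 (by omega)
      exact (h3 L (hL p hp hpW)).2 i hi
  have hsmall' : ∀ p, p.Prime → p ≤ k → W.factorization p < L.factorization p := by
    intro p hp hpk
    exact (hp.pow_dvd_iff_le_factorization hL0.ne').mp (hsmall p hp hpk)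
  have hsL : ∀ i < r, s i ∣ L := by
    intro i hi
    rw [← Nat.factorization_prime_le_iff_dvd (hs.pos i hi).ne' hL0.ne']
    intro p hp
    by_cases hpW : p ∣ W
    · by_cases hpk : p ≤ k
      · have := hvW i hi p
        have := hsmall' p hp hpk
        omega
      · obtain ⟨e, h1, h2, -⟩ := hbig p hp hpW (by omega)
        rcases h2 i hi with h | h <;> omega
    · rw [Nat.factorization_eq_zero_of_not_dvd (fun h => hpW (h.trans (hsW i hi)))]
      exact Nat.zero_le _
  have hbound : L + T ≤ T ^ (2 * k + 4) :=
    le_two_mul_sq_bound (by omega) hr.le hT hXT hs.le hLle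
  set s' : ℕ → ℕ := fun i => if i < r then L + s i else L with hs'
  have e1 : ∀ i, i < r → s' i = L + s i := fun i hi => by simp [hs', hi]
  have e2 : s' r = L := by simp [hs']
  have hlt : ∀ j < r + 1, ∀ i < j, s' j < s' i := by
    intro j hj i hij
    rw [e1 i (by omega)]
    rcases Nat.lt_succ_iff_lt_or_eq.mp hj with h | rfl
    · rw [e1 j h]; have := hs.lt j h i hij; omega
    · rw [e2]; have := hs.pos i hij; omega
  have hdiff : ∀ j < r + 1, ∀ i < j, ∃ l < r, s' i - s' j ∣ s l := by
    intro j hj i hij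
    rw [e1 i (by omega)]
    rcases Nat.lt_succ_iff_lt_or_eq.mp hj with h | rfl
    · rw [e1 j h]
      exact ⟨j, h, by rw [Nat.add_sub_add_left]; exact hs.dvd j h i hij⟩
    · rw [e2]
      exact ⟨i, hij, by rw [Nat.add_sub_cancel_left]⟩
  have hlevel : ∀ j < r + 1, ∀ i < j, ∀ p, p.Prime → k < p → (s' i).factorization p ≠ 0 →
      (s' j).factorization p ≠ 0 → (s' i).factorization p = (s' j).factorization p := by
    intro j hj i hij p hp hkp h1 h2
    by_cases hpW : p ∣ W
    · rw [e1 i (by omega), hpres p hp hpW i (by omega)] at h1 ⊢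
      rcases Nat.lt_succ_iff_lt_or_eq.mp hj with h | rfl
      · rw [e1 j h, hpres p hp hpW j h] at h2 ⊢
        exact hs.level i (by omega) j h p hp hkp h1 h2
      · rw [e2]
        obtain ⟨e, g1, g2, -⟩ := hbig p hp hpW hkp
        rw [g1]
        exact (g2 i hij).resolve_left h1
    · exfalso
      have d1 := Nat.dvd_of_factorization_pos h1
      have d2 := Nat.dvd_of_factorization_pos h2
      obtain ⟨l, hl, hd⟩ := hdiff j hj i hij
      exact hpW (((Nat.dvd_sub d1 d2).trans hd).trans (hsW l hl))
  refine ⟨s', ?_, ?_, hlt, ?_, ?_, ?_, ?_⟩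
  · intro i hi
    by_cases h : i < r
    · rw [e1 i h]; omega
    · simp [hs', h, hL0]
  · intro i hi
    refine le_trans ?_ hbound
    by_cases h : i < r
    · rw [e1 i h]; have := hs.le i h; omega
    · simp [hs', h]
  · intro j hj i hij
    rcases Nat.lt_succ_iff_lt_or_eq.mp hj with h | rfl
    · rw [e1 i (by omega), e1 j h, Nat.add_sub_add_left]
      have := hs.dvd j h i hij
      exact dvd_add (this.trans (hsL j h)) this
    · rw [e1 i hij, e2, Nat.add_sub_cancel_left]
      exact hsL i hij
  · intro j hj i hij p hp hpk
    have hpW := (hXk p hp hpk).trans hXW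
    rw [e1 i (by omega), hpres p hp hpW i (by omega)]
    rcases Nat.lt_succ_iff_lt_or_eq.mp hj with h | rfl
    · rw [e1 j h, hpres p hp hpW j h]
      exact hs.chain j h i hij p hp hpk
    · rw [e2]
      have := hvW i hij p
      have := hsmall' p hp hpk
      omega
  · intro i hi j hj p hp hkp h1 h2
    rcases lt_trichotomy i j with h | h | h
    · exact hlevel j hj i h p hp hkp h1 h2
    · rw [h]
    · exact (hlevel i hi j h p hp hkp h2 h1).symm
  · intro i hi p hpE
    have hp := (hE p hpE).1
    have hpW := (hXE p hpE).trans hXW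
    rcases Nat.lt_succ_iff_lt_or_eq.mp hi with h | rfl
    · rw [e1 i h, hpres p hp hpW i h]
      exact hs.ctrl i h p hpE
    · rw [e2]
      obtain ⟨e, g1, -, g3⟩ := hbig p hp hpW (hE p hpE).2
      rw [g1, g3 hpE]

theorem exists_stagedTuple {k : ℕ} {E : Finset ℕ} {τ : ℕ → ℕ} {X : ℕ}
    (hE : ∀ p ∈ E, p.Prime ∧ k < p) (hX : 2 ≤ X) (hXk : ∀ p, p.Prime → p ≤ k → p ∣ X)
    (hXE : ∀ p ∈ E, p ∣ X) (r : ℕ) (hr : r ≤ k) :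
    ∃ s, StagedTuple k E τ r (X ^ ((2 * k + 4) ^ r)) s := by
  induction r with
  | zero => exact ⟨fun _ => 0, ⟨by simp, by simp, by simp, by simp, by simp, by simp, by simp⟩⟩
  | succ r ih =>
    obtain ⟨s, hs⟩ := ih (by omega)
    have h1 : X ≤ X ^ ((2 * k + 4) ^ r) :=
      Nat.le_self_pow (pow_ne_zero _ (by omega)) X
    obtain ⟨s', hs'⟩ := hs.exists_succ (by omega) hE (by omega) hXk hXE h1 (by omega)
    refine ⟨s', ?_⟩
    rwa [← pow_mul, ← pow_succ] at hs'

theorem StagedTuple.exists_translate {k : ℕ} {E : Finset ℕ} {τ : ℕ → ℕ} {T X : ℕ} {s : ℕ → ℕ}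
    (hs : StagedTuple k E τ k T s) (hk : 0 < k) (hE : ∀ p ∈ E, p.Prime ∧ k < p)
    (hτ : ∀ p ∈ E, τ p < k)
    (hX0 : 0 < X) (hXk : ∀ p, p.Prime → p ≤ k → p ∣ X) (hXE : ∀ p ∈ E, p ∣ X) (hXT : X ≤ T)
    (hT : 2 ≤ T) : ∃ a : ℕ → ℕ, (∀ i < k, 0 < a i ∧ a i ≤ T ^ (2 * k + 4)) ∧
      (∀ j < k, ∀ i < j, a j < a i ∧ a i - a j ∣ a j) ∧
      (∀ j < k, ∀ i < j, ∀ p, p.Prime → p ≤ k →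
        (a i).factorization p < (a j).factorization p) ∧
      (∀ p ∈ E, ∀ i < k, (i < τ p → (a i).factorization p = 0) ∧
        (i = τ p → 2 ≤ (a i).factorization p) ∧ (τ p < i → (a i).factorization p = 1)) ∧
      (∀ i < k, ∀ j < k, ∀ p, p.Prime → k < p → p ∉ E → p ∣ a i → p ∣ a j →
        (a i).factorization p = (a j).factorization p) := by
  classical
  set W := X * ∏ i ∈ Finset.range k, s i with hWdef
  have hW : 0 < W := Nat.mul_pos hX0
    (Finset.prod_pos fun i hi => hs.pos i (by simpa using hi))
  have hXW : X ∣ W := dvd_mul_right _ _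
  have hsW : ∀ i < k, s i ∣ W := fun i hi =>
    (Finset.dvd_prod_of_mem s (Finset.mem_range.mpr hi)).trans (dvd_mul_left _ _)
  have hvW : ∀ i < k, ∀ p, (s i).factorization p ≤ W.factorization p := fun i hi p =>
    (Nat.factorization_le_iff_dvd (hs.pos i hi).ne' hW.ne').mpr (hsW i hi) p
  obtain ⟨L, hL0, hLle, hL⟩ := exists_modEq_primeFactors W hW
    (fun p => if p ∈ E then s (τ p) * (p ^ (W.factorization p + 1) - 1) else 0)
  have hbound : L + T ≤ T ^ (2 * k + 4) := le_two_mul_sq_bound hk le_rfl hT hXT hs.le hLle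
  have hLn : ∀ p, p.Prime → p ∣ W → p ∉ E → p ^ (W.factorization p + 1) ∣ L := by
    intro p hp hpW hpE
    have := hL p hp hpW
    simp only [hpE, if_false] at this
    exact Nat.modEq_zero_iff_dvd.mp this
  have hLE : ∀ p ∈ E, p ^ 2 ∣ L + s (τ p) := by
    intro p hpE
    have hp := (hE p hpE).1
    have hpW := (hXE p hpE).trans hXW
    have h1 := hL p hp hpW
    simp only [hpE, if_true] at h1
    have h2 := h1.add_right (s (τ p))
    have h3 : s (τ p) * (p ^ (W.factorization p + 1) - 1) + s (τ p) =
        s (τ p) * p ^ (W.factorization p + 1) := by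
      have : 1 ≤ p ^ (W.factorization p + 1) := Nat.one_le_pow _ _ hp.pos
      obtain ⟨q, hq⟩ := Nat.exists_eq_add_of_le this
      rw [hq, Nat.add_sub_cancel_left]; ring
    rw [h3] at h2
    have h4 : p ^ (W.factorization p + 1) ∣ L + s (τ p) :=
      (h2.dvd_iff dvd_rfl).mpr (dvd_mul_left _ _)
    have := hp.factorization_pos_of_dvd hW.ne' hpW
    exact (pow_dvd_pow p (by omega)).trans h4
  have hLp : ∀ p ∈ E, p ∣ L := by
    intro p hpE
    have h1 : p ∣ L + s (τ p) := (dvd_pow_self p two_ne_zero).trans (hLE p hpE)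
    have h2 : p ∣ s (τ p) := by
      apply Nat.dvd_of_factorization_pos
      rw [hs.ctrl _ (hτ p hpE) p hpE]; simp
    exact (Nat.dvd_add_left h2).mp h1
  have hpres : ∀ p, p.Prime → p ∣ W → p ∉ E → ∀ i < k,
      (L + s i).factorization p = (s i).factorization p := by
    intro p hp hpW hpE i hi
    apply factorization_add_of_pow_dvd hp (hs.pos i hi)
    exact (pow_dvd_pow p (by have := hvW i hi p; omega)).trans (hLn p hp hpW hpE)
  have hsL : ∀ i < k, s i ∣ L := by
    intro i hi
    rw [← Nat.factorization_prime_le_iff_dvd (hs.pos i hi).ne' hL0.ne']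
    intro p hp
    by_cases hpW : p ∣ W
    · by_cases hpE : p ∈ E
      · have h1 := hp.factorization_pos_of_dvd hL0.ne' (hLp p hpE)
        rw [hs.ctrl i hi p hpE]
        split_ifs <;> omega
      · have h1 := (hp.pow_dvd_iff_le_factorization hL0.ne').mp (hLn p hp hpW hpE)
        have := hvW i hi p
        omega
    · rw [Nat.factorization_eq_zero_of_not_dvd (fun h => hpW (h.trans (hsW i hi)))]
      exact Nat.zero_le _
  have hlevel : ∀ j < k, ∀ i < j, ∀ p, p.Prime → k < p → p ∉ E → p ∣ L + s i → p ∣ L + s j →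
      (L + s i).factorization p = (L + s j).factorization p := by
    intro j hj i hij p hp hkp hpE h1 h2
    by_cases hpW : p ∣ W
    · have g1 := hp.factorization_pos_of_dvd (by omega) h1
      have g2 := hp.factorization_pos_of_dvd (by omega) h2
      rw [hpres p hp hpW hpE i (by omega)] at g1 ⊢
      rw [hpres p hp hpW hpE j hj] at g2 ⊢
      exact hs.level i (by omega) j hj p hp hkp g1.ne' g2.ne'
    · exfalso
      have h3 := Nat.dvd_sub h1 h2
      rw [Nat.add_sub_add_left] at h3
      exact hpW ((h3.trans (hs.dvd j hj i hij)).trans (hsW j hj))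
  refine ⟨fun i => L + s i, ?_, ?_, ?_, ?_, ?_⟩ <;> dsimp only
  · intro i hi
    have := hs.le i hi
    exact ⟨by omega, by omega⟩
  · intro j hj i hij
    have h1 := hs.lt j hj i hij
    refine ⟨by omega, ?_⟩
    rw [Nat.add_sub_add_left]
    have := hs.dvd j hj i hij
    exact dvd_add (this.trans (hsL j hj)) this
  · intro j hj i hij p hp hpk
    have hpW := (hXk p hp hpk).trans hXW
    have hpE : p ∉ E := fun h => by have := (hE p h).2; omega
    rw [hpres p hp hpW hpE i (by omega), hpres p hp hpW hpE j hj]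
    exact hs.chain j hj i hij p hp hpk
  · intro p hpE i hi
    have hp := (hE p hpE).1
    have hc := hs.ctrl i hi p hpE
    refine ⟨fun h => ?_, fun h => ?_, fun h => ?_⟩
    · rw [if_neg (by omega)] at hc
      apply Nat.factorization_eq_zero_of_not_dvd
      intro h1
      have h2 := (Nat.dvd_add_right (hLp p hpE)).mp h1
      have := hp.factorization_pos_of_dvd (hs.pos i hi).ne' h2
      omega
    · subst h
      exact (hp.pow_dvd_iff_le_factorization (by omega)).mp (hLE p hpE)
    · rw [if_pos (by omega)] at hc
      have h1 : p ∣ L + s i :=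
        dvd_add (hLp p hpE) (Nat.dvd_of_factorization_pos (by omega))
      have h2 := hp.factorization_pos_of_dvd (by omega) h1
      by_contra hne
      have h3 : p ^ 2 ∣ L + s i :=
        (hp.pow_dvd_iff_le_factorization (by omega)).mpr (by omega)
      have h4 := Nat.dvd_sub (hLE p hpE) h3
      rw [Nat.add_sub_add_left] at h4
      have h5 := h4.trans (hs.dvd i hi (τ p) h)
      have h6 := (hp.pow_dvd_iff_le_factorization (hs.pos i hi).ne').mp h5
      omega
  · intro i hi j hj p hp hkp hpE h1 h2
    rcases lt_trichotomy i j with h | h | h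
    · exact hlevel j hj i h p hp hkp hpE h1 h2
    · rw [h]
    · exact (hlevel i hi j h p hp hkp hpE h2 h1).symm

theorem card_primeFactors_mul_eq (n x : ℕ) (hn : n ≠ 0) (hx : x ≠ 0) :
    (n * x).primeFactors.card =
      n.primeFactors.card + (x.primeFactors.filter (fun p => ¬ p ∣ n)).card := by
  rw [Nat.primeFactors_mul hn hx, ← Finset.card_union_of_disjoint]
  · congr 1
    ext p
    simp only [Finset.mem_union, Finset.mem_filter, Nat.mem_primeFactors]
    tauto
  · rw [Finset.disjoint_left]
    intro p h1 h2
    exact (Finset.mem_filter.mp h2).2 (Nat.dvd_of_mem_primeFactors h1)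

theorem prime_dvd_div_sub_iff {x z p : ℕ} (hp : p.Prime) (hz : 0 < z) (hzx : z < x)
    (hd : x - z ∣ z) :
    (p ∣ z / (x - z) ↔ x.factorization p < z.factorization p) ∧
    (p ∣ x / (x - z) ↔ z.factorization p < x.factorization p) := by
  have hdx : x - z ∣ x := by
    have := dvd_add hd (dvd_refl (x - z))
    rwa [Nat.add_sub_cancel' hzx.le] at this
  have hg0 : x - z ≠ 0 := by omega
  have hx0 : x ≠ 0 := by omega
  have h1 := (Nat.factorization_le_iff_dvd hg0 hz.ne').mpr hd p
  have h2 := (Nat.factorization_le_iff_dvd hg0 hx0).mpr hdx p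
  have h3 : min (x.factorization p) (z.factorization p) ≤ (x - z).factorization p := by
    rw [← hp.pow_dvd_iff_le_factorization hg0]
    apply Nat.dvd_sub
    · exact (hp.pow_dvd_iff_le_factorization hx0).mpr (min_le_left _ _)
    · exact (hp.pow_dvd_iff_le_factorization hz.ne').mpr (min_le_right _ _)
  have key : ∀ w, w ≠ 0 → x - z ∣ w →
      (p ∣ w / (x - z) ↔ (x - z).factorization p < w.factorization p) := by
    intro w hw hdw
    have hq : w / (x - z) ≠ 0 :=
      (Nat.div_pos (Nat.le_of_dvd (Nat.pos_of_ne_zero hw) hdw) (by omega)).ne'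
    have e := congrArg (fun f => f p) (Nat.factorization_div hdw)
    simp only [Finsupp.coe_tsub, Pi.sub_apply] at e
    rw [hp.dvd_iff_one_le_factorization hq, e]
    omega
  rw [key z hz.ne' hd, key x hx0 hdx]
  rcases le_total (x.factorization p) (z.factorization p) with h | h
  · rw [min_eq_left h] at h3
    omega
  · rw [min_eq_right h] at h3
    omega

theorem card_primeFactors_balanced {k n c : ℕ} {E : Finset ℕ} {τ : ℕ → ℕ} {a : ℕ → ℕ}
    (hn : 0 < n) (hnk : n ≤ k)
    (hc : ((Finset.range (k + 1)).filter (fun p => p.Prime ∧ ¬ p ∣ n)).card = c)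
    (hE : ∀ p ∈ E, p.Prime ∧ k < p) (hfib : ∀ t < k, (E.filter (fun p => τ p = t)).card = c)
    (hpos : ∀ i < k, 0 < a i)
    (hdvd : ∀ j < k, ∀ i < j, a j < a i ∧ a i - a j ∣ a j)
    (hchain : ∀ j < k, ∀ i < j, ∀ p, p.Prime → p ≤ k →
        (a i).factorization p < (a j).factorization p)
    (hctrl : ∀ p ∈ E, ∀ i < k, (i < τ p → (a i).factorization p = 0) ∧
        (i = τ p → 2 ≤ (a i).factorization p) ∧ (τ p < i → (a i).factorization p = 1))
    (hlevel : ∀ i < k, ∀ j < k, ∀ p, p.Prime → k < p → p ∉ E → p ∣ a i → p ∣ a j →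
        (a i).factorization p = (a j).factorization p)
    (j : ℕ) (hj : j < k) (i : ℕ) (hij : i < j) :
    (n * (a j / (a i - a j))).primeFactors.card +
        (c * i + ((a i).primeFactors.filter (fun p => k < p ∧ p ∉ E)).card) =
      (n * (a i / (a i - a j))).primeFactors.card +
        (c * j + ((a j).primeFactors.filter (fun p => k < p ∧ p ∉ E)).card) := by
  classical
  have hik : i < k := by omega
  obtain ⟨hlt, hd⟩ := hdvd j hj i hij
  have hdi : a i - a j ∣ a i := by
    have := dvd_add hd (dvd_refl (a i - a j))
    rwa [Nat.add_sub_cancel' hlt.le] at this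
  set g := a i - a j with hg
  have hg0 : 0 < g := by omega
  have hqj : a j / g ≠ 0 := (Nat.div_pos (Nat.le_of_dvd (hpos j hj) hd) hg0).ne'
  have hqi : a i / g ≠ 0 := (Nat.div_pos (Nat.le_of_dvd (hpos i hik) hdi) hg0).ne'
  have hmem := fun p (hp : Nat.Prime p) => prime_dvd_div_sub_iff hp (hpos j hj) hlt hd
  rw [card_primeFactors_mul_eq n _ hn.ne' hqj, card_primeFactors_mul_eq n _ hn.ne' hqi]
  set A := (a j / g).primeFactors.filter (fun p => ¬ p ∣ n) with hA
  set B := (a i / g).primeFactors.filter (fun p => ¬ p ∣ n) with hB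
  set HI := (a i).primeFactors.filter (fun p => k < p ∧ p ∉ E) with hHI
  set HJ := (a j).primeFactors.filter (fun p => k < p ∧ p ∉ E) with hHJ
  have memA : ∀ p, p ∈ A ↔ p.Prime ∧ (a i).factorization p < (a j).factorization p ∧ ¬ p ∣ n := by
    intro p
    simp only [hA, Finset.mem_filter, Nat.mem_primeFactors]
    constructor
    · rintro ⟨⟨h1, h2, -⟩, h3⟩
      exact ⟨h1, (hmem p h1).1.mp h2, h3⟩
    · rintro ⟨h1, h2, h3⟩
      exact ⟨⟨h1, (hmem p h1).1.mpr h2, hqj⟩, h3⟩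
  have memB : ∀ p, p ∈ B ↔ p.Prime ∧ (a j).factorization p < (a i).factorization p ∧ ¬ p ∣ n := by
    intro p
    simp only [hB, Finset.mem_filter, Nat.mem_primeFactors]
    constructor
    · rintro ⟨⟨h1, h2, -⟩, h3⟩
      exact ⟨h1, (hmem p h1).2.mp h2, h3⟩
    · rintro ⟨h1, h2, h3⟩
      exact ⟨⟨h1, (hmem p h1).2.mpr h2, hqi⟩, h3⟩
  have hbign : ∀ p, k < p → ¬ p ∣ n := fun p hkp h => by
    have := Nat.le_of_dvd hn h; omega
  have split : ∀ C : Finset ℕ, C.card = (C.filter (fun p => p ≤ k)).card +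
      (C.filter (fun p => k < p ∧ p ∈ E)).card + (C.filter (fun p => k < p ∧ p ∉ E)).card := by
    intro C
    rw [← Finset.card_filter_add_card_filter_not (s := C) (fun p => p ≤ k),
      ← Finset.card_filter_add_card_filter_not (s := C.filter (fun p => ¬ p ≤ k)) (fun p => p ∈ E),
      Finset.filter_filter, Finset.filter_filter]
    simp only [not_le]
    ring
  have A1 : (A.filter (fun p => p ≤ k)).card = c := by
    rw [← hc]
    congr 1
    ext p
    simp only [Finset.mem_filter, memA, Finset.mem_range]
    constructor
    · rintro ⟨⟨h1, h2, h3⟩, h4⟩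
      exact ⟨by omega, h1, h3⟩
    · rintro ⟨h1, h2, h3⟩
      exact ⟨⟨h2, hchain j hj i hij p h2 (by omega), h3⟩, by omega⟩
  have B1 : (B.filter (fun p => p ≤ k)).card = 0 := by
    rw [Finset.card_eq_zero, Finset.filter_eq_empty_iff]
    intro p hpB hpk
    have h := (memB p).mp hpB
    have := hchain j hj i hij p h.1 hpk
    omega
  have A2 : (A.filter (fun p => k < p ∧ p ∈ E)).card = c * (j - i) := by
    have e : A.filter (fun p => k < p ∧ p ∈ E) = E.filter (fun p => i < τ p ∧ τ p ≤ j) := by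
      ext p
      simp only [Finset.mem_filter, memA]
      constructor
      · rintro ⟨⟨h1, h2, h3⟩, h4, h5⟩
        obtain ⟨i1, i2, i3⟩ := hctrl p h5 i hik
        obtain ⟨j1, j2, j3⟩ := hctrl p h5 j hj
        refine ⟨h5, ?_, ?_⟩
        · by_contra hcon
          rcases Nat.lt_or_ge (τ p) i with h | h
          · have := i3 h; have := j3 (by omega); omega
          · have := i2 (by omega); have := j3 (by omega); omega
        · by_contra hcon
          have := j1 (by omega); omega
      · rintro ⟨h5, h6, h7⟩
        obtain ⟨hp, hkp⟩ := hE p h5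
        obtain ⟨i1, i2, i3⟩ := hctrl p h5 i hik
        obtain ⟨j1, j2, j3⟩ := hctrl p h5 j hj
        refine ⟨⟨hp, ?_, hbign p hkp⟩, hkp, h5⟩
        rw [i1 h6]
        rcases Nat.lt_or_ge (τ p) j with h | h
        · have := j3 h; omega
        · have := j2 (by omega); omega
    rw [e, Finset.card_eq_sum_card_fiberwise (f := τ) (t := Finset.Ioc i j)]
    · have : ∀ t ∈ Finset.Ioc i j,
          ((E.filter (fun p => i < τ p ∧ τ p ≤ j)).filter (fun p => τ p = t)).card = c := by
        intro t ht
        rw [Finset.mem_Ioc] at ht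
        rw [← hfib t (by omega), Finset.filter_filter]
        congr 1
        apply Finset.filter_congr
        intro p _
        constructor
        · exact fun h => h.2
        · exact fun h => ⟨by omega, h⟩
      rw [Finset.sum_congr rfl this]
      simp [mul_comm]
    · intro p hp
      simp only [Finset.coe_filter, Set.mem_ofPred_eq] at hp
      simpa using hp.2
  have B2 : (B.filter (fun p => k < p ∧ p ∈ E)).card = c := by
    rw [← hfib i hik]
    congr 1
    ext p
    simp only [Finset.mem_filter, memB]
    constructor
    · rintro ⟨⟨h1, h2, h3⟩, h4, h5⟩
      obtain ⟨i1, i2, i3⟩ := hctrl p h5 i hik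
      obtain ⟨j1, j2, j3⟩ := hctrl p h5 j hj
      refine ⟨h5, ?_⟩
      by_contra hcon
      rcases Nat.lt_or_ge (τ p) i with h | h
      · have := i3 h; have := j3 (by omega); omega
      · have := i1 (by omega); omega
    · rintro ⟨h5, h6⟩
      obtain ⟨hp, hkp⟩ := hE p h5
      have i2 := (hctrl p h5 i hik).2.1 h6.symm
      have j3 := (hctrl p h5 j hj).2.2 (by omega)
      exact ⟨⟨hp, by omega, hbign p hkp⟩, hkp, h5⟩
  have other : ∀ u < k, ∀ w < k, ∀ p, p.Prime → k < p → p ∉ E →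
      ((a u).factorization p < (a w).factorization p ↔ p ∣ a w ∧ ¬ p ∣ a u) := by
    intro u hu w hw p hp hkp hpE
    constructor
    · intro h
      have h1 : p ∣ a w := Nat.dvd_of_factorization_pos (by omega)
      refine ⟨h1, fun h2 => ?_⟩
      have := hlevel u hu w hw p hp hkp hpE h2 h1
      omega
    · rintro ⟨h1, h2⟩
      rw [Nat.factorization_eq_zero_of_not_dvd h2]
      exact hp.factorization_pos_of_dvd (hpos w hw).ne' h1
  have A3 : A.filter (fun p => k < p ∧ p ∉ E) = HJ.filter (fun p => ¬ p ∣ a i) := by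
    ext p
    simp only [Finset.mem_filter, memA, hHJ, Nat.mem_primeFactors]
    constructor
    · rintro ⟨⟨h1, h2, h3⟩, h4, h5⟩
      have := (other i hik j hj p h1 h4 h5).mp h2
      exact ⟨⟨⟨h1, this.1, (hpos j hj).ne'⟩, h4, h5⟩, this.2⟩
    · rintro ⟨⟨⟨h1, h2, -⟩, h4, h5⟩, h6⟩
      exact ⟨⟨h1, (other i hik j hj p h1 h4 h5).mpr ⟨h2, h6⟩, hbign p h4⟩, h4, h5⟩
  have B3 : B.filter (fun p => k < p ∧ p ∉ E) = HI.filter (fun p => ¬ p ∣ a j) := by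
    ext p
    simp only [Finset.mem_filter, memB, hHI, Nat.mem_primeFactors]
    constructor
    · rintro ⟨⟨h1, h2, h3⟩, h4, h5⟩
      have := (other j hj i hik p h1 h4 h5).mp h2
      exact ⟨⟨⟨h1, this.1, (hpos i hik).ne'⟩, h4, h5⟩, this.2⟩
    · rintro ⟨⟨⟨h1, h2, -⟩, h4, h5⟩, h6⟩
      exact ⟨⟨h1, (other j hj i hik p h1 h4 h5).mpr ⟨h2, h6⟩, hbign p h4⟩, h4, h5⟩
  have common : HJ.filter (fun p => p ∣ a i) = HI.filter (fun p => p ∣ a j) := by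
    have := (hpos i hik).ne'
    have := (hpos j hj).ne'
    ext p
    simp only [Finset.mem_filter, hHI, hHJ, Nat.mem_primeFactors]
    tauto
  have sA := split A
  have sB := split B
  have sI := Finset.card_filter_add_card_filter_not (s := HI) (fun p => p ∣ a j)
  have sJ := Finset.card_filter_add_card_filter_not (s := HJ) (fun p => p ∣ a i)
  rw [common] at sJ
  rw [A1, A2, A3] at sA
  rw [B1, B2, B3] at sB
  obtain ⟨d, rfl⟩ := Nat.exists_eq_add_of_lt hij
  have hsub : i + d + 1 - i = d + 1 := by omega
  rw [hsub] at sA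
  have e1 : c * (d + 1) = c * d + c := by ring
  have e2 : c * (i + d + 1) = c * i + c * d + c := by ring
  omega

theorem exists_strictMono_primes (B : ℕ) (hB : 0 < B) :
    ∃ q : ℕ → ℕ, StrictMono q ∧ ∀ m, (q m).Prime ∧ B < q m ∧ q m ≤ 2 ^ (m + 1) * B := by
  have hb : ∀ b, ∃ p, b ≠ 0 → p.Prime ∧ b < p ∧ p ≤ 2 * b := by
    intro b
    by_cases h : b = 0
    · exact ⟨0, fun h' => absurd h h'⟩
    · obtain ⟨p, hp⟩ := Nat.exists_prime_lt_and_le_two_mul b h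
      exact ⟨p, fun _ => hp⟩
  choose f hf using hb
  let q : ℕ → ℕ := fun m => Nat.rec (f B) (fun _ r => f r) m
  have hq : ∀ m, (q m).Prime ∧ B < q m ∧ q m ≤ 2 ^ (m + 1) * B := by
    intro m
    induction m with
    | zero => simpa [q] using hf B hB.ne'
    | succ m ih =>
      obtain ⟨h1, h2, h3⟩ := hf (q m) ih.1.ne_zero
      refine ⟨h1, ih.2.1.trans h2, h3.trans ?_⟩
      calc 2 * q m ≤ 2 * (2 ^ (m + 1) * B) := Nat.mul_le_mul_left _ ih.2.2
        _ = 2 ^ (m + 1 + 1) * B := by ring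
  exact ⟨q, strictMono_nat_of_lt_succ fun m => (hf (q m) (hq m).1.ne_zero).2.1, hq⟩

theorem exists_mul_add_one_dvd {p b : ℕ} (hp : p.Prime) (hb : ¬ p ∣ b) :
    ∃ ρ, ∀ m, m ≡ ρ [MOD p] → p ∣ b * m + 1 := by
  have : Fact p.Prime := ⟨hp⟩
  have hb' : (b : ZMod p) ≠ 0 := by rwa [Ne, ZMod.natCast_eq_zero_iff]
  refine ⟨(-(b : ZMod p)⁻¹).val, fun m hm => ?_⟩
  have h := (ZMod.natCast_eq_natCast_iff _ _ _).mpr hm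
  rw [ZMod.natCast_zmod_val] at h
  rw [← ZMod.natCast_eq_zero_iff]
  push_cast
  rw [h, mul_neg, mul_inv_cancel₀ hb', neg_add_cancel]

theorem exists_forced_primes {k Q H : ℕ} {a h : ℕ → ℕ} (hQ : 0 < Q)
    (ha : ∀ i < k, a i ∣ Q) (hh : ∀ i < k, h i ≤ H) :
    ∃ G : ℕ → Finset ℕ, ∃ Γ m₀ : ℕ, 0 < Γ ∧ 0 < m₀ ∧ Γ ≤ (2 ^ (k * H) * Q) ^ (k * H) ∧
      m₀ ≤ 2 * Γ ^ 2 ∧ (∀ i < k, (G i).card = h i) ∧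
      (∀ i < k, ∀ p ∈ G i, p.Prime ∧ ¬ p ∣ Q ∧ p ∣ Γ ∧ p ∣ a i * Q * m₀ + 1) ∧
      (∀ p, p.Prime → p ∣ Γ → ∃ i < k, p ∈ G i) := by
  classical
  obtain ⟨q, hqm, hq⟩ := exists_strictMono_primes Q hQ
  have hqQ : ∀ l, ¬ q l ∣ Q := fun l hl => by
    have := Nat.le_of_dvd hQ hl
    have := (hq l).2.1
    omega
  set G : ℕ → Finset ℕ := fun i => (Finset.range (h i)).image (fun m => q (i * H + m)) with hG
  have memG : ∀ i p, p ∈ G i ↔ ∃ m < h i, q (i * H + m) = p := by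
    intro i p
    simp [hG]
  have hdisj : ∀ i < k, ∀ j < k, ∀ p, p ∈ G i → p ∈ G j → i = j := by
    intro i hi j hj p h1 h2
    obtain ⟨m, hm, rfl⟩ := (memG _ _).mp h1
    obtain ⟨m', hm', h3⟩ := (memG _ _).mp h2
    have h4 := hqm.injective h3
    have := hh i hi
    have := hh j hj
    have e : ∀ i m, m < H → (i * H + m) / H = i := fun i m hm => by
      rw [mul_comm, Nat.mul_add_div (by omega), Nat.div_eq_of_lt hm, add_zero]
    rw [← e i m (by omega), ← e j m' (by omega), h4]
  set Γ := ∏ i ∈ Finset.range k, ∏ p ∈ G i, p with hΓ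
  have hprime : ∀ i, ∀ p ∈ G i, p.Prime := by
    intro i p hp
    obtain ⟨m, -, rfl⟩ := (memG _ _).mp hp
    exact (hq _).1
  have hΓ0 : 0 < Γ :=
    Finset.prod_pos fun i _ => Finset.prod_pos fun p hp => (hprime i p hp).pos
  have hcard : ∀ i, (G i).card = h i := by
    intro i
    rw [hG, Finset.card_image_of_injective, Finset.card_range]
    intro m m' hmm
    have := hqm.injective hmm
    omega
  have hdvd : ∀ i < k, ∀ p ∈ G i, p ∣ Γ := fun i hi p hp =>
    (Finset.dvd_prod_of_mem (fun p => p) hp).trans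
      (Finset.dvd_prod_of_mem (fun i => ∏ p ∈ G i, p) (Finset.mem_range.mpr hi))
  have hρ : ∀ p, ∃ ρ, ∀ m, m ≡ ρ [MOD p] → ∀ i < k, p ∈ G i → p ∣ a i * Q * m + 1 := by
    intro p
    by_cases hp : ∃ i < k, p ∈ G i
    · obtain ⟨i, hi, hpi⟩ := hp
      obtain ⟨l, -, rfl⟩ := (memG _ _).mp hpi
      have hnd : ¬ q (i * H + l) ∣ a i * Q := by
        rw [(hq _).1.dvd_mul, not_or]
        exact ⟨fun h => hqQ _ (h.trans (ha i hi)), hqQ _⟩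
      obtain ⟨ρ, hρ⟩ := exists_mul_add_one_dvd (hq _).1 hnd
      refine ⟨ρ, fun m hm j hj hpj => ?_⟩
      rw [← hdisj i hi j hj _ hpi hpj]
      exact hρ m hm
    · exact ⟨0, fun m _ i hi hpi => absurd ⟨i, hi, hpi⟩ hp⟩
  choose ρ hρ using hρ
  obtain ⟨m₀, hm0, hmle, hm⟩ := exists_modEq_primeFactors Γ hΓ0 ρ
  refine ⟨G, Γ, m₀, hΓ0, hm0, ?_, hmle, fun i _ => hcard i, ?_, ?_⟩
  · have hone : 1 ≤ 2 ^ (k * H) * Q := Nat.mul_pos (by positivity) hQ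
    calc Γ ≤ ∏ i ∈ Finset.range k, (2 ^ (k * H) * Q) ^ H := by
          apply Finset.prod_le_prod'
          intro i hi
          rw [Finset.mem_range] at hi
          refine (Finset.prod_le_pow_card _ _ (2 ^ (k * H) * Q) ?_).trans
            (Nat.pow_le_pow_right hone ((hcard i).le.trans (hh i hi)))
          intro p hp
          obtain ⟨m, hm, rfl⟩ := (memG _ _).mp hp
          refine (hq _).2.2.trans (Nat.mul_le_mul_right _ (Nat.pow_le_pow_right (by norm_num) ?_))
          have h1 := hh i hi
          have h2 : (i + 1) * H ≤ k * H := Nat.mul_le_mul_right _ hi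
          have h3 : (i + 1) * H = i * H + H := by ring
          omega
      _ = (2 ^ (k * H) * Q) ^ (k * H) := by
          rw [Finset.prod_const, Finset.card_range, ← pow_mul, mul_comm H k]
  · intro i hi p hp
    refine ⟨hprime i p hp, ?_, hdvd i hi p hp, ?_⟩
    · obtain ⟨m, -, rfl⟩ := (memG _ _).mp hp
      exact hqQ _
    · exact hρ p m₀ ((hm p (hprime i p hp) (hdvd i hi p hp)).of_dvd
        (dvd_pow_self p (Nat.succ_ne_zero _))) i hi hp
  · intro p hp hpΓ
    obtain ⟨i, hi, hpi⟩ := (hp.prime.dvd_finsetProd_iff _).mp hpΓ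
    obtain ⟨r, hr, hpr⟩ := (hp.prime.dvd_finsetProd_iff _).mp hpi
    rw [(Nat.prime_dvd_prime_iff_eq hp (hprime i r hr)).mp hpr]
    exact ⟨i, Finset.mem_range.mp hi, hr⟩

theorem exists_gt_card_primeFactors_eq {t n Q X₀ F H : ℕ} {a h : ℕ → ℕ}
    (ht : 48 * F + 100 < t ^ 2) (hn : 0 < n) (hQ : 0 < Q) (hX₀ : X₀ ≤ Q) (hnQ : n ∣ Q)
    (hpos : ∀ i < 4 * t, 0 < a i) (haQ : ∀ i < 4 * t, a i ∣ Q)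
    (hdvd : ∀ j < 4 * t, ∀ i < j, a j < a i ∧ a i - a j ∣ a j)
    (hbal : ∀ j < 4 * t, ∀ i < j, (n * (a j / (a i - a j))).primeFactors.card + h i =
      (n * (a i / (a i - a j))).primeFactors.card + h j)
    (hh : ∀ i < 4 * t, h i ≤ H)
    (hF : Q * Q * (2 * ((2 ^ (4 * t * H) * Q) ^ (4 * t * H)) ^ 2) + 1 ≤ 2 ^ 2 ^ F) :
    ∃ x, X₀ < x ∧ x.primeFactors.card = (x + n).primeFactors.card := by
  classical
  obtain ⟨G, Γ, m₀, hΓ0, hm0, hΓle, hm0le, hGcard, hG, hGΓ⟩ := exists_forced_primes hQ haQ hh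
  have haleQ : ∀ i < 4 * t, a i ≤ Q := fun i hi => Nat.le_of_dvd hQ (haQ i hi)
  have hm0F : m₀ ≤ 2 * ((2 ^ (4 * t * H) * Q) ^ (4 * t * H)) ^ 2 :=
    hm0le.trans (Nat.mul_le_mul_left _ (Nat.pow_le_pow_left hΓle 2))
  have hΓF : Γ ≤ 2 * ((2 ^ (4 * t * H) * Q) ^ (4 * t * H)) ^ 2 := by
    refine le_trans ?_ (Nat.mul_le_mul_left 2 (Nat.pow_le_pow_left hΓle 2))
    nlinarith
  obtain ⟨m, -, i', hi', j', hj', hne', heq'⟩ := exists_linear_forms_collision F t (Q * Γ)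
    (fun i => a i * Q * Γ) (fun i => a i * Q * m₀ + 1) ht
    (fun i hi => (Nat.mul_le_mul (Nat.mul_le_mul_right _ (haleQ i hi)) hΓF).trans
      ((Nat.le_succ _).trans hF))
    (fun i hi => (Nat.succ_le_succ
      (Nat.mul_le_mul (Nat.mul_le_mul_right _ (haleQ i hi)) hm0F)).trans hF)
    (fun i _ => Nat.succ_pos _)
    (fun i hi p hp hpD hpa => by
      rw [mul_assoc, hp.dvd_mul] at hpa
      exact hpD (hpa.elim (fun h => (h.trans (haQ i hi)).trans (dvd_mul_right _ _)) id))
  have hsplit : ∀ i < 4 * t, (a i * Q * Γ * m + (a i * Q * m₀ + 1)).primeFactors.card =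
      h i + ((a i * Q * Γ * m + (a i * Q * m₀ + 1)).primeFactors.filter
        (fun p => ¬ p ∣ Q * Γ)).card := by
    intro i hi
    rw [← Finset.card_filter_add_card_filter_not (fun p => p ∣ Q * Γ), ← hGcard i hi]
    congr 2
    ext p
    simp only [Finset.mem_filter, Nat.mem_primeFactors]
    constructor
    · rintro ⟨⟨hp, hpL, -⟩, hpD⟩
      have hpQ : ¬ p ∣ Q := by
        intro hpQ
        have h1 : p ∣ a i * Q * Γ * m + a i * Q * m₀ := by
          have e : a i * Q * Γ * m + a i * Q * m₀ = Q * (a i * (Γ * m + m₀)) := by ring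
          rw [e]
          exact hpQ.mul_right _
        rw [← add_assoc] at hpL
        exact hp.one_lt.ne' (Nat.dvd_one.mp ((Nat.dvd_add_right h1).mp hpL))
      have hpΓ : p ∣ Γ := (hp.dvd_mul.mp hpD).resolve_left hpQ
      obtain ⟨j, hj, hpj⟩ := hGΓ p hp hpΓ
      have h1 : p ∣ a i * Q * m₀ + 1 :=
        (Nat.dvd_add_right ((hpΓ.mul_left _).mul_right _)).mp hpL
      have h2 := (hG j hj p hpj).2.2.2
      have hpm : ¬ p ∣ m₀ := fun hpm =>
        hp.one_lt.ne' (Nat.dvd_one.mp ((Nat.dvd_add_right (hpm.mul_left _)).mp h1))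
      have hlt : ∀ i < 4 * t, ∀ j < i, p ∣ a i * Q * m₀ + 1 → ¬ p ∣ a j * Q * m₀ + 1 := by
        intro i hi j hji h1 h2
        have h3 := Nat.dvd_sub h2 h1
        have e : a j * Q * m₀ + 1 - (a i * Q * m₀ + 1) = (a j - a i) * Q * m₀ := by
          rw [Nat.add_sub_add_right, Nat.sub_mul, Nat.sub_mul]
        rw [e, hp.dvd_mul, hp.dvd_mul] at h3
        rcases h3 with (h3 | h3) | h3
        · exact hpQ ((h3.trans (hdvd i hi j hji).2).trans (haQ i hi))
        · exact hpQ h3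
        · exact hpm h3
      rcases lt_trichotomy i j with hij | hij | hij
      · exact absurd h1 (hlt j hj i hij h2)
      · rwa [hij]
      · exact absurd h2 (hlt i hi j hij h1)
    · intro hp
      obtain ⟨h1, h2, h3, h4⟩ := hG i hi p hp
      exact ⟨⟨h1, dvd_add ((h3.mul_left _).mul_right _) h4, Nat.succ_ne_zero _⟩, h3.mul_left _⟩
  have main : ∀ j < 4 * t, ∀ i < j,
      ((a i * Q * Γ * m + (a i * Q * m₀ + 1)).primeFactors.filter (fun p => ¬ p ∣ Q * Γ)).card =
      ((a j * Q * Γ * m + (a j * Q * m₀ + 1)).primeFactors.filter (fun p => ¬ p ∣ Q * Γ)).card →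
      ∃ x, X₀ < x ∧ x.primeFactors.card = (x + n).primeFactors.card := by
    intro j hj i hij heq
    have hi : i < 4 * t := by omega
    have sI := hsplit i hi
    have sJ := hsplit j hj
    obtain ⟨hlt, hd⟩ := hdvd j hj i hij
    have hb := hbal j hj i hij
    have e : ∀ i, a i * Q * Γ * m + (a i * Q * m₀ + 1) = Q * (a i * (Γ * m + m₀)) + 1 :=
      fun i => by ring
    rw [e] at sI sJ
    rw [e, e] at heq
    have hmul : ∀ i w, w ∣ Q → (n * w * (Q * (a i * (Γ * m + m₀)) + 1)).primeFactors.card =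
        (n * w).primeFactors.card + (Q * (a i * (Γ * m + m₀)) + 1).primeFactors.card := by
      intro i w hw
      have hQc : ∀ u, u ∣ Q → Nat.Coprime u (Q * (a i * (Γ * m + m₀)) + 1) := by
        rintro u ⟨v, hv⟩
        rw [hv, mul_assoc]
        simp
      have hc : Nat.Coprime (n * w) (Q * (a i * (Γ * m + m₀)) + 1) :=
        Nat.Coprime.mul_left (hQc n hnQ) (hQc w hw)
      rw [hc.primeFactors_mul, Finset.card_union_of_disjoint hc.disjoint_primeFactors]
    obtain ⟨b, hb'⟩ := hd
    set g := a i - a j with hg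
    have hg0 : 0 < g := by omega
    have hai : a i = g * (b + 1) := by rw [mul_add, ← hb']; omega
    have ej : a j / g = b := by rw [hb', Nat.mul_div_cancel_left _ hg0]
    have ei : a i / g = b + 1 := by rw [hai, Nat.mul_div_cancel_left _ hg0]
    have hb0 : 0 < b := by
      rcases Nat.eq_zero_or_pos b with h | h
      · have := hpos j hj
        simp [hb', h] at this
      · exact h
    rw [ej, ei] at hb
    have hbQ : b ∣ Q := (Dvd.intro_left g hb'.symm).trans (haQ j hj)
    have hbQ' : b + 1 ∣ Q := (Dvd.intro_left g hai.symm).trans (haQ i hi)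
    refine ⟨n * b * (Q * (a i * (Γ * m + m₀)) + 1), ?_, ?_⟩
    · have h1 : 1 ≤ a i * (Γ * m + m₀) := Nat.mul_pos (hpos i hi) (by omega)
      calc X₀ ≤ Q * 1 := by omega
        _ ≤ Q * (a i * (Γ * m + m₀)) := Nat.mul_le_mul_left _ h1
        _ < Q * (a i * (Γ * m + m₀)) + 1 := Nat.lt_succ_self _
        _ ≤ n * b * (Q * (a i * (Γ * m + m₀)) + 1) := Nat.le_mul_of_pos_left _ (Nat.mul_pos hn hb0)
    · have hx : n * b * (Q * (a i * (Γ * m + m₀)) + 1) + n =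
          n * (b + 1) * (Q * (a j * (Γ * m + m₀)) + 1) := by
        rw [hai, hb']; ring
      rw [hx, hmul i b hbQ, hmul j (b + 1) hbQ', sI, sJ, heq]
      omega
  rcases lt_or_gt_of_ne hne' with h | h
  · exact main j' hj' i' h heq'
  · exact main i' hi' j' h heq'.symm

theorem two_pow_card_primeFactors_le {x : ℕ} (hx : 0 < x) : 2 ^ x.primeFactors.card ≤ x :=
  (Finset.pow_card_le_prod _ (fun p => p) 2
    fun _ hp => (Nat.prime_of_mem_primeFactors hp).two_le).trans
    (Nat.le_of_dvd hx (Nat.prod_primeFactors_dvd x))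

theorem exists_labelled_primes (k c : ℕ) (hk : 0 < k) :
    ∃ E : Finset ℕ, ∃ τ : ℕ → ℕ, (∀ p ∈ E, p.Prime ∧ k < p) ∧ (∀ p ∈ E, τ p < k) ∧
      (∀ t < k, (E.filter (fun p => τ p = t)).card = c) ∧
      ∏ p ∈ E, p ≤ (2 ^ (k * c) * k) ^ (k * c) := by
  classical
  obtain ⟨q, hqm, hq⟩ := exists_strictMono_primes k hk
  have hinv : ∀ l, Function.invFun q (q l) = l := Function.leftInverse_invFun hqm.injective
  refine ⟨(Finset.range (k * c)).image q, fun p => Function.invFun q p / c, ?_, ?_, ?_, ?_⟩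
  · intro p hp
    obtain ⟨l, -, rfl⟩ := Finset.mem_image.mp hp
    exact ⟨(hq l).1, (hq l).2.1⟩
  · intro p hp
    obtain ⟨l, hl, rfl⟩ := Finset.mem_image.mp hp
    dsimp only
    rw [hinv]
    exact Nat.div_lt_of_lt_mul (by rw [mul_comm]; exact Finset.mem_range.mp hl)
  · intro t ht
    have e : ((Finset.range (k * c)).image q).filter (fun p => Function.invFun q p / c = t) =
        (Finset.range c).image (fun m => q (t * c + m)) := by
      ext p
      simp only [Finset.mem_filter, Finset.mem_image, Finset.mem_range]
      constructor
      · rintro ⟨⟨l, hl, rfl⟩, h⟩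
        rw [hinv] at h
        have hc : 0 < c := Nat.pos_of_ne_zero (by rintro rfl; simp at hl)
        refine ⟨l % c, Nat.mod_lt _ hc, ?_⟩
        rw [← h, Nat.div_add_mod']
      · rintro ⟨m, hm, rfl⟩
        refine ⟨⟨t * c + m, ?_, rfl⟩, ?_⟩
        · have h2 : (t + 1) * c ≤ k * c := Nat.mul_le_mul_right _ ht
          have h3 : (t + 1) * c = t * c + c := by ring
          omega
        · rw [hinv, mul_comm, Nat.mul_add_div (by omega), Nat.div_eq_of_lt hm, add_zero]
    rw [e, Finset.card_image_of_injective, Finset.card_range]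
    intro m m' hmm
    have := hqm.injective hmm
    omega
  · have hone : 1 ≤ 2 ^ (k * c) * k := Nat.mul_pos (by positivity) hk
    refine (Finset.prod_le_pow_card _ _ (2 ^ (k * c) * k) ?_).trans
      (Nat.pow_le_pow_right hone (Finset.card_image_le.trans (Finset.card_range _).le))
    intro p hp
    obtain ⟨l, hl, rfl⟩ := Finset.mem_image.mp hp
    exact (hq l).2.2.trans (Nat.mul_le_mul_right _
      (Nat.pow_le_pow_right (by norm_num) (Finset.mem_range.mp hl)))

/-- A decreasing tuple with `a i - a j ∣ a j` whose ratio pairs have numbers of prime factors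
balanced by `h`, together with explicit size bounds. -/
theorem exists_balanced_tuple (u n : ℕ) (hu : 0 < u) (hn : 0 < n) (hnk : n ≤ 2 ^ u) :
    ∃ a h : ℕ → ℕ, (∀ i < 2 ^ u, 0 < a i) ∧
      (∀ i < 2 ^ u, a i ≤ 2 ^ 2 ^ (4 * u + 4 + (u + 2) * (2 ^ u + 1))) ∧
      (∀ i < 2 ^ u, h i ≤ 2 ^ (4 * u + 4 + (u + 2) * (2 ^ u + 1) + 1)) ∧
      (∀ j < 2 ^ u, ∀ i < j, a j < a i ∧ a i - a j ∣ a j) ∧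
      (∀ j < 2 ^ u, ∀ i < j, (n * (a j / (a i - a j))).primeFactors.card + h i =
        (n * (a i / (a i - a j))).primeFactors.card + h j) := by
  classical
  set k := 2 ^ u with hkdef
  have hk : 0 < k := by positivity
  have hk2 : 2 ≤ k := Nat.le_self_pow hu.ne' 2
  set G := 4 * u + 4 + (u + 2) * (k + 1) with hG
  obtain ⟨c, hc⟩ : ∃ c, ((Finset.range (k + 1)).filter
    (fun p => p.Prime ∧ ¬ p ∣ n)).card = c := ⟨_, rfl⟩
  have hck : c ≤ 2 * k := by
    have := Finset.card_filter_le (Finset.range (k + 1)) (fun p => p.Prime ∧ ¬ p ∣ n)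
    rw [hc, Finset.card_range] at this
    omega
  have hkc : k * c ≤ 2 ^ (2 * u + 1) := by
    calc k * c ≤ k * (2 * k) := Nat.mul_le_mul_left _ hck
      _ = 2 ^ (2 * u + 1) := by rw [hkdef]; ring
  obtain ⟨E, τ, hE, hτ, hfib, hprod⟩ := exists_labelled_primes k c hk
  have hE0 : 0 < ∏ p ∈ E, p := Finset.prod_pos fun p hp => (hE p hp).1.pos
  set X := k.factorial * ∏ p ∈ E, p with hXdef
  have hX0 : 0 < X := Nat.mul_pos k.factorial_pos hE0
  have hX2 : 2 ≤ X := by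
    calc 2 ≤ k := hk2
      _ ≤ k.factorial := Nat.self_le_factorial k
      _ ≤ X := Nat.le_mul_of_pos_right _ hE0
  have hXk : ∀ p, p.Prime → p ≤ k → p ∣ X := fun p hp hpk =>
    (Nat.dvd_factorial hp.pos hpk).mul_right _
  have hXE : ∀ p ∈ E, p ∣ X := fun p hp =>
    (Finset.dvd_prod_of_mem (fun p => p) hp).mul_left _
  have huk : u ≤ k := Nat.lt_two_pow_self.le
  have hXle : X ≤ 2 ^ 2 ^ (4 * u + 4) := by
    have h1 : k.factorial ≤ 2 ^ 2 ^ (4 * u + 3) := by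
      calc k.factorial ≤ k ^ k := Nat.factorial_le_pow k
        _ = 2 ^ (u * k) := by rw [hkdef, ← pow_mul]
        _ ≤ 2 ^ (k * k) := Nat.pow_le_pow_right (by norm_num) (Nat.mul_le_mul_right _ huk)
        _ = 2 ^ 2 ^ (2 * u) := by rw [hkdef]; ring_nf
        _ ≤ 2 ^ 2 ^ (4 * u + 3) :=
          Nat.pow_le_pow_right (by norm_num) (Nat.pow_le_pow_right (by norm_num) (by omega))
    have h2 : ∏ p ∈ E, p ≤ 2 ^ 2 ^ (4 * u + 3) := by
      have h3 : 2 ^ (k * c) * k ≤ 2 ^ 2 ^ (2 * u + 2) := by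
        rw [hkdef, ← pow_add, ← hkdef]
        apply Nat.pow_le_pow_right (by norm_num)
        have : u ≤ 2 ^ (2 * u + 1) :=
          huk.trans (Nat.pow_le_pow_right (by norm_num) (by omega))
        calc k * c + u ≤ 2 ^ (2 * u + 1) + 2 ^ (2 * u + 1) := Nat.add_le_add hkc this
          _ = 2 ^ (2 * u + 2) := by ring
      calc ∏ p ∈ E, p ≤ (2 ^ (k * c) * k) ^ (k * c) := hprod
        _ ≤ (2 ^ 2 ^ (2 * u + 2)) ^ 2 ^ (2 * u + 1) :=
          (Nat.pow_le_pow_left h3 _).trans (Nat.pow_le_pow_right (by positivity) hkc)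
        _ = 2 ^ 2 ^ (4 * u + 3) := by rw [← pow_mul, ← pow_add]; ring_nf
    calc X ≤ 2 ^ 2 ^ (4 * u + 3) * 2 ^ 2 ^ (4 * u + 3) := Nat.mul_le_mul h1 h2
      _ = 2 ^ 2 ^ (4 * u + 4) := by rw [← pow_add]; ring_nf
  obtain ⟨s, hs⟩ := exists_stagedTuple hE hX2 hXk hXE (τ := τ) k le_rfl
  have hexp : (2 * k + 4) ^ k ≠ 0 := by positivity
  have hXT : X ≤ X ^ ((2 * k + 4) ^ k) := Nat.le_self_pow hexp X
  obtain ⟨a, ha, hdvd, hchain, hctrl, hlevel⟩ :=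
    hs.exists_translate hk hE hτ hX0 hXk hXE hXT (hX2.trans hXT)
  have hale : ∀ i < k, a i ≤ 2 ^ 2 ^ G := by
    intro i hi
    have h4 : 2 * k + 4 ≤ 2 ^ (u + 2) := by
      have : 2 ^ (u + 2) = 4 * k := by rw [hkdef]; ring
      omega
    calc a i ≤ (X ^ ((2 * k + 4) ^ k)) ^ (2 * k + 4) := (ha i hi).2
      _ = X ^ (2 * k + 4) ^ (k + 1) := by rw [← pow_mul, pow_succ]
      _ ≤ (2 ^ 2 ^ (4 * u + 4)) ^ (2 ^ (u + 2)) ^ (k + 1) :=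
        (Nat.pow_le_pow_left hXle _).trans
          (Nat.pow_le_pow_right (by positivity) (Nat.pow_le_pow_left h4 _))
      _ = 2 ^ 2 ^ G := by rw [← pow_mul, ← pow_mul, ← pow_add]
  refine ⟨a, fun i => c * i + ((a i).primeFactors.filter (fun p => k < p ∧ p ∉ E)).card,
    fun i hi => (ha i hi).1, hale, ?_, hdvd, ?_⟩
  · intro i hi
    have h1 : c * i ≤ 2 ^ G := by
      calc c * i ≤ c * k := Nat.mul_le_mul_left _ hi.le
        _ = k * c := mul_comm _ _
        _ ≤ 2 ^ (2 * u + 1) := hkc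
        _ ≤ 2 ^ G := Nat.pow_le_pow_right (by norm_num) (by omega)
    have h2 : (a i).primeFactors.card ≤ 2 ^ G :=
      (Nat.pow_le_pow_iff_right (by norm_num)).mp
        ((two_pow_card_primeFactors_le (ha i hi).1).trans (hale i hi))
    have h3 := Finset.card_filter_le (a i).primeFactors (fun p => k < p ∧ p ∉ E)
    dsimp only
    rw [pow_succ]
    omega
  · intro j hj i hij
    exact card_primeFactors_balanced hn hnk hc hE hfib (fun i hi => (ha i hi).1) hdvd hchain
      hctrl hlevel j hj i hij

theorem thousand_mul_add_le_two_pow {v : ℕ} (hv : 15 ≤ v) : 1000 * (v + 4) ≤ 2 ^ v := by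
  induction v, hv using Nat.le_induction with
  | base => norm_num
  | succ v hv ih =>
    rw [pow_succ]
    omega

theorem mul_mul_two_mul_pow_add_one_le {Q R K : ℕ} (hQ : Q ≤ 2 ^ 2 ^ K) (hR : R ≤ 2 ^ K) :
    Q * Q * (2 * ((2 ^ R * Q) ^ R) ^ 2) + 1 ≤ 2 ^ 2 ^ (2 * K + 4) := by
  have h1 : 2 ^ R * Q ≤ 2 ^ 2 ^ (K + 1) := by
    calc 2 ^ R * Q ≤ 2 ^ 2 ^ K * 2 ^ 2 ^ K :=
          Nat.mul_le_mul (Nat.pow_le_pow_right (by norm_num) hR) hQ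
      _ = 2 ^ 2 ^ (K + 1) := by rw [← pow_add]; ring_nf
  have h2 : (2 ^ R * Q) ^ R ≤ 2 ^ 2 ^ (2 * K + 1) := by
    calc (2 ^ R * Q) ^ R ≤ (2 ^ 2 ^ (K + 1)) ^ 2 ^ K :=
          (Nat.pow_le_pow_left h1 _).trans (Nat.pow_le_pow_right (by positivity) hR)
      _ = 2 ^ 2 ^ (2 * K + 1) := by rw [← pow_mul, ← pow_add]; ring_nf
  have h3 : Q * Q * (2 * ((2 ^ R * Q) ^ R) ^ 2) ≤ 2 ^ (2 ^ (K + 1) + (1 + 2 ^ (2 * K + 2))) := by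
    calc Q * Q * (2 * ((2 ^ R * Q) ^ R) ^ 2)
        ≤ 2 ^ 2 ^ K * 2 ^ 2 ^ K * (2 * (2 ^ 2 ^ (2 * K + 1)) ^ 2) :=
          Nat.mul_le_mul (Nat.mul_le_mul hQ hQ)
            (Nat.mul_le_mul_left _ (Nat.pow_le_pow_left h2 2))
      _ = 2 ^ (2 ^ (K + 1) + (1 + 2 ^ (2 * K + 2))) := by
        rw [← pow_add, ← pow_mul, pow_add 2 (2 ^ (K + 1)), pow_add 2 1]; ring_nf
  have h4 : 2 ^ (K + 1) + (1 + 2 ^ (2 * K + 2)) + 1 ≤ 2 ^ (2 * K + 4) := by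
    have e1 : 2 ^ (K + 1) ≤ 2 ^ (2 * K + 2) := Nat.pow_le_pow_right (by norm_num) (by omega)
    have e2 : 2 ^ (2 * K + 4) = 4 * 2 ^ (2 * K + 2) := by ring
    have e3 : 2 ^ 1 ≤ 2 ^ (2 * K + 2) := Nat.pow_le_pow_right (by norm_num) (by omega)
    omega
  have h5 : 1 ≤ 2 ^ (2 ^ (K + 1) + (1 + 2 ^ (2 * K + 2))) := Nat.one_le_two_pow
  calc _ ≤ 2 ^ (2 ^ (K + 1) + (1 + 2 ^ (2 * K + 2))) * 2 := by omega
    _ = 2 ^ (2 ^ (K + 1) + (1 + 2 ^ (2 * K + 2)) + 1) := (pow_succ _ _).symm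
    _ ≤ 2 ^ 2 ^ (2 * K + 4) := Nat.pow_le_pow_right (by norm_num) h4

theorem exists_gt_primeFactors_card_eq (n X₀ : ℕ) (hn : 0 < n) (hX₀ : 0 < X₀) :
    ∃ x, X₀ < x ∧ x.primeFactors.card = (x + n).primeFactors.card := by
  set v := 15 + n + X₀ with hv
  set t := 2 ^ v with ht
  have hvt : 1000 * (v + 4) ≤ t := thousand_mul_add_le_two_pow (by omega)
  have hk : 2 ^ (v + 2) = 4 * t := by rw [ht]; ring
  obtain ⟨a, h, hpos, hale, hhle, hdvd, hbal⟩ :=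
    exists_balanced_tuple (v + 2) n (by omega) hn (by omega)
  set G := 4 * (v + 2) + 4 + (v + 2 + 2) * (2 ^ (v + 2) + 1) with hG
  have hK : 2 ^ (v + 2) * 2 ^ (G + 1) ≤ 2 ^ (G + v + 4) := by
    rw [← pow_add]
    exact Nat.pow_le_pow_right (by norm_num) (by omega)
  rw [hk] at hpos hale hhle hdvd hbal hG hK
  have hprod : ∏ i ∈ Finset.range (4 * t), a i ≤ 2 ^ 2 ^ (G + v + 3) := by
    refine (Finset.prod_le_pow_card _ _ (2 ^ 2 ^ G)
      (fun i hi => hale i (Finset.mem_range.mp hi))).trans ?_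
    rw [Finset.card_range, ← hk, ← pow_mul, ← pow_add]
    exact Nat.pow_le_pow_right (by norm_num) (Nat.pow_le_pow_right (by norm_num) (by omega))
  have hP0 : 0 < ∏ i ∈ Finset.range (4 * t), a i :=
    Finset.prod_pos fun i hi => hpos i (Finset.mem_range.mp hi)
  have hnX : n * X₀ ≤ 2 ^ 2 ^ (G + v + 3) := by
    have h1 : n ≤ 2 ^ v := by omega
    have h2 : X₀ ≤ 2 ^ v := by omega
    calc n * X₀ ≤ 2 ^ v * 2 ^ v := Nat.mul_le_mul h1 h2
      _ = 2 ^ (v + v) := (pow_add _ _ _).symm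
      _ ≤ 2 ^ 2 ^ (G + v + 3) := by
        apply Nat.pow_le_pow_right (by norm_num)
        have : 2 ^ (v + 1) ≤ 2 ^ (G + v + 3) := Nat.pow_le_pow_right (by norm_num) (by omega)
        rw [pow_succ] at this
        omega
  refine exists_gt_card_primeFactors_eq (t := t) (Q := n * X₀ * ∏ i ∈ Finset.range (4 * t), a i)
    (F := 2 * (G + v + 4) + 4) (H := 2 ^ (G + 1)) (a := a) (h := h)
    ?_ hn (by positivity) ?_ ?_ hpos ?_ hdvd hbal hhle ?_
  · rw [hG]
    nlinarith
  · rw [mul_assoc, mul_comm n, mul_assoc]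
    exact Nat.le_mul_of_pos_right _ (Nat.mul_pos hP0 hn)
  · exact (dvd_mul_right n X₀).mul_right _
  · exact fun i hi => (Finset.dvd_prod_of_mem a (Finset.mem_range.mpr hi)).mul_left _
  · apply mul_mul_two_mul_pow_add_one_le _ hK
    calc n * X₀ * ∏ i ∈ Finset.range (4 * t), a i
        ≤ 2 ^ 2 ^ (G + v + 3) * 2 ^ 2 ^ (G + v + 3) := Nat.mul_le_mul hnX hprod
      _ = 2 ^ 2 ^ (G + v + 4) := by rw [← pow_add]; ring_nf

/-- For every positive integer `n`, there are infinitely many positive integers `x`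
with `ω(x) = ω(x + n)`. -/
theorem stmt_9 (n : ℕ) (hn : 0 < n) :
    {x : ℕ | 0 < x ∧ x.primeFactors.card = (x + n).primeFactors.card}.Infinite := by
  refine Set.infinite_of_forall_exists_gt fun b => ?_
  obtain ⟨x, hx, hω⟩ := exists_gt_primeFactors_card_eq n (b + 1) hn (Nat.succ_pos b)
  exact ⟨x, ⟨by omega, hω⟩, by omega⟩
end

section
/- For every positive integer n, there are infinitely many positive integers x such that λ(x) = λ(x + n), where λ is the Liouville function λ(x) = (−1)^{Ω(x)}. -/
/-- The Liouville function `λ(x) = (-1)^{Ω(x)}`. -/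
def liouville (x : ℕ) : ℤ := (-1) ^ x.primeFactorsList.length

theorem liouville_mul {a b : ℕ} (ha : a ≠ 0) (hb : b ≠ 0) :
    liouville (a * b) = liouville a * liouville b := by
  simp [liouville, (Nat.perm_primeFactorsList_mul ha hb).length_eq, pow_add]

theorem liouville_two : liouville 2 = -1 := by
  simp [liouville, Nat.primeFactorsList_prime Nat.prime_two]

theorem liouville_eq_one_or_neg_one (x : ℕ) : liouville x = 1 ∨ liouville x = -1 :=
  neg_one_pow_eq_or ℤ _

/-- If `λ` alternated beyond `B`, it would be constant on large even numbers,
contradicting `λ(2x) = -λ(x)`. -/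
theorem exists_gt_liouville_eq_succ (B : ℕ) : ∃ y, B < y ∧ liouville y = liouville (y + 1) := by
  by_contra! h
  have periodic (y : ℕ) (hy : B < y) : liouville (y + 2) = liouville y := by
    have h₁ := h y hy
    have h₂ := h (y + 1) (by omega)
    have := liouville_eq_one_or_neg_one y
    have := liouville_eq_one_or_neg_one (y + 1)
    have := liouville_eq_one_or_neg_one (y + 2)
    grind
  have const (y : ℕ) (hy : B < y) (k : ℕ) : liouville (y + 2 * k) = liouville y := by
    induction k with
    | zero => rfl
    | succ k ih => rw [← ih, ← periodic (y + 2 * k) (by omega)]; rfl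
  have hc := const (2 * (B + 1)) (by omega) (B + 1)
  rw [← two_mul, liouville_mul (by simp) (by simp), liouville_two] at hc
  have := liouville_eq_one_or_neg_one (2 * (B + 1))
  omega

/-- For every positive integer `n`, there are infinitely many positive integers `x`
with `λ(x) = λ(x + n)`. -/
theorem stmt_10 (n : ℕ) (hn : 0 < n) :
    {x : ℕ | 0 < x ∧ liouville x = liouville (x + n)}.Infinite := by
  refine Set.infinite_of_forall_exists_gt fun B => ?_
  obtain ⟨y, hy, h⟩ := exists_gt_liouville_eq_succ B
  refine ⟨n * y, ⟨Nat.mul_pos hn (by omega), ?_⟩, hy.trans_le (Nat.le_mul_of_pos_left y hn)⟩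
  rw [← Nat.mul_succ, liouville_mul hn.ne' (by omega), liouville_mul hn.ne' (by omega), h]
end

section
/- For every positive integer n, there exists a positive integer A (depending only on n) such that d(x) = d(x + n) = A for infinitely many positive integers x, where d denotes the number-of-divisors function. -/
open Finset

/-- The elementary symmetric sum of degree `r` of the values of `g` on `P`. -/
noncomputable def esum (g : ℕ → ℝ) (P : Finset ℕ) (r : ℕ) : ℝ :=
  ∑ S ∈ P.powersetCard r, ∏ p ∈ S, g p

/-- The inclusion-exclusion sum for `∏ p ∈ P, (1 - g p)`, cut off before degree `r`. -/
noncomputable def altsum (g : ℕ → ℝ) (P : Finset ℕ) (r : ℕ) : ℝ :=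
  ∑ s ∈ range r, (-1) ^ s * esum g P s

lemma esum_zero (g : ℕ → ℝ) (P : Finset ℕ) : esum g P 0 = 1 := by simp [esum]

lemma esum_insert {g : ℕ → ℝ} {P : Finset ℕ} {p : ℕ} (hp : p ∉ P) (r : ℕ) :
    esum g (insert p P) (r + 1) = esum g P (r + 1) + g p * esum g P r := by
  unfold esum
  rw [powersetCard_succ_insert hp, sum_union, sum_image, mul_sum]
  · congr 1
    refine sum_congr rfl fun S hS => ?_
    rw [prod_insert (fun h => hp ((mem_powersetCard.1 hS).1 h))]
  · intro S hS T hT h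
    have hS' : p ∉ S := fun h => hp ((mem_powersetCard.1 hS).1 h)
    have hT' : p ∉ T := fun h => hp ((mem_powersetCard.1 hT).1 h)
    rw [← erase_insert hS', ← erase_insert hT', h]
  · rw [disjoint_left]
    intro S hS hS'
    obtain ⟨T, -, rfl⟩ := mem_image.1 hS'
    exact hp ((mem_powersetCard.1 hS).1 (mem_insert_self _ _))

lemma altsum_insert {g : ℕ → ℝ} {P : Finset ℕ} {p : ℕ} (hp : p ∉ P) (r : ℕ) :
    altsum g (insert p P) (r + 1) = altsum g P (r + 1) - g p * altsum g P r := by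
  induction r with
  | zero => simp [altsum, esum_zero]
  | succ r ih =>
    have h (Q : Finset ℕ) (s : ℕ) : altsum g Q (s + 1) = altsum g Q s + (-1) ^ s * esum g Q s :=
      sum_range_succ _ _
    rw [h, ih, h P (r + 1), h P r, esum_insert hp]
    ring

lemma esum_nonneg {g : ℕ → ℝ} {P : Finset ℕ} (h0 : ∀ p ∈ P, 0 ≤ g p) (r : ℕ) :
    0 ≤ esum g P r :=
  sum_nonneg fun _ hS => prod_nonneg fun p hp => h0 p ((mem_powersetCard.1 hS).1 hp)

/-- The Bonferroni inequalities. -/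
lemma bonferroni {g : ℕ → ℝ} (P : Finset ℕ) (h0 : ∀ p ∈ P, 0 ≤ g p) (h1 : ∀ p ∈ P, g p ≤ 1)
    (r : ℕ) :
    0 ≤ (-1) ^ r * (∏ p ∈ P, (1 - g p) - altsum g P r) ∧
      (-1) ^ r * (∏ p ∈ P, (1 - g p) - altsum g P r) ≤ esum g P r := by
  induction P using Finset.induction_on generalizing r with
  | empty =>
    rcases r with _ | r
    · simp [altsum, esum_zero]
    · have : altsum g ∅ (r + 1) = 1 := by
        unfold altsum
        rw [sum_range_succ', sum_eq_zero]
        · simp [esum_zero]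
        · intro s _
          rw [esum, powersetCard_eq_empty.2 (by simp)]
          simp
      rw [this]
      simpa using esum_nonneg h0 _
  | insert p P hp ih =>
    have h0' : ∀ p ∈ P, 0 ≤ g p := fun q hq => h0 q (mem_insert_of_mem hq)
    have h1' : ∀ p ∈ P, g p ≤ 1 := fun q hq => h1 q (mem_insert_of_mem hq)
    have hg0 := h0 p (mem_insert_self _ _)
    have hg1 := h1 p (mem_insert_self _ _)
    rw [prod_insert hp]
    rcases r with _ | r
    · have hV : 0 ≤ ∏ p ∈ P, (1 - g p) := prod_nonneg fun q hq => by linarith [h1' q hq]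
      have hV1 : ∏ p ∈ P, (1 - g p) ≤ 1 :=
        prod_le_one (fun q hq => by linarith [h1' q hq]) fun q hq => by linarith [h0' q hq]
      simp only [altsum, esum_zero, range_zero, sum_empty, pow_zero, one_mul, sub_zero]
      constructor
      · exact mul_nonneg (by linarith) hV
      · nlinarith
    · obtain ⟨a1, a2⟩ := ih h0' h1' (r + 1)
      obtain ⟨b1, b2⟩ := ih h0' h1' r
      rw [altsum_insert hp, esum_insert hp]
      have e : (-1 : ℝ) ^ (r + 1) * ((1 - g p) * ∏ p ∈ P, (1 - g p) -
          (altsum g P (r + 1) - g p * altsum g P r)) =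
          (-1) ^ (r + 1) * (∏ p ∈ P, (1 - g p) - altsum g P (r + 1)) +
          g p * ((-1) ^ r * (∏ p ∈ P, (1 - g p) - altsum g P r)) := by
        rw [pow_succ]; ring
      rw [e]
      exact ⟨by positivity, by gcongr⟩

/-- On every residue class to a modulus coprime to `Q`, the values of `F` at the `t < N` have the
sum that is expected for a function of mean `μ`, up to an error `E`. -/
def MeanInAP (N : ℕ) (F : ℕ → ℝ) (Q : ℕ) (μ E : ℝ) : Prop :=
  ∀ q a : ℕ, 0 < q → q.Coprime Q →
    |∑ t ∈ range N with t ≡ a [MOD q], F t - μ * N / q| ≤ E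

lemma card_modEq_sub_le (N q a : ℕ) (hq : 0 < q) :
    |(#{t ∈ range N | t ≡ a [MOD q]} : ℝ) - N / q| ≤ 1 := by
  have h := Nat.count_modEq_card N hq a
  rw [Nat.count_eq_card_filter_range] at h
  rw [h]
  have hN : (N : ℝ) = q * (N / q : ℕ) + (N % q : ℕ) := by exact_mod_cast (Nat.div_add_mod N q).symm
  have hq' : (0 : ℝ) < q := by exact_mod_cast hq
  have hlt : ((N % q : ℕ) : ℝ) < q := by exact_mod_cast Nat.mod_lt N hq
  have e : (N : ℝ) / q = (N / q : ℕ) + (N % q : ℕ) / q := by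
    field_simp; linarith
  have h0 : (0 : ℝ) ≤ (N % q : ℕ) / q := by positivity
  have h1 : ((N % q : ℕ) : ℝ) / q ≤ 1 := by rw [div_le_one hq']; exact hlt.le
  rw [e, abs_le]
  split_ifs <;> push_cast <;> constructor <;> linarith

lemma meanInAP_one (N : ℕ) : MeanInAP N (fun _ => 1) 1 1 1 := by
  intro q a hq _
  simpa using card_modEq_sub_le N q a hq

namespace MeanInAP

variable {N : ℕ} {F : ℕ → ℝ} {Q : ℕ} {μ E : ℝ}

lemma nonneg (h : MeanInAP N F Q μ E) : 0 ≤ E :=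
  (abs_nonneg _).trans (h 1 0 one_pos (Nat.coprime_one_left _))

lemma of_dvd (h : MeanInAP N F Q μ E) {Q' : ℕ} (hQ : Q ∣ Q') : MeanInAP N F Q' μ E :=
  fun q a hq hc => h q a hq (hc.coprime_dvd_right hQ)

lemma mono (h : MeanInAP N F Q μ E) {E' : ℝ} (hE : E ≤ E') : MeanInAP N F Q μ E' :=
  fun q a hq hc => (h q a hq hc).trans hE

lemma sum {ι : Type*} (s : Finset ι) {F : ι → ℕ → ℝ} {μ E : ι → ℝ} (c : ι → ℝ)
    (hc : ∀ i ∈ s, |c i| ≤ 1) (h : ∀ i ∈ s, MeanInAP N (F i) Q (μ i) (E i)) :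
    MeanInAP N (fun t => ∑ i ∈ s, c i * F i t) Q (∑ i ∈ s, c i * μ i) (∑ i ∈ s, E i) := by
  intro q a hq hqQ
  rw [sum_comm, sum_mul, sum_div, ← sum_sub_distrib]
  refine (abs_sum_le_sum_abs _ _).trans (sum_le_sum fun i hi => ?_)
  have := h i hi q a hq hqQ
  rw [← mul_sum, show c i * μ i * N / q = c i * (μ i * N / q) by ring, ← mul_sub, abs_mul]
  calc _ ≤ 1 * E i := by gcongr; exact hc i hi
    _ = E i := one_mul _

lemma sub {F' : ℕ → ℝ} {μ' E' : ℝ} (h : MeanInAP N F Q μ E) (h' : MeanInAP N F' Q μ' E') :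
    MeanInAP N (fun t => F t - F' t) Q (μ - μ') (E + E') := by
  intro q a hq hc
  rw [sum_sub_distrib]
  have h1 := h q a hq hc
  have h2 := h' q a hq hc
  calc _ = |(∑ t ∈ range N with t ≡ a [MOD q], F t - μ * N / q) -
        (∑ t ∈ range N with t ≡ a [MOD q], F' t - μ' * N / q)| := by congr 1; ring
    _ ≤ _ := (abs_sub _ _).trans (add_le_add h1 h2)

lemma mul_indicator (h : MeanInAP N F Q μ E) {p : ℕ} (hp : 0 < p) (hpQ : p.Coprime Q)
    {Ω : Finset ℕ} (hΩ : Ω ⊆ range p) :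
    MeanInAP N (fun t => F t * if t % p ∈ Ω then 1 else 0) (Q * p) (μ * (#Ω / p)) (E * #Ω) := by
  intro q a hq hqQ
  have hqp : q.Coprime p := hqQ.coprime_dvd_right (dvd_mul_left _ _)
  have hqQ' : q.Coprime Q := hqQ.coprime_dvd_right (dvd_mul_right _ _)
  have key : ∑ t ∈ range N with t ≡ a [MOD q], F t * (if t % p ∈ Ω then 1 else 0) =
      ∑ c ∈ Ω, ∑ t ∈ range N with t ≡ (Nat.chineseRemainder hqp a c : ℕ) [MOD q * p], F t := by
    simp only [sum_filter]
    rw [sum_comm]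
    refine sum_congr rfl fun t _ => ?_
    have hiff (c : ℕ) (hc : c ∈ Ω) : t ≡ (Nat.chineseRemainder hqp a c : ℕ) [MOD q * p] ↔
        t ≡ a [MOD q] ∧ c = t % p := by
      have hx := (Nat.chineseRemainder hqp a c).2
      rw [← Nat.modEq_and_modEq_iff_modEq_mul hqp]
      have hcp : c % p = c := Nat.mod_eq_of_lt (mem_range.1 (hΩ hc))
      constructor
      · rintro ⟨h1, h2⟩
        have h3 : t ≡ c [MOD p] := h2.trans hx.2
        exact ⟨h1.trans hx.1, by rw [h3, hcp]⟩
      · rintro ⟨h1, h2⟩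
        have h3 : t ≡ c [MOD p] := by rw [Nat.ModEq, hcp, h2]
        exact ⟨h1.trans hx.1.symm, h3.trans hx.2.symm⟩
    rw [sum_congr rfl fun c hc => if_congr (hiff c hc) rfl rfl]
    by_cases h1 : t ≡ a [MOD q] <;> simp [h1]
  have e : μ * (#Ω / p) * N / q = ∑ c ∈ Ω, μ * N / ((q * p : ℕ) : ℝ) := by
    rw [sum_const, nsmul_eq_mul]
    push_cast
    have : (p : ℝ) ≠ 0 := by positivity
    have : (q : ℝ) ≠ 0 := by positivity
    field_simp
  rw [key, e, ← sum_sub_distrib]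
  refine (abs_sum_le_sum_abs _ _).trans ((sum_le_sum fun c _ => h (q * p) _ (by positivity)
    (Nat.Coprime.mul_left hqQ' hpQ)).trans (le_of_eq ?_))
  rw [sum_const, nsmul_eq_mul, mul_comm]

/-- Multiplication by the indicator functions of the sets of residues `Ω p`, for `p ∈ S`. -/
lemma mul_prod (h : MeanInAP N F Q μ E) {Ω : ℕ → Finset ℕ} (S : Finset ℕ)
    (hS : ∀ p ∈ S, p.Prime) (hΩ : ∀ p ∈ S, Ω p ⊆ range p) (hQ : ∀ p ∈ S, p.Coprime Q) :
    MeanInAP N (fun t => F t * ∏ p ∈ S, if t % p ∈ Ω p then 1 else 0) (Q * ∏ p ∈ S, p)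
      (μ * ∏ p ∈ S, ((#(Ω p) : ℝ) / p)) (E * ∏ p ∈ S, (#(Ω p) : ℝ)) := by
  induction S using Finset.induction_on with
  | empty => simpa using h
  | insert p S hp ih =>
    have h1 := ih (fun q hq => hS q (mem_insert_of_mem hq))
      (fun q hq => hΩ q (mem_insert_of_mem hq))
      (fun q hq => hQ q (mem_insert_of_mem hq))
    have hpp := hS p (mem_insert_self _ _)
    have h2 := h1.mul_indicator hpp.pos (Nat.Coprime.mul_right (hQ p (mem_insert_self _ _))
      (Nat.Coprime.prod_right fun q hq => (Nat.coprime_primes hpp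
        (hS q (mem_insert_of_mem hq))).2 fun e => hp (e ▸ hq))) (hΩ p (mem_insert_self _ _))
    simp only [prod_insert hp]
    convert h2 using 1
    · ext t; ring
    · ring
    · ring
    · ring

lemma mul_esum (h : MeanInAP N F Q μ E) {Ω : ℕ → Finset ℕ} {k : ℕ} (P : Finset ℕ)
    (hP : ∀ p ∈ P, p.Prime) (hΩ : ∀ p ∈ P, Ω p ⊆ range p) (hQ : ∀ p ∈ P, p.Coprime Q)
    (hk : ∀ p ∈ P, #(Ω p) ≤ k) (r : ℕ) :
    MeanInAP N (fun t => F t * esum (fun p => if t % p ∈ Ω p then 1 else 0) P r)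
      (Q * ∏ p ∈ P, p) (μ * esum (fun p => (#(Ω p) : ℝ) / p) P r)
      (E * ((#P).choose r * k ^ r)) := by
  have h1 := MeanInAP.sum (N := N) (Q := Q * ∏ p ∈ P, p) (P.powersetCard r)
    (F := fun S t => F t * ∏ p ∈ S, if t % p ∈ Ω p then 1 else 0)
    (μ := fun S => μ * ∏ p ∈ S, ((#(Ω p) : ℝ) / p)) (E := fun S => E * k ^ r) (fun _ => 1)
    (by simp) (fun S hS => by
      obtain ⟨hSP, hc⟩ := mem_powersetCard.1 hS
      refine ((h.mul_prod S (fun p hp => hP p (hSP hp)) (fun p hp => hΩ p (hSP hp))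
        (fun p hp => hQ p (hSP hp))).of_dvd
          (mul_dvd_mul_left _ (prod_dvd_prod_of_subset _ _ _ hSP))).mono
        (mul_le_mul_of_nonneg_left ?_ h.nonneg)
      rw [← hc, ← prod_const]
      exact prod_le_prod (fun _ _ => by positivity) fun p hp => by exact_mod_cast hk p (hSP hp))
  convert h1 using 1
  · ext t; simp [esum, mul_sum]
  · simp [esum, mul_sum]
  · simp; ring

lemma mul_altsum (h : MeanInAP N F Q μ E) {Ω : ℕ → Finset ℕ} {k : ℕ} (P : Finset ℕ)
    (hP : ∀ p ∈ P, p.Prime) (hΩ : ∀ p ∈ P, Ω p ⊆ range p) (hQ : ∀ p ∈ P, p.Coprime Q)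
    (hk : ∀ p ∈ P, #(Ω p) ≤ k) (r : ℕ) :
    MeanInAP N (fun t => F t * altsum (fun p => if t % p ∈ Ω p then 1 else 0) P r)
      (Q * ∏ p ∈ P, p) (μ * altsum (fun p => (#(Ω p) : ℝ) / p) P r)
      (E * ∑ s ∈ range r, ((#P).choose s * k ^ s : ℝ)) := by
  have h1 := MeanInAP.sum (N := N) (Q := Q * ∏ p ∈ P, p) (range r) (fun s => (-1) ^ s)
    (by simp) (fun s _ => h.mul_esum P hP hΩ hQ hk s)
  convert h1 using 1
  · ext t
    simp only [altsum, mul_sum]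
    exact sum_congr rfl fun _ _ => by ring
  · simp only [altsum, mul_sum]
    exact sum_congr rfl fun _ _ => by ring
  · rw [mul_sum]

end MeanInAP

/-- Upper and lower bound functions, with controlled means, for the indicator function of the
integers whose residues mod `p` avoid `Ω p` for all `p` in the blocks `P 0, …, P (J - 1)`. -/
lemma exists_sieve_functions {N k : ℕ} {P Ω : ℕ → Finset ℕ} {r : ℕ → ℕ} {ε D : ℕ → ℝ}
    (hP : ∀ j, ∀ p ∈ P j, p.Prime) (hdisj : ∀ i j, i < j → Disjoint (P i) (P j))
    (hΩ : ∀ j, ∀ p ∈ P j, Ω p ⊆ range p) (hk : ∀ j, ∀ p ∈ P j, #(Ω p) ≤ k)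
    (hr : ∀ j, Odd (r j)) (hε0 : ∀ j, 0 ≤ ε j)
    (hε : ∀ j, esum (fun p => (#(Ω p) : ℝ) / p) (P j) (r j) ≤
      ε j * ∏ p ∈ P j, (1 - (#(Ω p) : ℝ) / p))
    (hD : ∀ j, ∑ s ∈ range (r j + 1), ((#(P j)).choose s * k ^ s : ℝ) ≤ D j)
    (J : ℕ) (hJ : ∏ j ∈ range J, (1 + ε j) ≤ 2) :
    ∃ (U L : ℕ → ℝ) (μ ν : ℝ),
      MeanInAP N U (∏ j ∈ range J, ∏ p ∈ P j, p) μ (∏ j ∈ range J, D j) ∧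
      MeanInAP N L (∏ j ∈ range J, ∏ p ∈ P j, p) ν ((J + 1) * ∏ j ∈ range J, D j) ∧
      (∀ t, ∏ j ∈ range J, ∏ p ∈ P j, (1 - if t % p ∈ Ω p then (1 : ℝ) else 0) ≤ U t) ∧
      (∀ t, L t ≤ ∏ j ∈ range J, ∏ p ∈ P j, (1 - if t % p ∈ Ω p then (1 : ℝ) else 0)) ∧
      μ ≤ (∏ j ∈ range J, ∏ p ∈ P j, (1 - (#(Ω p) : ℝ) / p)) * ∏ j ∈ range J, (1 + ε j) ∧
      (∏ j ∈ range J, ∏ p ∈ P j, (1 - (#(Ω p) : ℝ) / p)) * (2 - ∏ j ∈ range J, (1 + ε j)) ≤ ν ∧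
      0 ≤ μ := by
  have hg1 (j : ℕ) : ∀ p ∈ P j, (#(Ω p) : ℝ) / p ≤ 1 := fun p hp => by
    rw [div_le_one (by exact_mod_cast (hP j p hp).pos)]
    exact_mod_cast (card_le_card (hΩ j p hp)).trans (card_range p).le
  have hg0 (j : ℕ) : ∀ p ∈ P j, 0 ≤ (#(Ω p) : ℝ) / p := fun p _ => by positivity
  have hi0 (j t : ℕ) : ∀ p ∈ P j, 0 ≤ if t % p ∈ Ω p then (1 : ℝ) else 0 :=
    fun p _ => by split_ifs <;> norm_num
  have hi1 (j t : ℕ) : ∀ p ∈ P j, (if t % p ∈ Ω p then (1 : ℝ) else 0) ≤ 1 :=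
    fun p _ => by split_ifs <;> norm_num
  have hf0 (J t : ℕ) :
      0 ≤ ∏ j ∈ range J, ∏ p ∈ P j, (1 - if t % p ∈ Ω p then (1 : ℝ) else 0) :=
    prod_nonneg fun j _ => prod_nonneg fun p hp => sub_nonneg.2 (hi1 j t p hp)
  have hV0 (j : ℕ) : 0 ≤ ∏ p ∈ P j, (1 - (#(Ω p) : ℝ) / p) :=
    prod_nonneg fun p hp => sub_nonneg.2 (hg1 j p hp)
  induction J with
  | zero =>
    refine ⟨fun _ => 1, fun _ => 1, 1, 1, ?_, ?_, ?_⟩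
    · simpa using meanInAP_one N
    · simpa using meanInAP_one N
    · norm_num
  | succ J ih =>
    have hprev : 0 ≤ ∏ j ∈ range J, (1 + ε j) := prod_nonneg fun j _ => by linarith [hε0 j]
    have hJ' : ∏ j ∈ range J, (1 + ε j) ≤ 2 := by
      refine le_trans ?_ hJ
      rw [prod_range_succ]
      exact le_mul_of_one_le_right hprev (by linarith [hε0 J])
    obtain ⟨U, L, μ, ν, hU, hL, hfU, hLf, hμ, hν, hμ0⟩ := ih hJ'
    have hco : ∀ p ∈ P J, p.Coprime (∏ j ∈ range J, ∏ p ∈ P j, p) := fun p hp =>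
      Nat.Coprime.prod_right fun j hj => Nat.Coprime.prod_right fun q hq =>
        (Nat.coprime_primes (hP J p hp) (hP j q hq)).2 fun e =>
          disjoint_left.1 (hdisj j J (mem_range.1 hj)) (e ▸ hq) hp
    have hD1 : ∑ s ∈ range (r J), ((#(P J)).choose s * k ^ s : ℝ) ≤ D J := by
      refine le_trans ?_ (hD J)
      rw [sum_range_succ]
      exact le_add_of_nonneg_right (by positivity)
    have hD2 : ((#(P J)).choose (r J) * k ^ (r J) : ℝ) ≤ D J := by
      refine le_trans ?_ (hD J)
      rw [sum_range_succ]
      exact le_add_of_nonneg_left (by positivity)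
    have hE := hU.nonneg
    have hb := bonferroni (P J) (hg0 J) (hg1 J) (r J)
    have hbi (t : ℕ) := bonferroni (P J) (hi0 J t) (hi1 J t) (r J)
    simp only [(hr J).neg_one_pow] at hb hbi
    obtain ⟨hb1, hb2⟩ := hb
    have hεJ := hε J
    have hε0J := hε0 J
    have hV0J := hV0 J
    have hVprod : 0 ≤ ∏ j ∈ range J, ∏ p ∈ P j, (1 - (#(Ω p) : ℝ) / p) :=
      prod_nonneg fun j _ => hV0 j
    have U1 := hU.mul_altsum (P J) (hP J) (hΩ J) hco (hk J) (r J)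
    have U2 := hU.mul_esum (P J) (hP J) (hΩ J) hco (hk J) (r J)
    have L1 := hL.mul_altsum (P J) (hP J) (hΩ J) hco (hk J) (r J)
    refine ⟨fun t => U t * altsum (fun p => if t % p ∈ Ω p then 1 else 0) (P J) (r J),
      fun t => L t * altsum (fun p => if t % p ∈ Ω p then 1 else 0) (P J) (r J) -
        U t * esum (fun p => if t % p ∈ Ω p then 1 else 0) (P J) (r J),
      μ * altsum (fun p => (#(Ω p) : ℝ) / p) (P J) (r J),
      ν * altsum (fun p => (#(Ω p) : ℝ) / p) (P J) (r J) -
        μ * esum (fun p => (#(Ω p) : ℝ) / p) (P J) (r J), ?_, ?_, ?_, ?_, ?_, ?_, ?_⟩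
    · rw [prod_range_succ]
      exact U1.mono (by rw [prod_range_succ]; gcongr)
    · rw [prod_range_succ]
      refine (L1.sub U2).mono ?_
      rw [prod_range_succ]
      have h1 := mul_le_mul_of_nonneg_left hD1 (show 0 ≤ ((J : ℝ) + 1) * ∏ j ∈ range J, D j by
        positivity)
      have h2 := mul_le_mul_of_nonneg_left hD2 hE
      push_cast
      nlinarith
    · intro t
      have := hbi t
      rw [prod_range_succ]
      exact mul_le_mul (hfU t) (by linarith [this.1])
        (prod_nonneg fun p hp => sub_nonneg.2 (hi1 J t p hp)) ((hf0 J t).trans (hfU t))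
    · intro t
      obtain ⟨h1, h2⟩ := hbi t
      have h3 := hf0 J t
      have h4 := hfU t
      have h5 := hLf t
      have h6 : 0 ≤ ∏ p ∈ P J, (1 - if t % p ∈ Ω p then (1 : ℝ) else 0) :=
        prod_nonneg fun p hp => sub_nonneg.2 (hi1 J t p hp)
      have h7 := esum_nonneg (hi0 J t) (r J)
      rw [prod_range_succ]
      set f := ∏ j ∈ range J, ∏ p ∈ P j, (1 - if t % p ∈ Ω p then (1 : ℝ) else 0)
      set v := ∏ p ∈ P J, (1 - if t % p ∈ Ω p then (1 : ℝ) else 0)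
      set a := altsum (fun p => if t % p ∈ Ω p then (1 : ℝ) else 0) (P J) (r J)
      set e := esum (fun p => if t % p ∈ Ω p then (1 : ℝ) else 0) (P J) (r J)
      have ha : 0 ≤ a := by linarith
      have i1 : L t * a ≤ f * a := by gcongr
      have i2 : f * e ≤ U t * e := by gcongr
      have i3 : f * a ≤ f * (v + e) := by gcongr; linarith
      linarith
    · rw [prod_range_succ, prod_range_succ]
      set V := ∏ j ∈ range J, ∏ p ∈ P j, (1 - (#(Ω p) : ℝ) / p)
      set v := ∏ p ∈ P J, (1 - (#(Ω p) : ℝ) / p)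
      calc _ ≤ (V * ∏ j ∈ range J, (1 + ε j)) * (v * (1 + ε J)) :=
            mul_le_mul hμ (by linarith) (by linarith) (by positivity)
        _ = _ := by ring
    · rw [prod_range_succ, prod_range_succ]
      set V := ∏ j ∈ range J, ∏ p ∈ P j, (1 - (#(Ω p) : ℝ) / p)
      set v := ∏ p ∈ P J, (1 - (#(Ω p) : ℝ) / p)
      set M := ∏ j ∈ range J, (1 + ε j)
      set a := altsum (fun p => (#(Ω p) : ℝ) / p) (P J) (r J)
      set e := esum (fun p => (#(Ω p) : ℝ) / p) (P J) (r J)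
      have hM : 0 ≤ V * (2 - M) := mul_nonneg hVprod (by linarith)
      have i1 : V * (2 - M) * v ≤ ν * a :=
        mul_le_mul hν (by linarith) hV0J (hM.trans hν)
      have i2 : μ * e ≤ (V * M) * (ε J * v) :=
        mul_le_mul hμ hεJ (esum_nonneg (hg0 J) _) (by positivity)
      linarith
    · exact mul_nonneg hμ0 (by linarith)

/-- The primes in the interval `(m, n]`. -/
def primesIoc (m n : ℕ) : Finset ℕ := {p ∈ Ioc m n | p.Prime}

lemma mem_primesIoc {m n p : ℕ} : p ∈ primesIoc m n ↔ (m < p ∧ p ≤ n) ∧ p.Prime := by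
  simp [primesIoc]

lemma mul_card_primesIoc_le (i : ℕ) : i * #(primesIoc (2 ^ i) (2 ^ (i + 1))) ≤ 2 ^ (i + 2) := by
  have h1 : 2 ^ (i * #(primesIoc (2 ^ i) (2 ^ (i + 1)))) ≤ primorial (2 ^ (i + 1)) := by
    rw [pow_mul, ← prod_const, primorial]
    refine (prod_le_prod' fun p hp => (mem_primesIoc.1 hp).1.1.le).trans
      (prod_le_prod_of_subset_of_one_le' ?_ ?_)
    · intro p hp
      have := mem_primesIoc.1 hp
      simp only [mem_filter, mem_range]
      exact ⟨by omega, this.2⟩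
    · intro p hp _
      exact (mem_filter.1 hp).2.one_le
  have h2 := h1.trans (primorial_le_four_pow (2 ^ (i + 1)))
  rw [show 4 = 2 ^ 2 by norm_num, ← pow_mul] at h2
  have h3 := (Nat.pow_le_pow_iff_right (by norm_num)).1 h2
  rw [pow_succ' 2 (i + 1)]
  exact h3

lemma sum_inv_primesIoc_le {a : ℕ} (ha : 0 < a) (m : ℕ) :
    ∑ p ∈ primesIoc (2 ^ a) (2 ^ (a + m)), (1 : ℝ) / p ≤ 4 * m / a := by
  have ha' : (0 : ℝ) < a := by exact_mod_cast ha
  induction m with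
  | zero => simp [primesIoc]
  | succ m ih =>
    have hU : primesIoc (2 ^ a) (2 ^ (a + (m + 1))) =
        primesIoc (2 ^ a) (2 ^ (a + m)) ∪ primesIoc (2 ^ (a + m)) (2 ^ (a + m + 1)) := by
      have h1 : 2 ^ a ≤ 2 ^ (a + m) := Nat.pow_le_pow_right (by norm_num) (by omega)
      have h2 : 2 ^ (a + m) ≤ 2 ^ (a + m + 1) := Nat.pow_le_pow_right (by norm_num) (by omega)
      ext p
      rw [mem_union, mem_primesIoc, mem_primesIoc, mem_primesIoc, ← add_assoc]
      constructor
      · rintro ⟨⟨h3, h4⟩, h5⟩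
        rcases le_or_gt p (2 ^ (a + m)) with h | h
        · exact Or.inl ⟨⟨h3, h⟩, h5⟩
        · exact Or.inr ⟨⟨h, h4⟩, h5⟩
      · rintro (⟨⟨h3, h4⟩, h5⟩ | ⟨⟨h3, h4⟩, h5⟩)
        · exact ⟨⟨h3, by omega⟩, h5⟩
        · exact ⟨⟨by omega, h4⟩, h5⟩
    have hd : Disjoint (primesIoc (2 ^ a) (2 ^ (a + m)))
        (primesIoc (2 ^ (a + m)) (2 ^ (a + m + 1))) := by
      rw [disjoint_left]
      intro p hp hp'
      have := mem_primesIoc.1 hp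
      have := mem_primesIoc.1 hp'
      omega
    have hb : ∑ p ∈ primesIoc (2 ^ (a + m)) (2 ^ (a + m + 1)), (1 : ℝ) / p ≤ 4 / a := by
      have h1 : ∀ p ∈ primesIoc (2 ^ (a + m)) (2 ^ (a + m + 1)),
          (1 : ℝ) / p ≤ 1 / 2 ^ (a + m) := by
        intro p hp
        have := (mem_primesIoc.1 hp).1.1
        gcongr
        exact_mod_cast this.le
      refine (sum_le_card_nsmul _ _ _ h1).trans ?_
      have h2 : ((a + m : ℕ) : ℝ) * #(primesIoc (2 ^ (a + m)) (2 ^ (a + m + 1))) ≤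
          2 ^ (a + m) * 4 := by
        have := mul_card_primesIoc_le (a + m)
        rw [pow_add 2 (a + m) 2] at this
        exact_mod_cast this
      rw [nsmul_eq_mul, mul_one_div, div_le_div_iff₀ (by positivity) ha']
      have h3 : (a : ℝ) * #(primesIoc (2 ^ (a + m)) (2 ^ (a + m + 1))) ≤
          ((a + m : ℕ) : ℝ) * #(primesIoc (2 ^ (a + m)) (2 ^ (a + m + 1))) := by
        gcongr; omega
      linarith
    rw [hU, sum_union hd]
    push_cast
    calc _ ≤ 4 * (m : ℝ) / a + 4 / a := add_le_add ih hb
      _ = _ := by ring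

lemma esum_mul_exp_le {g : ℕ → ℝ} {P : Finset ℕ} (h0 : ∀ p ∈ P, 0 ≤ g p) (r : ℕ) :
    esum g P r * Real.exp r ≤ Real.exp (3 * ∑ p ∈ P, g p) := by
  have h1 : esum g P r * Real.exp r = ∑ S ∈ P.powersetCard r, ∏ p ∈ S, (Real.exp 1 * g p) := by
    rw [esum, sum_mul]
    refine sum_congr rfl fun S hS => ?_
    rw [prod_mul_distrib, prod_const, (mem_powersetCard.1 hS).2, ← Real.exp_nat_mul, mul_one,
      mul_comm]
  have h2 : ∑ S ∈ P.powersetCard r, ∏ p ∈ S, (Real.exp 1 * g p) ≤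
      ∏ p ∈ P, (1 + Real.exp 1 * g p) := by
    rw [prod_one_add]
    refine sum_le_sum_of_subset_of_nonneg
      (fun S hS => mem_powerset.2 (mem_powersetCard.1 hS).1) fun S hS _ =>
      prod_nonneg fun p hp => mul_nonneg (Real.exp_pos _).le (h0 p (mem_powerset.1 hS hp))
  rw [h1, mul_sum, Real.exp_sum]
  refine h2.trans (prod_le_prod (fun p hp => ?_) fun p hp => ?_)
  · have := h0 p hp
    positivity
  · have h3 := Real.add_one_le_exp (3 * g p)
    have h4 : Real.exp 1 * g p ≤ 3 * g p :=
      mul_le_mul_of_nonneg_right Real.exp_one_lt_three.le (h0 p hp)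
    linarith

lemma exp_neg_le_prod_one_sub {g : ℕ → ℝ} {P : Finset ℕ} (h0 : ∀ p ∈ P, 0 ≤ g p)
    (h1 : ∀ p ∈ P, g p ≤ 1 / 2) :
    Real.exp (-2 * ∑ p ∈ P, g p) ≤ ∏ p ∈ P, (1 - g p) := by
  rw [mul_sum, Real.exp_sum]
  refine prod_le_prod (fun _ _ => (Real.exp_pos _).le) fun p hp => ?_
  have h2 := h0 p hp
  have h3 := h1 p hp
  have h4 := Real.add_one_le_exp (2 * g p)
  rw [show -2 * g p = -(2 * g p) by ring, Real.exp_neg, inv_le_comm₀ (Real.exp_pos _) (by linarith)]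
  refine le_trans ?_ h4
  rw [inv_le_iff_one_le_mul₀ (by linarith)]
  nlinarith

lemma sum_choose_mul_pow_le (n k r : ℕ) :
    ∑ s ∈ range (r + 1), n.choose s * k ^ s ≤ (n * k + 1) ^ r := by
  rw [add_pow]
  refine sum_le_sum fun s hs => ?_
  rw [one_pow, mul_one, mul_pow]
  have h1 := Nat.choose_le_pow n s
  have h2 : 0 < r.choose s := Nat.choose_pos (by have := mem_range.1 hs; omega)
  calc n.choose s * k ^ s ≤ n ^ s * k ^ s := Nat.mul_le_mul_right _ h1
    _ ≤ _ := Nat.le_mul_of_pos_right _ h2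

lemma sum_two_pow_mul_sub (J : ℕ) : ∑ j ∈ range J, 2 ^ j * (J - j) + (J + 2) = 2 ^ (J + 1) := by
  induction J with
  | zero => simp
  | succ J ih =>
    have h : ∑ j ∈ range (J + 1), 2 ^ j * (J + 1 - j) =
        ∑ j ∈ range J, 2 ^ j * (J - j) + ∑ j ∈ range (J + 1), 2 ^ j := by
      rw [sum_range_succ, sum_range_succ, ← add_assoc, ← sum_add_distrib]
      congr 1
      · refine sum_congr rfl fun j hj => ?_
        have := mem_range.1 hj
        rw [show J + 1 - j = J - j + 1 by omega, mul_add, mul_one]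
      · simp
    have h2 : ∑ j ∈ range (J + 1), 2 ^ j + 1 = 2 ^ (J + 1) := by
      have := Nat.geomSum_eq (le_refl 2) (J + 1)
      rw [this]
      have : 0 < 2 ^ (J + 1) := by positivity
      simp; omega
    rw [h, pow_succ 2 (J + 1)]
    omega

lemma prod_one_add_four_pow_le (J : ℕ) :
    ∏ j ∈ range J, (1 + (1 / 4 : ℝ) ^ (J - j)) ≤ 3 / 2 := by
  have h : ∏ j ∈ range J, (1 + (1 / 4 : ℝ) ^ (J - j)) =
      ∏ j ∈ range J, (1 + (1 / 4 : ℝ) ^ (j + 1)) := by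
    rw [← prod_range_reflect]
    refine prod_congr rfl fun j hj => ?_
    have := mem_range.1 hj
    rw [show J - (J - 1 - j) = j + 1 by omega]
  have h2 (J : ℕ) : ∏ j ∈ range J, (1 + (1 / 4 : ℝ) ^ (j + 1)) ≤ 3 / 2 - 1 / 2 * (1 / 4) ^ J := by
    induction J with
    | zero => norm_num
    | succ J ih =>
      rw [prod_range_succ, pow_succ]
      have : (0 : ℝ) < (1 / 4) ^ J := by positivity
      set x := (1 / 4 : ℝ) ^ J
      nlinarith
  rw [h]
  refine (h2 J).trans ?_
  have : (0 : ℝ) < (1 / 4) ^ J := by positivity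
  linarith

/-- The sieve of Brun and Hooley, for the primes between `2 ^ v` and `z = 2 ^ (v * 2 ^ J)`. -/
lemma sieve_bounds {k v : ℕ} (hk : 0 < k) (hv : 2 * k ≤ 2 ^ v) {Ω : ℕ → Finset ℕ}
    (hΩ : ∀ p, p.Prime → 2 ^ v < p → Ω p ⊆ range p ∧ #(Ω p) ≤ k) (J : ℕ) :
    ∃ V : ℝ, Real.exp (-(8 * k * J)) ≤ V ∧ V ≤ 1 ∧ ∀ N : ℕ,
      V * N / 2 - (J + 1) * ((2 : ℝ) ^ (v * 2 ^ J)) ^ (60 * k + 15) ≤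
        #{t ∈ range N | ∀ p ∈ primesIoc (2 ^ v) (2 ^ (v * 2 ^ J)), t % p ∉ Ω p} ∧
      ∀ q a : ℕ, 0 < q → (∀ p ∈ primesIoc (2 ^ v) (2 ^ (v * 2 ^ J)), ¬ p ∣ q) →
        (#{t ∈ range N | (∀ p ∈ primesIoc (2 ^ v) (2 ^ (v * 2 ^ J)), t % p ∉ Ω p) ∧
          t ≡ a [MOD q]} : ℝ) ≤
          3 / 2 * V * N / q + ((2 : ℝ) ^ (v * 2 ^ J)) ^ (60 * k + 15) := by
  have hv0 : 0 < v := by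
    rcases Nat.eq_zero_or_pos v with rfl | h
    · simp at hv; omega
    · exact h
  set P : ℕ → Finset ℕ := fun j => primesIoc (2 ^ (v * 2 ^ j)) (2 ^ (v * 2 ^ (j + 1))) with hPdef
  set r : ℕ → ℕ := fun j => 20 * k + 2 * (J - j) + 1 with hrdef
  have hmem (j p : ℕ) (hp : p ∈ P j) :
      (2 ^ (v * 2 ^ j) < p ∧ p ≤ 2 ^ (v * 2 ^ (j + 1))) ∧ p.Prime := mem_primesIoc.1 hp
  have hbase (j : ℕ) : v ≤ v * 2 ^ j := Nat.le_mul_of_pos_right _ (by positivity)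
  have hlow (j p : ℕ) (hp : p ∈ P j) : 2 ^ v < p :=
    (Nat.pow_le_pow_right (by norm_num) (hbase j)).trans_lt (hmem j p hp).1.1
  have hP : ∀ j, ∀ p ∈ P j, p.Prime := fun j p hp => (hmem j p hp).2
  have hmono {i j : ℕ} (h : i ≤ j) : 2 ^ (v * 2 ^ i) ≤ 2 ^ (v * 2 ^ j) :=
    Nat.pow_le_pow_right (by norm_num)
      (Nat.mul_le_mul_left _ (Nat.pow_le_pow_right (by norm_num) h))
  have hdisj : ∀ i j, i < j → Disjoint (P i) (P j) := by
    intro i j hij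
    rw [disjoint_left]
    intro p hp hp'
    have h1 := (hmem i p hp).1.2
    have h2 := (hmem j p hp').1.1
    have h3 := hmono (show i + 1 ≤ j from hij)
    omega
  have hΩ1 : ∀ j, ∀ p ∈ P j, Ω p ⊆ range p := fun j p hp => (hΩ p (hP j p hp) (hlow j p hp)).1
  have hk1 : ∀ j, ∀ p ∈ P j, #(Ω p) ≤ k := fun j p hp => (hΩ p (hP j p hp) (hlow j p hp)).2
  have hg0 (j : ℕ) : ∀ p ∈ P j, 0 ≤ (#(Ω p) : ℝ) / p := fun p _ => by positivity
  have hg1 (j : ℕ) : ∀ p ∈ P j, (#(Ω p) : ℝ) / p ≤ 1 / 2 := fun p hp => by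
    have h1 := hk1 j p hp
    have h2 := hlow j p hp
    rw [div_le_div_iff₀ (by exact_mod_cast (hP j p hp).pos) (by norm_num)]
    have : #(Ω p) * 2 ≤ 1 * p := by omega
    exact_mod_cast this
  have hsum (j : ℕ) : ∑ p ∈ P j, (#(Ω p) : ℝ) / p ≤ 4 * k := by
    have h1 := sum_inv_primesIoc_le (a := v * 2 ^ j) (by positivity) (v * 2 ^ j)
    have h2 : ∑ p ∈ P j, (1 : ℝ) / p ≤ 4 := by
      rw [← two_mul, show 2 * (v * 2 ^ j) = v * 2 ^ (j + 1) by ring, mul_div_assoc,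
        div_self (by positivity), mul_one] at h1
      exact h1
    calc _ ≤ ∑ p ∈ P j, (k : ℝ) * (1 / p) := sum_le_sum fun p hp => by
            rw [mul_one_div]
            have := hk1 j p hp
            gcongr
      _ ≤ k * 4 := by rw [← mul_sum]; gcongr
      _ = _ := by ring
  have hV1 (j : ℕ) : Real.exp (-(8 * k)) ≤ ∏ p ∈ P j, (1 - (#(Ω p) : ℝ) / p) := by
    refine le_trans (Real.exp_le_exp.2 ?_) (exp_neg_le_prod_one_sub (hg0 j) (hg1 j))
    linarith [hsum j]
  have hε : ∀ j, esum (fun p => (#(Ω p) : ℝ) / p) (P j) (r j) ≤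
      (1 / 4 : ℝ) ^ (J - j) * ∏ p ∈ P j, (1 - (#(Ω p) : ℝ) / p) := by
    intro j
    have h1 := esum_mul_exp_le (hg0 j) (r j)
    rw [← le_div_iff₀ (Real.exp_pos _), ← Real.exp_sub] at h1
    have h4 : Real.exp (-(2 * (J - j : ℕ))) ≤ (1 / 4 : ℝ) ^ (J - j) := by
      rw [show -(2 * ((J - j : ℕ) : ℝ)) = (J - j : ℕ) * (-2) by ring, Real.exp_nat_mul]
      gcongr
      have h5 : (2 : ℝ) ≤ Real.exp 1 := by have := Real.add_one_le_exp (1 : ℝ); linarith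
      rw [Real.exp_neg, one_div, show (2 : ℝ) = 1 + 1 by norm_num, Real.exp_add]
      gcongr
      nlinarith
    calc _ ≤ _ := h1
      _ ≤ Real.exp (-(2 * (J - j : ℕ)) + -(8 * k)) := by
          rw [Real.exp_le_exp]
          have := hsum j
          simp only [hrdef]
          push_cast
          linarith
      _ = Real.exp (-(2 * (J - j : ℕ))) * Real.exp (-(8 * k)) := Real.exp_add _ _
      _ ≤ _ := mul_le_mul h4 (hV1 j) (Real.exp_pos _).le (by positivity)
  have hD : ∀ j, ∑ s ∈ range (r j + 1), ((#(P j)).choose s * k ^ s : ℝ) ≤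
      2 ^ (3 * v * (2 ^ j * r j)) := by
    intro j
    have hy : 2 * k ≤ 2 ^ (v * 2 ^ j) := hv.trans (Nat.pow_le_pow_right (by norm_num) (hbase j))
    have hc : #(P j) ≤ (2 ^ (v * 2 ^ j)) ^ 2 := by
      refine (card_le_card (filter_subset _ _)).trans ?_
      rw [Nat.card_Ioc, ← pow_mul, show v * 2 ^ j * 2 = v * 2 ^ (j + 1) by ring]
      exact Nat.sub_le _ _
    have h1 : #(P j) * k + 1 ≤ (2 ^ (v * 2 ^ j)) ^ 3 := by
      set y := 2 ^ (v * 2 ^ j)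
      have : #(P j) * k ≤ y ^ 2 * k := Nat.mul_le_mul_right _ hc
      have h2 : y ^ 2 * (2 * k) ≤ y ^ 2 * y := Nat.mul_le_mul_left _ hy
      have h3 : 1 ≤ y ^ 2 * k := Nat.mul_pos (by positivity) hk
      have h4 : y ^ 3 = y ^ 2 * y := by ring
      have h5 : y ^ 2 * (2 * k) = 2 * (y ^ 2 * k) := by ring
      omega
    have h2 := (sum_choose_mul_pow_le (#(P j)) k (r j)).trans (Nat.pow_le_pow_left h1 _)
    rw [← pow_mul, ← pow_mul, show v * 2 ^ j * (3 * r j) = 3 * v * (2 ^ j * r j) by ring] at h2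
    exact_mod_cast h2
  have hDprod : ∏ j ∈ range J, (2 : ℝ) ^ (3 * v * (2 ^ j * r j)) ≤
      ((2 : ℝ) ^ (v * 2 ^ J)) ^ (60 * k + 15) := by
    rw [prod_pow_eq_pow_sum, ← pow_mul]
    refine pow_le_pow_right₀ (by norm_num) ?_
    rw [← mul_sum]
    have h1 : ∑ j ∈ range J, 2 ^ j * r j ≤ (20 * k + 5) * 2 ^ J := by
      have h2 := sum_two_pow_mul_sub J
      have h3 : ∑ j ∈ range J, 2 ^ j + 1 = 2 ^ J := by
        rw [Nat.geomSum_eq (le_refl 2) J]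
        have : 0 < 2 ^ J := by positivity
        simp; omega
      have h4 : ∑ j ∈ range J, 2 ^ j * r j =
          (20 * k + 1) * ∑ j ∈ range J, 2 ^ j + 2 * ∑ j ∈ range J, 2 ^ j * (J - j) := by
        rw [mul_sum, mul_sum, ← sum_add_distrib]
        exact sum_congr rfl fun j _ => by simp only [hrdef]; ring
      rw [h4]
      rw [pow_succ] at h2
      nlinarith
    calc 3 * v * ∑ j ∈ range J, 2 ^ j * r j ≤ 3 * v * ((20 * k + 5) * 2 ^ J) := by gcongr
      _ = _ := by ring
  have hprod2 : ∏ j ∈ range J, (1 + (1 / 4 : ℝ) ^ (J - j)) ≤ 3 / 2 := prod_one_add_four_pow_le J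
  have hcover (p : ℕ) (hp : p ∈ primesIoc (2 ^ v) (2 ^ (v * 2 ^ J))) : ∃ j < J, p ∈ P j := by
    clear hε hD hDprod hprod2 hrdef
    clear_value r
    induction J with
    | zero => have := mem_primesIoc.1 hp; simp at this; omega
    | succ J ih =>
      obtain ⟨⟨h1, h2⟩, h3⟩ := mem_primesIoc.1 hp
      rcases le_or_gt p (2 ^ (v * 2 ^ J)) with h | h
      · obtain ⟨j, hj, hpj⟩ := ih (mem_primesIoc.2 ⟨⟨h1, h⟩, h3⟩)
        exact ⟨j, by omega, hpj⟩
      · exact ⟨J, by omega, mem_primesIoc.2 ⟨⟨h, h2⟩, h3⟩⟩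
  have hsub (j p : ℕ) (hj : j < J) (hp : p ∈ P j) :
      p ∈ primesIoc (2 ^ v) (2 ^ (v * 2 ^ J)) :=
    mem_primesIoc.2 ⟨⟨hlow j p hp, (hmem j p hp).1.2.trans (hmono hj)⟩, hP j p hp⟩
  refine ⟨∏ j ∈ range J, ∏ p ∈ P j, (1 - (#(Ω p) : ℝ) / p), ?_, ?_, fun N => ?_⟩
  · calc Real.exp (-(8 * k * J)) = ∏ j ∈ range J, Real.exp (-(8 * k)) := by
          rw [prod_const, card_range, ← Real.exp_nat_mul]; congr 1; ring
      _ ≤ _ := prod_le_prod (fun _ _ => (Real.exp_pos _).le) fun j _ => hV1 j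
  · exact prod_le_one (fun j _ => prod_nonneg fun p hp => by linarith [hg1 j p hp])
      fun j _ => prod_le_one (fun p hp => by linarith [hg1 j p hp])
        fun p hp => by linarith [hg0 j p hp]
  obtain ⟨U, L, μ, ν, hU, hL, hfU, hLf, hμ, hν, -⟩ := exists_sieve_functions (N := N)
    (ε := fun j => (1 / 4 : ℝ) ^ (J - j)) (r := r) hP hdisj hΩ1 hk1
    (fun j => ⟨10 * k + (J - j), by simp only [hrdef]; ring⟩) (fun j => by positivity) hε hD J
    (hprod2.trans (by norm_num))
  have hV0 : 0 ≤ ∏ j ∈ range J, ∏ p ∈ P j, (1 - (#(Ω p) : ℝ) / p) :=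
    prod_nonneg fun j _ => (Real.exp_pos _).le.trans (hV1 j)
  have hf (t : ℕ) : ∏ j ∈ range J, ∏ p ∈ P j, (1 - if t % p ∈ Ω p then (1 : ℝ) else 0) =
      if ∀ p ∈ primesIoc (2 ^ v) (2 ^ (v * 2 ^ J)), t % p ∉ Ω p then 1 else 0 := by
    split_ifs with h
    · refine prod_eq_one fun j hj => prod_eq_one fun p hp => ?_
      rw [if_neg (h p (hsub j p (mem_range.1 hj) hp)), sub_zero]
    · push Not at h
      obtain ⟨p, hp, ht⟩ := h
      obtain ⟨j, hj, hpj⟩ := hcover p hp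
      exact prod_eq_zero (mem_range.2 hj) (prod_eq_zero hpj (by rw [if_pos ht, sub_self]))
  set V := ∏ j ∈ range J, ∏ p ∈ P j, (1 - (#(Ω p) : ℝ) / p)
  have hμ' : μ ≤ 3 / 2 * V :=
    hμ.trans (by rw [mul_comm (3 / 2 : ℝ)]; exact mul_le_mul_of_nonneg_left hprod2 hV0)
  have hν' : V / 2 ≤ ν := by
    refine le_trans ?_ hν
    rw [div_eq_mul_one_div]
    exact mul_le_mul_of_nonneg_left (by linarith) hV0
  constructor
  · have h1 := hL 1 0 one_pos (Nat.coprime_one_left _)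
    simp only [Nat.modEq_one, filter_true, Nat.cast_one, div_one] at h1
    have h2 : ∑ t ∈ range N, L t ≤
        (#{t ∈ range N | ∀ p ∈ primesIoc (2 ^ v) (2 ^ (v * 2 ^ J)), t % p ∉ Ω p} : ℝ) := by
      rw [card_eq_sum_ones, sum_filter]
      push_cast
      exact sum_le_sum fun t _ => (hLf t).trans (hf t).le
    have h3 := (abs_le.1 h1).1
    have h4 : V / 2 * N ≤ ν * N := by gcongr
    have h5 : ((J : ℝ) + 1) * ∏ j ∈ range J, (2 : ℝ) ^ (3 * v * (2 ^ j * r j)) ≤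
      ((J : ℝ) + 1) * ((2 : ℝ) ^ (v * 2 ^ J)) ^ (60 * k + 15) := by gcongr
    linarith
  · intro q a hq hqp
    have h1 := hU q a hq (Nat.Coprime.prod_right fun j hj => Nat.Coprime.prod_right fun p hp =>
      ((Nat.Prime.coprime_iff_not_dvd (hP j p hp)).2
        (hqp p (hsub j p (mem_range.1 hj) hp))).symm)
    have h2 : (#{t ∈ range N | (∀ p ∈ primesIoc (2 ^ v) (2 ^ (v * 2 ^ J)), t % p ∉ Ω p) ∧
          t ≡ a [MOD q]} : ℝ) ≤ ∑ t ∈ range N with t ≡ a [MOD q], U t := by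
      rw [card_eq_sum_ones, ← filter_filter, filter_comm, sum_filter]
      push_cast
      exact sum_le_sum fun t _ => (hf t).symm.le.trans (hfU t)
    have h3 := (abs_le.1 h1).2
    have h4 : μ * N / q ≤ 3 / 2 * V * N / q := by gcongr
    linarith

lemma sum_inv_primesIoc_two_pow_le {a : ℕ} (ha : 0 < a) (s : ℕ) :
    ∑ p ∈ primesIoc (2 ^ a) (2 ^ (a * 2 ^ s)), (1 : ℝ) / p ≤ 4 * s := by
  induction s with
  | zero => simp [primesIoc]
  | succ s ih =>
    have hU : primesIoc (2 ^ a) (2 ^ (a * 2 ^ (s + 1))) ⊆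
        primesIoc (2 ^ a) (2 ^ (a * 2 ^ s)) ∪
          primesIoc (2 ^ (a * 2 ^ s)) (2 ^ (a * 2 ^ s + a * 2 ^ s)) := by
      intro p hp
      rw [mem_union, mem_primesIoc, mem_primesIoc]
      obtain ⟨⟨h3, h4⟩, h5⟩ := mem_primesIoc.1 hp
      rw [show a * 2 ^ (s + 1) = a * 2 ^ s + a * 2 ^ s by ring] at h4
      rcases le_or_gt p (2 ^ (a * 2 ^ s)) with h | h
      · exact Or.inl ⟨⟨h3, h⟩, h5⟩
      · exact Or.inr ⟨⟨h, h4⟩, h5⟩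
    have h1 := sum_inv_primesIoc_le (a := a * 2 ^ s) (by positivity) (a * 2 ^ s)
    rw [mul_div_assoc, div_self (by positivity), mul_one] at h1
    refine (sum_le_sum_of_subset_of_nonneg hU fun _ _ _ => by positivity).trans ?_
    have h2 := sum_union_inter (s₁ := primesIoc (2 ^ a) (2 ^ (a * 2 ^ s)))
      (s₂ := primesIoc (2 ^ (a * 2 ^ s)) (2 ^ (a * 2 ^ s + a * 2 ^ s)))
      (f := fun p : ℕ => (1 : ℝ) / p)
    have h3 : 0 ≤ ∑ p ∈ primesIoc (2 ^ a) (2 ^ (a * 2 ^ s)) ∩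
        primesIoc (2 ^ (a * 2 ^ s)) (2 ^ (a * 2 ^ s + a * 2 ^ s)), (1 : ℝ) / p :=
      sum_nonneg fun _ _ => by positivity
    push_cast
    linarith

lemma card_primeFactors_le_add_two {n M z : ℕ} (h0 : n ≠ 0) (hn : n < M ^ 3)
    (hz : ∀ p ∈ n.primeFactors, z < p) :
    #n.primeFactors ≤ #{p ∈ primesIoc z M | p ∣ n} + 2 := by
  have h1 : #{p ∈ n.primeFactors | M < p} ≤ 2 := by
    have h2 : M ^ #{p ∈ n.primeFactors | M < p} ≤ n := by
      rw [← prod_const]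
      refine (prod_le_prod' fun p hp => (mem_filter.1 hp).2.le).trans
        ((prod_le_prod_of_subset_of_one_le' (filter_subset _ _) fun p hp _ =>
          (Nat.prime_of_mem_primeFactors hp).one_le).trans
          (Nat.le_of_dvd (Nat.pos_of_ne_zero h0) (Nat.prod_primeFactors_dvd n)))
    by_contra! h3
    have hM : 0 < M := by
      rcases Nat.eq_zero_or_pos M with rfl | h
      · simp at hn
      · exact h
    have := Nat.pow_le_pow_right hM (show 3 ≤ #{p ∈ n.primeFactors | M < p} from h3)
    omega
  rw [← card_filter_add_card_filter_not (s := n.primeFactors) (fun p => M < p), add_comm]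
  refine add_le_add (card_le_card fun p hp => ?_) h1
  obtain ⟨h2, h3⟩ := mem_filter.1 hp
  exact mem_filter.2 ⟨mem_primesIoc.2 ⟨⟨hz p h2, not_lt.1 h3⟩, Nat.prime_of_mem_primeFactors h2⟩,
    Nat.dvd_of_mem_primeFactors h2⟩

lemma exists_modEq_of_dvd_linear {q a : ℕ} (h : q.Coprime a) (b : ℕ) :
    ∃ c, ∀ t, q ∣ a * t + b → t ≡ c [MOD q] := by
  by_cases hex : ∃ c, q ∣ a * c + b
  · obtain ⟨c, hc⟩ := hex
    refine ⟨c, fun t ht => ?_⟩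
    have h1 : a * t + b ≡ a * c + b [MOD q] :=
      ((Nat.modEq_zero_iff_dvd).2 ht).trans ((Nat.modEq_zero_iff_dvd).2 hc).symm
    exact Nat.ModEq.cancel_left_of_coprime h (Nat.ModEq.add_right_cancel' b h1)
  · exact ⟨0, fun t ht => (hex ⟨t, ht⟩).elim⟩

open Classical in
/-- A linear form is rarely divisible by the square of a large prime. -/
lemma card_sq_dvd_linear_le {a b z N R : ℕ} (hz : 0 < z) (hb : 0 < b)
    (ha : ∀ p, p.Prime → z < p → ¬ p ∣ a) (hR : ∀ t < N, a * t + b ≤ R ^ 2) :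
    (#{t ∈ range N | ∃ p, p.Prime ∧ z < p ∧ p ^ 2 ∣ a * t + b} : ℝ) ≤ N / z + R := by
  rcases le_or_gt z R with hzR | hzR
  swap
  · rw [filter_false_of_mem]
    · simp only [card_empty, Nat.cast_zero]; positivity
    · rintro t ht ⟨p, -, hzp, hp⟩
      have h1 := Nat.le_of_dvd (by omega) hp
      have h2 := hR t (mem_range.1 ht)
      have := (Nat.pow_le_pow_iff_left (by norm_num)).1 (h1.trans h2)
      omega
  have h1 : {t ∈ range N | ∃ p, p.Prime ∧ z < p ∧ p ^ 2 ∣ a * t + b} ⊆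
      (primesIoc z R).biUnion fun p => {t ∈ range N | p ^ 2 ∣ a * t + b} := by
    intro t ht
    obtain ⟨h2, p, hp, hzp, hpd⟩ := mem_filter.1 ht
    refine mem_biUnion.2 ⟨p, mem_primesIoc.2 ⟨⟨hzp, ?_⟩, hp⟩, mem_filter.2 ⟨h2, hpd⟩⟩
    exact (Nat.pow_le_pow_iff_left (by norm_num)).1
      ((Nat.le_of_dvd (by omega) hpd).trans (hR t (mem_range.1 h2)))
  have h2 : ∀ p ∈ primesIoc z R,
      (#{t ∈ range N | p ^ 2 ∣ a * t + b} : ℝ) ≤ N * ((p : ℝ) ^ 2)⁻¹ + 1 := by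
    intro p hp
    obtain ⟨⟨h3, -⟩, h5⟩ := mem_primesIoc.1 hp
    obtain ⟨c, hc⟩ := exists_modEq_of_dvd_linear (q := p ^ 2) (a := a)
      (((Nat.Prime.coprime_iff_not_dvd h5).2 (ha p h5 h3)).pow_left 2) b
    have h6 := (abs_le.1 (card_modEq_sub_le N (p ^ 2) c (pow_pos h5.pos 2))).2
    have h7 : (#{t ∈ range N | p ^ 2 ∣ a * t + b} : ℝ) ≤ #{t ∈ range N | t ≡ c [MOD p ^ 2]} := by
      exact_mod_cast card_le_card (monotone_filter_right _ fun t _ ht => hc t ht)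
    push_cast at h6
    rw [div_eq_mul_inv] at h6
    linarith
  calc _ ≤ ∑ p ∈ primesIoc z R, (#{t ∈ range N | p ^ 2 ∣ a * t + b} : ℝ) := by
        exact_mod_cast (card_le_card h1).trans card_biUnion_le
    _ ≤ ∑ p ∈ primesIoc z R, (N * ((p : ℝ) ^ 2)⁻¹ + 1) := sum_le_sum h2
    _ ≤ ∑ p ∈ Ioc z R, (N * ((p : ℝ) ^ 2)⁻¹ + 1) :=
        sum_le_sum_of_subset_of_nonneg (filter_subset _ _) fun _ _ _ => by positivity
    _ = N * ∑ p ∈ Ioc z R, ((p : ℝ) ^ 2)⁻¹ + (R - z : ℕ) := by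
        rw [sum_add_distrib, ← mul_sum]; simp
    _ ≤ N * (z : ℝ)⁻¹ + R := by
        have h3 := sum_Ioc_inv_sq_le_sub (α := ℝ) hz.ne' hzR
        have h4 : (0 : ℝ) ≤ (R : ℝ)⁻¹ := by positivity
        have h5 : ((R - z : ℕ) : ℝ) ≤ R := by exact_mod_cast Nat.sub_le _ _
        gcongr
        linarith
    _ = _ := by rw [div_eq_mul_inv]

lemma mul_self_le_sum_of_injective {k m : ℕ} (hk : k = 2 * m) {ω : Fin k → ℕ}
    (h : ω.Injective) : m * m ≤ ∑ i, ω i := by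
  have h1 : #{i | ω i < m} ≤ m := by
    rw [← card_image_of_injective _ h]
    refine (card_le_card (t := range m) fun x hx => ?_).trans (card_range m).le
    obtain ⟨i, hi, rfl⟩ := mem_image.1 hx
    exact mem_range.2 (mem_filter.1 hi).2
  have h2 := card_filter_add_card_filter_not (s := univ) (fun i => ω i < m)
  rw [card_univ, Fintype.card_fin] at h2
  calc m * m ≤ #{i | ¬ ω i < m} * m := Nat.mul_le_mul_right _ (by omega)
    _ ≤ ∑ i with ¬ ω i < m, ω i := by
        rw [← smul_eq_mul]
        exact card_nsmul_le_sum _ _ _ fun i hi => not_lt.1 (mem_filter.1 hi).2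
    _ ≤ ∑ i, ω i := sum_le_sum_of_subset (filter_subset _ _)

lemma exists_large_two_pow (B : ℕ) : ∃ J : ℕ, B ≤ 2 ^ 2 ^ J ∧ J + 1 ≤ 2 ^ 2 ^ J ∧
    (30000 : ℝ) < Real.exp (-(8 * 1000 * J)) * 2 ^ 2 ^ J := by
  obtain ⟨m, hm⟩ : ∃ m, m = B + 16 := ⟨_, rfl⟩
  have h1 : m + 1 ≤ 2 ^ m := Nat.lt_two_pow_self
  have h2 : 65536 ≤ 2 ^ m := by
    rw [show 65536 = 2 ^ 16 by norm_num]
    exact Nat.pow_le_pow_right (by norm_num) (by omega)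
  have h3 : 16000 * (2 * m) + 15 ≤ 2 ^ (2 * m) := by
    have h4 : (m + 1) * 65536 ≤ 2 ^ m * 2 ^ m := Nat.mul_le_mul h1 h2
    rw [two_mul, pow_add]
    omega
  have h5 : 2 ^ (2 * m) < 2 ^ 2 ^ (2 * m) := Nat.lt_two_pow_self
  refine ⟨2 * m, by omega, by omega, ?_⟩
  have h6 : Real.exp (8 * 1000 * (2 * m : ℕ)) ≤ 2 ^ (16000 * (2 * m)) := by
    rw [show (8 * 1000 * (2 * m : ℕ) : ℝ) = (8000 * (2 * m) : ℕ) * 1 by push_cast; ring,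
      Real.exp_nat_mul, show 16000 * (2 * m) = 2 * (8000 * (2 * m)) by ring, pow_mul 2 2]
    refine pow_le_pow_left₀ (Real.exp_pos _).le ?_ _
    have := Real.exp_one_lt_three
    linarith
  have h7 : (2 : ℝ) ^ (16000 * (2 * m)) * 2 ^ 15 ≤ 2 ^ 2 ^ (2 * m) := by
    rw [← pow_add]
    exact pow_le_pow_right₀ (by norm_num) h3
  rw [Real.exp_neg, inv_mul_eq_div, lt_div_iff₀ (Real.exp_pos _)]
  calc 30000 * Real.exp (8 * 1000 * (2 * m : ℕ)) ≤ 30000 * 2 ^ (16000 * (2 * m)) := by gcongr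
    _ < 2 ^ (16000 * (2 * m)) * 2 ^ 15 := by
      have : (0 : ℝ) < 2 ^ (16000 * (2 * m)) := by positivity
      set x : ℝ := 2 ^ (16000 * (2 * m))
      linarith
    _ ≤ _ := h7

set_option maxHeartbeats 1000000 in
/-- Among `1000` linear forms without small prime factors there are infinitely often two that take
squarefree values with equally many prime factors, the number of which is bounded. -/
lemma exists_squarefree_pair {k : ℕ} (hk : k = 1000) {v : ℕ} (hv : 2000 ≤ 2 ^ v)
    {a b : Fin k → ℕ}
    (hb : ∀ i, 2 ≤ b i) (ha : ∀ p, p.Prime → 2 ^ v < p → ∀ i, ¬ p ∣ a i)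
    (hsmall : ∀ p, p.Prime → p ≤ 2 ^ v → ∀ i t, ¬ p ∣ a i * t + b i) (X : ℕ) :
    ∃ t > X, ∃ i j, i ≠ j ∧ Squarefree (a i * t + b i) ∧ Squarefree (a j * t + b j) ∧
      #(a i * t + b i).primeFactors = #(a j * t + b j).primeFactors ∧
      #(a i * t + b i).primeFactors ≤ 250000 := by
  classical
  have i₀ : Fin k := ⟨0, by omega⟩
  have hv0 : 0 < v := by
    rcases Nat.eq_zero_or_pos v with rfl | h
    · simp at hv
    · exact h
  obtain ⟨C, hCi⟩ : ∃ C, ∀ i, a i + b i ≤ C := ⟨∑ i, (a i + b i), fun i =>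
    single_le_sum (f := fun i => a i + b i) (fun _ _ => Nat.zero_le _) (mem_univ i)⟩
  have hC0 : 2 ≤ C := by have := hCi i₀; have := hb i₀; omega
  obtain ⟨J, hJB, hJ1, hJexp⟩ := exists_large_two_pow (C * (X + 1) + 1)
  obtain ⟨z, hz⟩ : ∃ z, z = 2 ^ (v * 2 ^ J) := ⟨_, rfl⟩
  have hz2 : 2 ^ 2 ^ J ≤ z := hz ▸ Nat.pow_le_pow_right (by norm_num) (Nat.le_mul_of_pos_left _ hv0)
  have hz0 : 0 < z := hz ▸ by positivity
  have hvz : 2 ^ v ≤ z := hz ▸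
    Nat.pow_le_pow_right (by norm_num) (Nat.le_mul_of_pos_right _ (by positivity))
  obtain ⟨e, he⟩ : ∃ e, e = 60 * 1000 + 15 := ⟨_, rfl⟩
  obtain ⟨s, hs⟩ : ∃ s, s = 16 := ⟨_, rfl⟩
  have hse : e + 1 ≤ 2 ^ s := by subst he hs; norm_num
  obtain ⟨M, hM⟩ : ∃ M, M = 2 ^ (v * 2 ^ J * 2 ^ s) := ⟨_, rfl⟩
  have hMz : M = z ^ 2 ^ s := by rw [hM, hz, ← pow_mul]
  set Ω : ℕ → Finset ℕ := fun p => {t ∈ range p | ∃ i, p ∣ a i * t + b i} with hΩdef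
  have hcop (p : ℕ) (hp : p.Prime) (hvp : 2 ^ v < p) (i : Fin k) : p.Coprime (a i) :=
    (Nat.Prime.coprime_iff_not_dvd hp).2 (ha p hp hvp i)
  have hΩ : ∀ p, p.Prime → 2 ^ v < p → Ω p ⊆ range p ∧ #(Ω p) ≤ 1000 := by
    intro p hp hvp
    refine ⟨filter_subset _ _, ?_⟩
    choose c hc using fun i => exists_modEq_of_dvd_linear (hcop p hp hvp i) (b i)
    have h1 : Ω p ⊆ univ.image fun i => c i % p := by
      intro t ht
      obtain ⟨h2, i, hi⟩ := mem_filter.1 ht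
      refine mem_image.2 ⟨i, mem_univ _, ?_⟩
      rw [← hc i t hi, Nat.mod_eq_of_lt (mem_range.1 h2)]
    simpa [hk] using (card_le_card h1).trans card_image_le
  obtain ⟨V, hV1, -, hV⟩ := sieve_bounds (by norm_num) (show 2 * 1000 ≤ 2 ^ v from hv) hΩ J
  obtain ⟨hS, hSq⟩ := hV (M ^ 2)
  have hV0 : 0 < V := (Real.exp_pos _).trans_le hV1
  push_cast at hV1
  rw [← hz, ← he] at hS hSq
  obtain ⟨E, hE⟩ : ∃ E : ℝ, E = ((2 : ℝ) ^ (v * 2 ^ J)) ^ e := ⟨_, rfl⟩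
  simp only [← hE, ← filter_filter] at hS hSq
  obtain ⟨S, hSdef⟩ : ∃ S, S = {t ∈ range (M ^ 2) | ∀ p ∈ primesIoc (2 ^ v) z, t % p ∉ Ω p} :=
    ⟨_, rfl⟩
  rw [← hSdef] at hS
  simp only [← hSdef] at hSq
  have hmemS (t : ℕ) (ht : t ∈ S) : t < M ^ 2 ∧ ∀ p ∈ primesIoc (2 ^ v) z, t % p ∉ Ω p := by
    rw [hSdef] at ht
    exact ⟨mem_range.1 (mem_filter.1 ht).1, (mem_filter.1 ht).2⟩
  have hlarge : ∀ t ∈ S, ∀ i p, p.Prime → p ∣ a i * t + b i → z < p := by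
    intro t ht i p hp hpd
    by_contra! hpz
    rcases le_or_gt p (2 ^ v) with h | h
    · exact hsmall p hp h i t hpd
    · refine (hmemS t ht).2 p (mem_primesIoc.2 ⟨⟨h, hpz⟩, hp⟩)
        (mem_filter.2 ⟨mem_range.2 (Nat.mod_lt _ hp.pos), i, ?_⟩)
      have h1 : a i * (t % p) + b i ≡ a i * t + b i [MOD p] :=
        ((Nat.mod_modEq t p).mul_left _).add_right _
      exact (Nat.modEq_zero_iff_dvd).1 (h1.trans ((Nat.modEq_zero_iff_dvd).2 hpd))
  have hSX : ∀ t ∈ S, X < t := by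
    intro t ht
    by_contra! htX
    obtain ⟨p, hp, hpd⟩ := Nat.exists_prime_and_dvd
      (show a i₀ * t + b i₀ ≠ 1 by have := hb i₀; omega)
    have h1 := hlarge t ht i₀ p hp hpd
    have h2 := Nat.le_of_dvd (by have := hb i₀; omega) hpd
    have h3 : a i₀ * t + b i₀ ≤ C * (X + 1) := by
      have := hCi i₀
      calc a i₀ * t + b i₀ ≤ a i₀ * (X + 1) + b i₀ * (X + 1) :=
            Nat.add_le_add (Nat.mul_le_mul_left _ (by omega)) (Nat.le_mul_of_pos_right _ (by omega))
        _ = (a i₀ + b i₀) * (X + 1) := by ring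
        _ ≤ _ := Nat.mul_le_mul_right _ this
    omega
  have hCz : C < z := by nlinarith
  have hzM : z * z ≤ M := by
    rw [hMz, ← sq]
    exact Nat.pow_le_pow_right hz0 (by omega)
  have hM0 : 0 < M := hM ▸ by positivity
  have hval : ∀ t < M ^ 2, ∀ i, a i * t + b i ≤ C * M ^ 2 := by
    intro t ht i
    calc a i * t + b i ≤ a i * M ^ 2 + b i * M ^ 2 :=
          Nat.add_le_add (Nat.mul_le_mul_left _ ht.le) (Nat.le_mul_of_pos_right _ (by positivity))
      _ = (a i + b i) * M ^ 2 := by ring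
      _ ≤ _ := Nat.mul_le_mul_right _ (hCi i)
  obtain ⟨bad, hbad⟩ : ∃ bad, bad = univ.biUnion fun i : Fin k =>
    {t ∈ range (M ^ 2) | ∃ p, p.Prime ∧ z < p ∧ p ^ 2 ∣ a i * t + b i} := ⟨_, rfl⟩
  have hmembad (t p : ℕ) (i : Fin k) (ht : t < M ^ 2) (hp : p.Prime) (hzp : z < p)
      (hpd : p ^ 2 ∣ a i * t + b i) : t ∈ bad := by
    rw [hbad]
    exact mem_biUnion.2 ⟨i, mem_univ _, mem_filter.2 ⟨mem_range.2 ht, p, hp, hzp, hpd⟩⟩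
  have hbadcard : (#bad : ℝ) ≤ 1000 * ((M ^ 2 : ℕ) / z + (C * M : ℕ)) := by
    have h1 : (#bad : ℝ) ≤ ∑ i : Fin k,
        (#{t ∈ range (M ^ 2) | ∃ p, p.Prime ∧ z < p ∧ p ^ 2 ∣ a i * t + b i} : ℝ) := by
      rw [hbad]
      exact_mod_cast card_biUnion_le
    refine h1.trans ((sum_le_card_nsmul _ _ ((M ^ 2 : ℕ) / z + (C * M : ℕ) : ℝ) fun i _ => ?_).trans
      (le_of_eq ?_))
    · refine card_sq_dvd_linear_le hz0 (by have := hb i; omega)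
        (fun p hp hzp => ha p hp (hvz.trans_lt hzp) i) fun t ht => (hval t ht i).trans ?_
      rw [mul_pow, sq C]
      exact Nat.mul_le_mul_right _ (Nat.le_mul_of_pos_left _ (by omega))
    · rw [card_univ, Fintype.card_fin, nsmul_eq_mul, hk]
      norm_num
  by_contra! hno
  have hmany : ∀ t ∈ S \ bad, 250000 ≤ ∑ i, #(a i * t + b i).primeFactors := by
    intro t ht
    obtain ⟨htS, htb⟩ := mem_sdiff.1 ht
    have hsqf (i : Fin k) : Squarefree (a i * t + b i) := by
      rw [Nat.squarefree_iff_prime_squarefree]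
      intro p hp hpd
      exact htb (hmembad t p i (hmemS t htS).1 hp
        (hlarge t htS i p hp (dvd_of_mul_left_dvd hpd)) (by rwa [sq]))
    by_cases hinj : Function.Injective fun i => #(a i * t + b i).primeFactors
    · exact mul_self_le_sum_of_injective (m := 500) hk hinj
    · rw [Function.Injective] at hinj
      push Not at hinj
      obtain ⟨i, j, hij, hne⟩ := hinj
      have h1 := hno t (hSX t htS) i j hne (hsqf i) (hsqf j) hij
      exact h1.le.trans (single_le_sum (f := fun i => #(a i * t + b i).primeFactors)
        (fun _ _ => Nat.zero_le _) (mem_univ i))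
  have hup : ∑ t ∈ S, ∑ i, (#(a i * t + b i).primeFactors : ℝ) ≤
      2000 * #S + 1000 * (96 * V * (M ^ 2 : ℕ) + M * E) := by
    have h1 : ∑ t ∈ S, ∑ i, (#(a i * t + b i).primeFactors : ℝ) ≤
        ∑ t ∈ S, ∑ i, ((#{p ∈ primesIoc z M | p ∣ a i * t + b i} : ℝ) + 2) := by
      refine sum_le_sum fun t ht => sum_le_sum fun i _ => ?_
      have hlt : a i * t + b i < M ^ 3 := by
        refine (hval t (hmemS t ht).1 i).trans_lt ?_
        rw [pow_succ' M 2]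
        exact Nat.mul_lt_mul_of_pos_right (by nlinarith) (by positivity)
      exact_mod_cast card_primeFactors_le_add_two (by have := hb i; omega) hlt fun p hp =>
        hlarge t ht i p (Nat.prime_of_mem_primeFactors hp) (Nat.dvd_of_mem_primeFactors hp)
    have h2 (i : Fin k) : ∑ t ∈ S, (#{p ∈ primesIoc z M | p ∣ a i * t + b i} : ℝ) ≤
        96 * V * (M ^ 2 : ℕ) + M * E := by
      have h3 : ∑ t ∈ S, #{p ∈ primesIoc z M | p ∣ a i * t + b i} =
          ∑ p ∈ primesIoc z M, #{t ∈ S | p ∣ a i * t + b i} :=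
        sum_card_bipartiteAbove_eq_sum_card_bipartiteBelow fun t p => p ∣ a i * t + b i
      have h4 : ∀ p ∈ primesIoc z M, (#{t ∈ S | p ∣ a i * t + b i} : ℝ) ≤
          3 / 2 * V * (M ^ 2 : ℕ) * (1 / p) + E := by
        intro p hp
        obtain ⟨⟨hzp, -⟩, hpp⟩ := mem_primesIoc.1 hp
        obtain ⟨c, hc⟩ := exists_modEq_of_dvd_linear (hcop p hpp (hvz.trans_lt hzp) i) (b i)
        have h5 := hSq p c hpp.pos fun q hq hqp => by
          obtain ⟨⟨-, h6⟩, h7⟩ := mem_primesIoc.1 hq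
          have := (Nat.prime_dvd_prime_iff_eq h7 hpp).1 hqp
          omega
        rw [mul_one_div]
        refine le_trans ?_ h5
        exact_mod_cast card_le_card (monotone_filter_right _ fun t _ ht => hc t ht)
      have h5 : ∑ p ∈ primesIoc z M, (1 : ℝ) / p ≤ 4 * (s : ℕ) :=
        by
        rw [hz, hM]; exact sum_inv_primesIoc_two_pow_le (by positivity) s
      have h6 : (#(primesIoc z M) : ℝ) ≤ M := by
        have := (card_le_card (filter_subset _ _ : primesIoc z M ⊆ Ioc z M))
        rw [Nat.card_Ioc] at this
        exact_mod_cast this.trans (Nat.sub_le _ _)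
      have hE0 : 0 ≤ E := hE ▸ by positivity
      calc ∑ t ∈ S, (#{p ∈ primesIoc z M | p ∣ a i * t + b i} : ℝ)
          = ∑ p ∈ primesIoc z M, (#{t ∈ S | p ∣ a i * t + b i} : ℝ) := by exact_mod_cast h3
        _ ≤ ∑ p ∈ primesIoc z M, (3 / 2 * V * (M ^ 2 : ℕ) * (1 / p) + E) := sum_le_sum h4
        _ = 3 / 2 * V * (M ^ 2 : ℕ) * ∑ p ∈ primesIoc z M, (1 : ℝ) / p +
            #(primesIoc z M) * E := by
          rw [sum_add_distrib, ← mul_sum, sum_const, nsmul_eq_mul]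
        _ ≤ 3 / 2 * V * (M ^ 2 : ℕ) * (4 * (s : ℕ)) + M * E := by gcongr
        _ = _ := by rw [hs]; push_cast; ring
    refine h1.trans ?_
    rw [sum_comm]
    simp only [sum_add_distrib]
    have h3 := sum_le_card_nsmul univ _ _ fun (i : Fin k) _ => h2 i
    simp only [card_univ, Fintype.card_fin, nsmul_eq_mul, hk] at h3
    simp only [sum_const, card_univ, Fintype.card_fin, nsmul_eq_mul, hk]
    push_cast at h3 ⊢
    linarith
  have hlow : (250000 : ℝ) * (#S - #bad) ≤ ∑ t ∈ S, ∑ i, (#(a i * t + b i).primeFactors : ℝ) := by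
    have h1 : (#S : ℝ) ≤ #(S \ bad) + #bad := by
      have := le_card_sdiff bad S
      exact_mod_cast (by omega : #S ≤ #(S \ bad) + #bad)
    have h2 : (#(S \ bad) * 250000 : ℝ) ≤
        ∑ t ∈ S \ bad, ∑ i, (#(a i * t + b i).primeFactors : ℝ) := by
      exact_mod_cast card_nsmul_le_sum _ _ _ hmany
    have h3 : ∑ t ∈ S \ bad, ∑ i, (#(a i * t + b i).primeFactors : ℝ) ≤
        ∑ t ∈ S, ∑ i, (#(a i * t + b i).primeFactors : ℝ) :=
      sum_le_sum_of_subset_of_nonneg sdiff_subset fun _ _ _ =>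
        sum_nonneg fun _ _ => Nat.cast_nonneg _
    linarith
  have hzR : (1 : ℝ) ≤ z := by exact_mod_cast hz0
  have hER : E = (z : ℝ) ^ e := by rw [hE, hz]; push_cast; rfl
  have hMR : (M : ℝ) = (z : ℝ) ^ 2 ^ s := by exact_mod_cast hMz
  have hME : E * z ≤ M := by
    rw [hER, hMR, ← pow_succ]
    exact pow_le_pow_right₀ hzR hse
  have hM1 : (z : ℝ) ≤ M := by exact_mod_cast (by nlinarith : z ≤ M)
  have hJz : (J : ℝ) + 1 ≤ M := le_trans (by exact_mod_cast hJ1.trans hz2) hM1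
  have hCM : (C : ℝ) * z ≤ M := by exact_mod_cast (by nlinarith : C * z ≤ M)
  have hVz : 30000 < V * z := by
    have h1 : (2 : ℝ) ^ 2 ^ J ≤ z := by exact_mod_cast hz2
    calc (30000 : ℝ) < _ := hJexp
      _ ≤ V * z := mul_le_mul hV1 h1 (by positivity) hV0.le
  have hMp : (0 : ℝ) < M := by exact_mod_cast hM0
  have hzp : (0 : ℝ) < z := by linarith
  push_cast at hS hup hbadcard
  have e1 : M * E * z ≤ (M : ℝ) ^ 2 := by nlinarith
  have e2 : ((J : ℝ) + 1) * E * z ≤ (M : ℝ) ^ 2 := by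
    have h1 : 0 ≤ E := by rw [hER]; positivity
    calc ((J : ℝ) + 1) * E * z = ((J : ℝ) + 1) * (E * z) := by ring
      _ ≤ M * M := by gcongr
      _ = _ := by ring
  have e3 : (C : ℝ) * M * z ≤ (M : ℝ) ^ 2 := by nlinarith
  have e4 : (M : ℝ) ^ 2 / z * z = (M : ℝ) ^ 2 := by field_simp
  have e5 : 30000 * (M : ℝ) ^ 2 < V * z * (M : ℝ) ^ 2 := by
    have : 0 < (M : ℝ) ^ 2 := by positivity
    gcongr
  have f : 28000 * V * (M : ℝ) ^ 2 ≤ 1000 * (M * E) +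
      250000 * (1000 * ((M : ℝ) ^ 2 / z + C * M)) + 248000 * (((J : ℝ) + 1) * E) := by
    linarith
  have f2 := mul_le_mul_of_nonneg_right f hzp.le
  nlinarith

/-- Linear forms `a i * t + b i`, any two of which have multiples with the difference `n`. The
numbers of divisors of the multipliers `c i j` are in the ratio given by the weights `s`. -/
structure FormSystem (n K : ℕ) {k : ℕ} (a b s : Fin k → ℕ) (c : Fin k → Fin k → ℕ) : Prop where
  a_pos (i) : 0 < a i
  b_pos (i) : 0 < b i
  s_pos (i) : 0 < s i
  c_pos (i j) : 0 < c i j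
  coprime (i) : (a i).Coprime (b i)
  dvd (i) : K ∣ a i
  mul_a (i j) : i ≠ j → c i j * a i = c j i * a j
  mul_b (i j) : i ≠ j → c i j * b i = c j i * b j + n ∨ c i j * b i + n = c j i * b j
  card_divisors (i j) : i ≠ j → s i * #(c i j).divisors = s j * #(c j i).divisors

lemma exists_distinct_primes (k B : ℕ) :
    ∃ q : Fin k → ℕ, (∀ i, (q i).Prime) ∧ q.Injective ∧ ∀ i, B < q i := by
  have hmono := Nat.nth_strictMono Nat.infinite_setOfPred_prime
  refine ⟨fun i => Nat.nth Nat.Prime (B + 1 + i), fun i => Nat.prime_nth_prime _, ?_, fun i => ?_⟩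
  · intro i j hij
    have := hmono.injective hij
    exact Fin.ext (by omega)
  · have : B + 1 + i ≤ Nat.nth Nat.Prime (B + 1 + i) := hmono.le_apply
    change B < Nat.nth Nat.Prime (B + 1 + i)
    omega

lemma card_divisors_prod_prime_pow {ι : Type*} (S : Finset ι) {q : ι → ℕ}
    (hq : ∀ i, (q i).Prime) (hinj : q.Injective) (f : ι → ℕ) :
    #(∏ i ∈ S, q i ^ f i).divisors = ∏ i ∈ S, (f i + 1) := by
  classical
  induction S using Finset.induction_on with
  | empty => simp
  | insert i S hi ih =>
    rw [prod_insert hi, prod_insert hi, Nat.Coprime.card_divisors_mul, ih,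
      Nat.divisors_prime_pow (hq i), card_map, card_range]
    exact Nat.Coprime.prod_right fun j hj => Nat.Coprime.pow _ _
      ((Nat.coprime_primes (hq i) (hq j)).2 fun h => hi (hinj h ▸ hj))

lemma exists_linear_modEq {a m : ℕ} (hm : 0 < m) (h : a.Coprime m) (b r : ℕ) :
    ∃ y, a * y + b ≡ r [MOD m] := by
  have : NeZero m := ⟨hm.ne'⟩
  obtain ⟨u, hu⟩ := (ZMod.isUnit_iff_coprime a m).2 h
  refine ⟨((↑u⁻¹ : ZMod m) * (r - b)).val, ?_⟩
  rw [← ZMod.natCast_eq_natCast_iff]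
  push_cast
  rw [ZMod.natCast_zmod_val, ← hu, Units.mul_inv_cancel_left, sub_add_cancel]

/-- The numbers of divisors of the multipliers can be changed by dividing the values of the forms
on a suitable residue class by powers of new primes. -/
lemma FormSystem.multiply {n K k : ℕ} (hn : 0 < n) {a b s : Fin k → ℕ} {c : Fin k → Fin k → ℕ}
    (F : FormSystem n K a b s c) {s' β : Fin k → ℕ} {T : ℕ} (hs' : ∀ i, 0 < s' i)
    (hβ : ∀ i, 0 < β i) (hT : ∀ i, s' i * (β i + 1) = T * s i) (B : ℕ) :
    ∃ q a' b' : Fin k → ℕ, (∀ i, (q i).Prime) ∧ q.Injective ∧ (∀ i, B < q i) ∧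
      (∀ i, a' i * q i ^ β i = a i * ∏ l, q l ^ (β l + 1)) ∧
      FormSystem n K a' b' s' (fun i j => c i j * q i ^ β i) := by
  obtain ⟨q, hq, hinj, hB⟩ :=
    exists_distinct_primes k (B + n + ∑ i, a i + ∑ i, ∑ j, c i j)
  have hqa (i j) : ¬ q i ∣ a j := fun h => by
    have h1 := Nat.le_of_dvd (F.a_pos j) h
    have h2 := single_le_sum (f := a) (fun _ _ => Nat.zero_le _) (mem_univ j)
    have := hB i
    omega
  have hqc (i j l) : ¬ q i ∣ c j l := fun h => by
    have h1 := Nat.le_of_dvd (F.c_pos j l) h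
    have h2 := single_le_sum (f := c j) (fun _ _ => Nat.zero_le _) (mem_univ l)
    have h3 : ∑ l, c j l ≤ ∑ j, ∑ l, c j l :=
      single_le_sum (f := fun j => ∑ l, c j l) (fun _ _ => Nat.zero_le _) (mem_univ j)
    have := hB i
    omega
  have hqn (i) : ¬ q i ∣ n := fun h => by
    have h1 := Nat.le_of_dvd hn h
    have := hB i
    omega
  choose y hy using fun i => exists_linear_modEq (a := a i) (m := q i ^ (β i + 1))
    (pow_pos (hq i).pos _) (((Nat.Prime.coprime_iff_not_dvd (hq i)).2 (hqa i i)).symm.pow_right _)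
    (b i) (q i ^ β i)
  obtain ⟨x, hx⟩ := Nat.chineseRemainderOfFinset y (fun i => q i ^ (β i + 1)) univ
    (fun i _ => (pow_pos (hq i).pos _).ne') fun i _ j _ hij => Nat.Coprime.pow _ _
      ((Nat.coprime_primes (hq i) (hq j)).2 fun h => hij (hinj h))
  have hL (i) : a i * x + b i ≡ q i ^ β i [MOD q i ^ (β i + 1)] :=
    (((hx i (mem_univ i)).mul_left _).add_right _).trans (hy i)
  have hLd (i) : q i ^ β i ∣ a i * x + b i :=
    ((hL i).dvd_iff (pow_dvd_pow _ (Nat.le_succ _))).2 dvd_rfl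
  choose b' hb' using hLd
  set Q := ∏ l, q l ^ (β l + 1) with hQ
  have hQ0 : 0 < Q := prod_pos fun l _ => pow_pos (hq l).pos _
  have hQd (i) : q i ^ β i ∣ Q :=
    (pow_dvd_pow _ (Nat.le_succ _)).trans (dvd_prod_of_mem (fun l => q l ^ (β l + 1)) (mem_univ i))
  choose R hR using hQd
  have hqb (i) : ¬ q i ∣ b' i := by
    intro h
    have h1 : q i ^ (β i + 1) ∣ a i * x + b i := by
      rw [hb' i, pow_succ]
      exact mul_dvd_mul_left _ h
    have h2 := ((hL i).dvd_iff dvd_rfl).1 h1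
    have h3 := (Nat.pow_dvd_pow_iff_le_right (hq i).one_lt).1 h2
    omega
  have hlink (i j) (hij : i ≠ j) : c i j * (a i * x + b i) = c j i * (a j * x + b j) + n ∨
      c i j * (a i * x + b i) + n = c j i * (a j * x + b j) := by
    have h1 := F.mul_a i j hij
    have h2 : c i j * (a i * x + b i) = c j i * a j * x + c i j * b i := by rw [← h1]; ring
    have h3 : c j i * (a j * x + b j) = c j i * a j * x + c j i * b j := by ring
    rcases F.mul_b i j hij with h | h
    · left; omega
    · right; omega
  have hqb' (i l) : ¬ q l ∣ b' i := by
    intro h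
    rcases eq_or_ne i l with rfl | hil
    · exact hqb i h
    have h1 : q l ∣ a i * x + b i := by rw [hb' i]; exact dvd_mul_of_dvd_right h _
    have h2 : q l ∣ a l * x + b l := by
      rw [hb' l]
      exact dvd_mul_of_dvd_left (dvd_pow_self _ (hβ l).ne') _
    have h3 := dvd_mul_of_dvd_right h1 (c i l)
    have h4 := dvd_mul_of_dvd_right h2 (c l i)
    rcases hlink i l hil with h5 | h5
    · rw [h5] at h3
      exact hqn l ((Nat.dvd_add_right h4).1 h3)
    · rw [← h5] at h4
      exact hqn l ((Nat.dvd_add_right h3).1 h4)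
  have hLpos (i) : 0 < a i * x + b i := Nat.add_pos_right _ (F.b_pos i)
  refine ⟨q, fun i => a i * R i, b', hq, hinj, fun i => by have := hB i; omega, fun i => ?_, ?_⟩
  · change a i * R i * q i ^ β i = a i * Q
    rw [hR i]
    ring
  have hRpos (i) : 0 < R i := Nat.pos_of_ne_zero fun h => by
    rw [hR i, h, mul_zero] at hQ0
    exact hQ0.false
  refine ⟨fun i => Nat.mul_pos (F.a_pos i) (hRpos i), fun i => ?_, hs',
    fun i j => Nat.mul_pos (F.c_pos i j) (pow_pos (hq i).pos _), fun i => ?_,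
    fun i => dvd_mul_of_dvd_left (F.dvd i) _, fun i j hij => ?_, fun i j hij => ?_,
    fun i j hij => ?_⟩
  · refine Nat.pos_of_ne_zero fun h => ?_
    have := hLpos i
    rw [hb' i, h, mul_zero] at this
    exact this.false
  · have h1 : (a i).Coprime (b' i) := by
      refine Nat.Coprime.coprime_dvd_right (Dvd.intro_left _ (hb' i).symm) ?_
      rw [mul_comm, Nat.coprime_mul_right_add_right]
      exact F.coprime i
    refine Nat.Coprime.mul_left h1 (Nat.Coprime.coprime_dvd_left (Dvd.intro_left _ (hR i).symm) ?_)
    exact Nat.Coprime.prod_left fun l _ =>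
      ((Nat.Prime.coprime_iff_not_dvd (hq l)).2 (hqb' i l)).pow_left _
  · have h1 := F.mul_a i j hij
    calc c i j * q i ^ β i * (a i * R i) = c i j * a i * (q i ^ β i * R i) := by ring
      _ = c j i * a j * (q j ^ β j * R j) := by rw [h1, ← hR i, ← hR j]
      _ = _ := by ring
  · have h1 := hlink i j hij
    rw [hb' i, hb' j, ← mul_assoc, ← mul_assoc] at h1
    exact h1
  · have h1 (i j) : #(c i j * q i ^ β i).divisors = #(c i j).divisors * (β i + 1) := by
      rw [Nat.Coprime.card_divisors_mul
        (((Nat.Prime.coprime_iff_not_dvd (hq i)).2 (hqc i i j)).symm.pow_right _),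
        Nat.divisors_prime_pow (hq i), card_map, card_range]
    rw [h1, h1]
    calc s' i * (#(c i j).divisors * (β i + 1))
        = s' i * (β i + 1) * #(c i j).divisors := by ring
      _ = T * (s i * #(c i j).divisors) := by rw [hT]; ring
      _ = T * (s j * #(c j i).divisors) := by rw [F.card_divisors i j hij]
      _ = s' j * (β j + 1) * #(c j i).divisors := by rw [hT]; ring
      _ = _ := by ring

lemma card_divisors_mul_prod_prime_pow {k : ℕ} {q : Fin k → ℕ} (hq : ∀ i, (q i).Prime)
    (hinj : q.Injective) (w : Fin k → ℕ) (α : ℕ) {N : ℕ} (hN : ∀ l, N.Coprime (q l)) (i : Fin k) :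
    #(N * (q i ^ α * ∏ l, q l ^ w l)).divisors =
      #N.divisors * ((w i + 1 + α) * ∏ l ∈ univ.erase i, (w l + 1)) := by
  have h1 : q i ^ α * ∏ l, q l ^ w l = ∏ l, q l ^ (w l + if l = i then α else 0) := by
    simp_rw [pow_add, prod_mul_distrib, pow_ite, pow_zero, prod_ite_eq', mem_univ, if_true]
    rw [mul_comm]
  have h2 : ∏ l, (w l + (if l = i then α else 0) + 1) =
      (w i + 1 + α) * ∏ l ∈ univ.erase i, (w l + 1) := by
    rw [← mul_prod_erase univ _ (mem_univ i), if_pos rfl]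
    congr 1
    · ring
    · exact prod_congr rfl fun l hl => by rw [if_neg (ne_of_mem_erase hl), add_zero]
  rw [h1, Nat.Coprime.card_divisors_mul, card_divisors_prod_prime_pow univ hq hinj, h2]
  exact Nat.Coprime.prod_right fun l _ => (hN l).pow_right _

/-- Exponents which equalize the products `τ i * (u i + α) * ∏ l ≠ i, u l`. -/
lemma exists_balancing_exponents {k : ℕ} (τ : Fin k → ℕ) (hτ : ∀ i, 0 < τ i) :
    ∃ (α : ℕ) (w : Fin k → ℕ) (H : ℕ), 0 < α ∧ 0 < H ∧ (∀ i, 0 < w i) ∧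
      ∀ i, τ i * ((w i + 1 + α) * ∏ l ∈ univ.erase i, (w l + 1)) = H := by
  have h1 (i) : ∃ γ, 0 < γ ∧ τ i + γ = 1 + ∑ l, τ l := by
    have := single_le_sum (f := τ) (fun _ _ => Nat.zero_le _) (mem_univ i)
    exact ⟨1 + ∑ l, τ l - τ i, by omega, by omega⟩
  choose γ hγ0 hγ using h1
  set C := 1 + ∑ l, τ l
  have h2 (i) : ∃ w, 0 < w ∧ w + 1 = 2 * (τ i * ∏ l ∈ univ.erase i, γ l) := by
    have : 0 < τ i * ∏ l ∈ univ.erase i, γ l :=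
      Nat.mul_pos (hτ i) (prod_pos fun l _ => hγ0 l)
    exact ⟨2 * (τ i * ∏ l ∈ univ.erase i, γ l) - 1, by omega, by omega⟩
  choose w hw0 hw using h2
  refine ⟨2 * ∏ l, γ l, w, C * ∏ l, (w l + 1), ?_, ?_, hw0, fun i => ?_⟩
  · exact Nat.mul_pos two_pos (prod_pos fun l _ => hγ0 l)
  · exact Nat.mul_pos (by omega) (prod_pos fun l _ => Nat.succ_pos _)
  · rw [← mul_prod_erase univ (fun l => w l + 1) (mem_univ i),
      ← mul_prod_erase univ γ (mem_univ i), ← hγ i, hw i]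
    ring

/-- A further form can be added to a system with equal numbers of divisors, at the price of unequal
weights. -/
lemma FormSystem.extend {n K k : ℕ} (hn : 0 < n) (hK : 0 < K) {a b : Fin k → ℕ}
    {c : Fin k → Fin k → ℕ} (F : FormSystem n K a b (fun _ => 1) c) :
    ∃ (a' b' s' : Fin (k + 1) → ℕ) (c' : Fin (k + 1) → Fin (k + 1) → ℕ),
      FormSystem n K a' b' s' c' := by
  obtain ⟨D, hD0, hKD, hnD, hcD⟩ : ∃ D : ℕ, 0 < D ∧ K ∣ D ∧ n ∣ D ∧ ∀ i j, c i j ∣ D :=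
    ⟨K * n * ∏ i, ∏ j, c i j,
      Nat.mul_pos (Nat.mul_pos hK hn) (prod_pos fun i _ => prod_pos fun j _ => F.c_pos i j),
      dvd_mul_of_dvd_left (dvd_mul_right _ _) _, dvd_mul_of_dvd_left (dvd_mul_left _ _) _,
      fun i j => dvd_mul_of_dvd_right ((dvd_prod_of_mem (c i) (mem_univ j)).trans
        (dvd_prod_of_mem (fun i => ∏ j, c i j) (mem_univ i))) _⟩
  obtain ⟨r, hr⟩ : ∃ r : Fin k → ℕ, ∀ i, r i = D * ∏ l ∈ univ.erase i, a l := ⟨_, fun _ => rfl⟩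
  have hra (i) : r i * a i = D * ∏ l, a l := by
    rw [hr, ← mul_prod_erase univ a (mem_univ i)]
    ring
  have hr0 (i) : 0 < r i := by
    rw [hr]
    exact Nat.mul_pos hD0 (prod_pos fun l _ => F.a_pos l)
  have hDr (i) : D ∣ r i := by
    rw [hr]
    exact dvd_mul_right _ _
  obtain ⟨A₁, hA₁⟩ : ∃ A₁, A₁ = D * ∏ l, a l := ⟨_, rfl⟩
  simp_rw [← hA₁] at hra
  have hA₁0 : 0 < A₁ := by
    rw [hA₁]
    exact Nat.mul_pos hD0 (prod_pos fun l _ => F.a_pos l)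
  obtain ⟨α, w, H, hα, hH, hw, hbal⟩ := exists_balancing_exponents
    (fun i => #(n * r i).divisors)
    (fun i => card_pos.2 (Nat.nonempty_divisors.2 (Nat.mul_pos hn (hr0 i)).ne'))
  obtain ⟨q, a', b', hq, hinj, hB, haq, F'⟩ := F.multiply hn (s' := fun _ => 1)
    (β := fun _ => α) (T := α + 1) (fun _ => one_pos) (fun _ => hα) (fun _ => by ring) (n * A₁)
  obtain ⟨e, he⟩ : ∃ e : Fin k → Fin k → ℕ, e = fun i j => c i j * q i ^ α := ⟨_, rfl⟩
  rw [← he] at F'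
  obtain ⟨g, hg⟩ : ∃ g : Fin k → ℕ, ∀ i, g i = r i * (q i ^ α * ∏ l, q l ^ w l) :=
    ⟨_, fun _ => rfl⟩
  obtain ⟨A, hA⟩ : ∃ A, A = A₁ * ∏ l, q l ^ (α + 1 + w l) := ⟨_, rfl⟩
  have hA0 : 0 < A := by
    rw [hA]
    exact Nat.mul_pos hA₁0 (prod_pos fun l _ => pow_pos (hq l).pos _)
  have hga (i) : g i * a' i = A := by
    calc g i * a' i = r i * (a' i * q i ^ α) * ∏ l, q l ^ w l := by rw [hg]; ring
      _ = r i * a i * ((∏ l, q l ^ (α + 1)) * ∏ l, q l ^ w l) := by rw [haq]; ring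
      _ = A := by simp_rw [hra, hA, ← prod_mul_distrib, ← pow_add]
  have hg0 (i) : 0 < g i := by
    refine Nat.pos_of_ne_zero fun h => ?_
    have := hga i
    rw [h, zero_mul] at this
    omega
  have hDg (i) : D ∣ g i := by
    rw [hg]
    exact dvd_mul_of_dvd_left (hDr i) _
  have hqg (i j) : q i ∣ g j := by
    rw [hg]
    exact dvd_mul_of_dvd_right (dvd_mul_of_dvd_right ((dvd_pow_self _ (hw i).ne').trans
      (dvd_prod_of_mem (fun l => q l ^ w l) (mem_univ i))) _) _
  have hdg (i) : #(n * g i).divisors = H := by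
    rw [hg, ← mul_assoc, card_divisors_mul_prod_prime_pow hq hinj, hbal]
    intro l
    refine ((Nat.Prime.coprime_iff_not_dvd (hq l)).2 fun h => ?_).symm
    have h1 := Nat.le_of_dvd (Nat.mul_pos hn hA₁0)
      (h.trans (mul_dvd_mul_left n (Dvd.intro _ (hra i))))
    have := hB l
    omega
  obtain ⟨m, hm⟩ : ∃ m : Fin k → ℕ, ∀ i, m i = g i * b' i + 1 := ⟨_, fun _ => rfl⟩
  have hm0 (i) : 0 < m i := by rw [hm]; exact Nat.succ_pos _
  have hmg (i) {x : ℕ} (hx : x ∣ g i) : x.Coprime (m i) := by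
    refine Nat.Coprime.coprime_dvd_left (hx.trans (dvd_mul_right _ (b' i))) ?_
    rw [hm]
    simp
  have hmb (i) : (m i).Coprime (b' i) := by
    rw [hm, Nat.coprime_comm]
    simp
  have hmn (i) : n.Coprime (m i) := hmg i (hnD.trans (hDg i))
  have hme (i j) : (e i j).Coprime (m j) := by
    rw [he]
    exact Nat.Coprime.mul_left (hmg j ((hcD i j).trans (hDg j))) ((hmg j (hqg i j)).pow_left _)
  have heg (i j) (hij : i ≠ j) : e i j * g j = e j i * g i := by
    have h1 := F'.mul_a i j hij
    refine Nat.eq_of_mul_eq_mul_right (Nat.mul_pos (F'.a_pos i) (F'.a_pos j)) ?_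
    calc e i j * g j * (a' i * a' j) = e i j * a' i * (g j * a' j) := by ring
      _ = e j i * a' j * (g i * a' i) := by rw [h1, hga, hga]
      _ = _ := by ring
  have hd0 : 0 < #n.divisors := card_pos.2 (Nat.nonempty_divisors.2 hn.ne')
  refine ⟨Fin.cons A fun i => a' i * m i, Fin.cons 1 b',
    Fin.cons H fun i => #n.divisors * #(m i).divisors,
    Fin.cons (Fin.cons 1 fun i => n * m i) fun i => Fin.cons (n * g i) fun j => e i j * m j,
    ?_, ?_, ?_, ?_, ?_, ?_, ?_, ?_, ?_⟩
  · refine Fin.cases ?_ fun i => ?_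
    · exact hA0
    · exact Nat.mul_pos (F'.a_pos i) (hm0 i)
  · refine Fin.cases ?_ fun i => ?_
    · exact one_pos
    · exact F'.b_pos i
  · refine Fin.cases ?_ fun i => ?_
    · exact hH
    · exact Nat.mul_pos hd0 (card_pos.2 (Nat.nonempty_divisors.2 (hm0 i).ne'))
  · refine Fin.cases (Fin.cases ?_ fun i => ?_) fun i => Fin.cases ?_ fun j => ?_
    · exact one_pos
    · exact Nat.mul_pos hn (hm0 i)
    · exact Nat.mul_pos hn (hg0 i)
    · exact Nat.mul_pos (F'.c_pos i j) (hm0 j)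
  · refine Fin.cases ?_ fun i => ?_
    · exact Nat.coprime_one_right _
    · exact Nat.Coprime.mul_left (F'.coprime i) (hmb i)
  · refine Fin.cases ?_ fun i => ?_
    · change K ∣ A
      rw [hA, hA₁]
      exact dvd_mul_of_dvd_left (dvd_mul_of_dvd_left hKD _) _
    · exact dvd_mul_of_dvd_left (F'.dvd i) _
  · have h1 (i) : n * m i * A = n * g i * (a' i * m i) := by
      rw [← hga i]
      ring
    refine Fin.cases (Fin.cases ?_ fun i => ?_) fun i => Fin.cases ?_ fun j => ?_
    · exact fun h => (h rfl).elim
    · exact fun _ => h1 i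
    · exact fun _ => (h1 i).symm
    · intro h
      have h2 := F'.mul_a i j fun hij => h (hij ▸ rfl)
      change e i j * m j * (a' i * m i) = e j i * m i * (a' j * m j)
      calc e i j * m j * (a' i * m i) = e i j * a' i * (m i * m j) := by ring
        _ = _ := by rw [h2]; ring
  · have h1 (i) : n * m i * 1 = n * g i * b' i + n := by
      rw [hm]
      ring
    refine Fin.cases (Fin.cases ?_ fun i => ?_) fun i => Fin.cases ?_ fun j => ?_
    · exact fun h => (h rfl).elim
    · exact fun _ => .inl (h1 i)
    · exact fun _ => .inr (h1 i).symm
    · intro h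
      have hij : i ≠ j := fun hij => h (hij ▸ rfl)
      have h2 : e i j * m j * b' i = e i j * g j * (b' i * b' j) + e i j * b' i := by
        rw [hm]
        ring
      have h3 : e j i * m i * b' j = e i j * g j * (b' i * b' j) + e j i * b' j := by
        rw [hm, heg i j hij]
        ring
      change e i j * m j * b' i = e j i * m i * b' j + n ∨
        e i j * m j * b' i + n = e j i * m i * b' j
      rcases F'.mul_b i j hij with h4 | h4
      · left; omega
      · right; omega
  · have h1 (i) : H * #(n * m i).divisors =
        #n.divisors * #(m i).divisors * #(n * g i).divisors := by
      rw [hdg, (hmn i).card_divisors_mul]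
      ring
    refine Fin.cases (Fin.cases ?_ fun i => ?_) fun i => Fin.cases ?_ fun j => ?_
    · exact fun h => (h rfl).elim
    · exact fun _ => h1 i
    · exact fun _ => (h1 i).symm
    · intro h
      have h2 := F'.card_divisors i j fun hij => h (hij ▸ rfl)
      change #n.divisors * #(m i).divisors * #(e i j * m j).divisors =
        #n.divisors * #(m j).divisors * #(e j i * m i).divisors
      rw [(hme i j).card_divisors_mul, (hme j i).card_divisors_mul]
      rw [one_mul, one_mul] at h2
      rw [h2]
      ring

lemma exists_formSystem {n K : ℕ} (hn : 0 < n) (hK : 0 < K) (k : ℕ) :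
    ∃ (a b : Fin k → ℕ) (c : Fin k → Fin k → ℕ), FormSystem n K a b (fun _ => 1) c := by
  induction k with
  | zero =>
    exact ⟨fun _ => 0, fun _ => 0, fun _ _ => 0, ⟨fun i => i.elim0, fun i => i.elim0,
      fun i => i.elim0, fun i => i.elim0, fun i => i.elim0, fun i => i.elim0, fun i => i.elim0,
      fun i => i.elim0, fun i => i.elim0⟩⟩
  | succ k ih =>
    obtain ⟨a, b, c, F⟩ := ih
    obtain ⟨a', b', s', c', F'⟩ := F.extend hn hK
    obtain ⟨_, a'', b'', _, _, _, _, F''⟩ := F'.multiply hn (s' := fun _ => 1)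
      (β := fun i => 2 * s' i - 1) (T := 2) (fun _ => one_pos)
      (fun i => by have := F'.s_pos i; omega) (fun i => by have := F'.s_pos i; omega) 0
    exact ⟨a'', b'', _, F''⟩

lemma exists_not_dvd_linear {k p : ℕ} (hp : p.Prime) {a b : Fin k → ℕ}
    (hab : ∀ i, (a i).Coprime (b i)) (hsmall : p ≤ k → ∀ i, p ∣ a i) :
    ∃ x, ∀ i, ¬ p ∣ a i * x + b i := by
  have hdiv (i) (hi : p ∣ a i) (x) : ¬ p ∣ a i * x + b i := fun h =>
    Nat.not_coprime_of_dvd_of_dvd hp.one_lt hi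
      ((Nat.dvd_add_right (dvd_mul_of_dvd_left hi x)).1 h) (hab i)
  rcases le_or_gt p k with hpk | hpk
  · exact ⟨0, fun i => hdiv i (hsmall hpk i) 0⟩
  have h1 (i) : ∃ r, ∀ t, p ∣ a i * t + b i → t ≡ r [MOD p] := by
    by_cases hi : p ∣ a i
    · exact ⟨0, fun t ht => (hdiv i hi t ht).elim⟩
    · exact exists_modEq_of_dvd_linear ((Nat.Prime.coprime_iff_not_dvd hp).2 hi) (b i)
  choose r hr using h1
  have h2 : #(univ.image fun i => r i % p) < #(range p) := by
    refine card_image_le.trans_lt ?_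
    rwa [card_univ, Fintype.card_fin, card_range]
  obtain ⟨x, hx, hx'⟩ := exists_mem_notMem_of_card_lt_card h2
  refine ⟨x, fun i hi => hx' (mem_image.2 ⟨i, mem_univ i, ?_⟩)⟩
  rw [← hr i x hi, Nat.mod_eq_of_lt (mem_range.1 hx)]

lemma exists_forall_not_dvd_linear {k : ℕ} {a b : Fin k → ℕ} (hab : ∀ i, (a i).Coprime (b i))
    (hsmall : ∀ p, p.Prime → p ≤ k → ∀ i, p ∣ a i) {P : Finset ℕ} (hP : ∀ p ∈ P, p.Prime) :
    ∃ x, ∀ p ∈ P, ∀ i, ¬ p ∣ a i * x + b i := by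
  have h1 (p : ℕ) : ∃ x, p.Prime → ∀ i, ¬ p ∣ a i * x + b i := by
    by_cases hp : p.Prime
    · exact (exists_not_dvd_linear hp hab (hsmall p hp)).imp fun _ h _ => h
    · exact ⟨0, fun h => (hp h).elim⟩
  choose y hy using h1
  obtain ⟨x, hx⟩ := Nat.chineseRemainderOfFinset y id P (fun p hp => (hP p hp).ne_zero)
    fun p hp q hq hpq => (Nat.coprime_primes (hP p hp) (hP q hq)).2 hpq
  refine ⟨x, fun p hp i h => hy p (hP p hp) i ?_⟩
  exact ((((hx p hp).mul_left (a i)).add_right (b i)).dvd_iff dvd_rfl).1 h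

lemma card_divisors_of_squarefree {m : ℕ} (hm : Squarefree m) :
    #m.divisors = 2 ^ #m.primeFactors := by
  rw [Nat.card_divisors hm.ne_zero]
  refine prod_eq_pow_card fun p hp => ?_
  rw [Nat.factorization_eq_one_of_squarefree hm (Nat.prime_of_mem_primeFactors hp)
    (Nat.dvd_of_mem_primeFactors hp)]

lemma FormSystem.exists_card_divisors_eq {n k : ℕ} (hk : k = 1000) {a b : Fin k → ℕ}
    {c : Fin k → Fin k → ℕ} (F : FormSystem n k.factorial a b (fun _ => 1) c) :
    ∃ M, ∀ X, ∃ x > X, x.divisors.card ≤ M ∧ (x + n).divisors.card = x.divisors.card := by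
  obtain ⟨v, hv, hav, hcv⟩ :
      ∃ v, 2000 ≤ 2 ^ v ∧ (∀ i, a i < 2 ^ v) ∧ ∀ i j, c i j < 2 ^ v := by
    refine ⟨2000 + ∑ i, a i + ∑ i, ∑ j, c i j, ?_, fun i => ?_, fun i j => ?_⟩ <;>
      have h := Nat.lt_two_pow_self (n := 2000 + ∑ i, a i + ∑ i, ∑ j, c i j)
    · omega
    · have := single_le_sum (f := a) (fun _ _ => Nat.zero_le _) (mem_univ i)
      omega
    · have h1 := single_le_sum (f := c i) (fun _ _ => Nat.zero_le _) (mem_univ j)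
      have h2 : ∑ j, c i j ≤ ∑ i, ∑ j, c i j :=
        single_le_sum (f := fun i => ∑ j, c i j) (fun _ _ => Nat.zero_le _) (mem_univ i)
      omega
  obtain ⟨V, hV⟩ : ∃ V, V = 2 ^ v := ⟨_, rfl⟩
  obtain ⟨x, hx⟩ := exists_forall_not_dvd_linear (P := (range (V + 1)).filter Nat.Prime) F.coprime
    (fun p hp hpk i => ((hp.dvd_factorial).2 hpk).trans (F.dvd i)) fun p hp => (mem_filter.1 hp).2
  obtain ⟨W, hW⟩ : ∃ W, W = ∏ p ∈ (range (V + 1)).filter Nat.Prime, p := ⟨_, rfl⟩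
  have hW0 : 0 < W := by
    rw [hW]
    exact prod_pos fun p hp => (mem_filter.1 hp).2.pos
  have hWd {p : ℕ} (hp : p.Prime) : p ∣ W ↔ p ≤ V := by
    rw [hW]
    constructor
    · intro h
      obtain ⟨q, hq, hpq⟩ := (hp.prime.dvd_finsetProd_iff _).1 h
      rw [mem_filter, mem_range] at hq
      have := Nat.le_of_dvd hq.2.pos hpq
      omega
    · exact fun h => dvd_prod_of_mem _ (mem_filter.2 ⟨mem_range.2 (by omega), hp⟩)
  have hsmall (p : ℕ) (hp : p.Prime) (hpV : p ≤ V) (i : Fin k) (t : ℕ) :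
      ¬ p ∣ a i * W * t + (a i * (x + 2 * W) + b i) := by
    intro h
    refine hx p (mem_filter.2 ⟨mem_range.2 (by omega), hp⟩) i ?_
    have h1 : a i * W * t + (a i * (x + 2 * W) + b i) =
        W * (a i * t + 2 * a i) + (a i * x + b i) := by ring
    rw [h1] at h
    exact (Nat.dvd_add_right (dvd_mul_of_dvd_left ((hWd hp).2 hpV) _)).1 h
  have hpair := exists_squarefree_pair hk hv (a := fun i => a i * W)
    (b := fun i => a i * (x + 2 * W) + b i)
    (fun i => by
      have := Nat.mul_pos (F.a_pos i) hW0
      have h : a i * (x + 2 * W) = a i * x + 2 * (a i * W) := by ring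
      omega)
    (fun p hp hpv i h => by
      rcases hp.dvd_mul.1 h with h | h
      · have := Nat.le_of_dvd (F.a_pos i) h
        have := hav i
        omega
      · have := (hWd hp).1 h
        omega)
    (fun p hp hpv => hsmall p hp (hV ▸ hpv))
  obtain ⟨ℓ, hℓ⟩ : ∃ ℓ : Fin k → ℕ → ℕ,
      ∀ i t, ℓ i t = a i * W * t + (a i * (x + 2 * W) + b i) := ⟨_, fun _ _ => rfl⟩
  simp_rw [← hℓ] at hpair hsmall
  generalize 250000 = N at hpair
  have hlt (i t) : t ≤ ℓ i t := by
    rw [hℓ]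
    exact (Nat.le_mul_of_pos_left t (Nat.mul_pos (F.a_pos i) hW0)).trans (Nat.le_add_right _ _)
  have hcop (i j t) : (c i j).Coprime (ℓ i t) := Nat.Coprime.symm <|
    Nat.coprime_of_dvd fun p hp h1 h2 => hsmall p hp (by
      have := Nat.le_of_dvd (F.c_pos i j) h2
      have := hcv i j
      omega) i t h1
  have hdiff (i j t) (hij : i ≠ j) :
      c i j * ℓ i t = c j i * ℓ j t + n ∨ c i j * ℓ i t + n = c j i * ℓ j t := by
    have h1 (i j) : c i j * ℓ i t = c i j * a i * (W * t + x + 2 * W) + c i j * b i := by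
      rw [hℓ]
      ring
    have h2 := F.mul_a i j hij
    rw [h1, h1, h2]
    rcases F.mul_b i j hij with h | h
    · left; omega
    · right; omega
  have hle (i j t) : t ≤ c i j * ℓ i t :=
    (hlt i t).trans (Nat.le_mul_of_pos_left _ (F.c_pos i j))
  refine ⟨V * 2 ^ N, fun X => ?_⟩
  obtain ⟨t, ht, i, j, hij, hi, hj, hω, hN⟩ := hpair X
  have hcd (i j) (h : Squarefree (ℓ i t)) :
      #(c i j * ℓ i t).divisors = #(c i j).divisors * 2 ^ #(ℓ i t).primeFactors := by
    rw [(hcop i j t).card_divisors_mul, card_divisors_of_squarefree h]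
  have hd := F.card_divisors i j hij
  rw [one_mul, one_mul] at hd
  have heq : #(c i j * ℓ i t).divisors = #(c j i * ℓ j t).divisors := by
    rw [hcd i j hi, hcd j i hj, hd, hω]
  have hM : #(c i j * ℓ i t).divisors ≤ V * 2 ^ N := by
    rw [hcd i j hi]
    refine Nat.mul_le_mul ((Nat.card_divisors_le_self _).trans ?_)
      (Nat.pow_le_pow_right two_pos hN)
    rw [hV]
    exact (hcv i j).le
  rcases hdiff i j t hij with h | h
  · exact ⟨_, ht.trans_le (hle j i t), heq ▸ hM, by rw [← h, heq]⟩
  · exact ⟨_, ht.trans_le (hle i j t), hM, by rw [h, heq]⟩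

/-- For every positive integer `n`, there is a positive integer `A` such that
`d(x) = d(x + n) = A` for infinitely many positive integers `x`. -/
theorem stmt_18 (n : ℕ) (hn : 0 < n) :
    ∃ A : ℕ, 0 < A ∧
      {x : ℕ | 0 < x ∧ x.divisors.card = A ∧ (x + n).divisors.card = A}.Infinite := by
  obtain ⟨k, hk⟩ : ∃ k, k = 1000 := ⟨_, rfl⟩
  obtain ⟨a, b, c, F⟩ := exists_formSystem hn k.factorial_pos k
  obtain ⟨M, hM⟩ := F.exists_card_divisors_eq hk
  by_contra! h
  have hfin : (⋃ A ∈ (Set.Icc 1 M : Set ℕ),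
      {x : ℕ | 0 < x ∧ x.divisors.card = A ∧ (x + n).divisors.card = A}).Finite :=
    (Set.finite_Icc 1 M).biUnion fun A hA => h A hA.1
  obtain ⟨X, hX⟩ := hfin.bddAbove
  obtain ⟨x, hx, hxM, hxn⟩ := hM X
  have hx0 : 0 < x := by omega
  refine hx.not_ge (hX (Set.mem_biUnion ?_ ⟨hx0, rfl, hxn⟩))
  exact ⟨card_pos.2 (Nat.nonempty_divisors.2 hx0.ne'), hxM⟩
end
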